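/- Let d ∈ {4,5,6} and let V, W ⊆ S^d be disjoint equivalent polybox codes without twin pairs with |V| = |W| = 12, such that V is extensible to a partition code (there is a partition code U ⊆ S^d with V ⊆ U). Then, after replacing V and W by their images under a single isomorphism of codes, there exist letters l, s ∈ S with s ∉ {l, l'}, a set A = {i_1 < i_2 < i_3 < i_4} ⊆ {1,…,d}, and a word p ∈ S^d such that every word of V ∪ W agrees with p at every coordinate outside A, the set of restrictions of the words of V to the coordinates (i_1,i_2,i_3,i_4) equals W_1 ∖ (W_1 ∩ W_2), and the set of restrictions of the words of W to these coordinates equals W_2 ∖ (W_1 ∩ W_2). -/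

import Mathlib

variable {S : Type}

/-- Two words are dichotomous: at some position they carry complementary letters. -/
def Dicho {d : ℕ} (c : S → S) (u v : Fin d → S) : Prop := ∃ j, v j = c (u j)

/-- Two words form a twin pair. -/
def TwinPair {d : ℕ} (c : S → S) (u v : Fin d → S) : Prop :=
  ∃ j, v j = c (u j) ∧ ∀ i, i ≠ j → v i = u i

/-- A polybox code: a set of pairwise dichotomous words. -/
def PolyboxCode {d : ℕ} (c : S → S) (V : Set (Fin d → S)) : Prop :=
  ∀ u ∈ V, ∀ v ∈ V, u ≠ v → Dicho c u v

/-- The code contains no twin pair. -/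
def NoTwinPair {d : ℕ} (c : S → S) (V : Set (Fin d → S)) : Prop :=
  ∀ u ∈ V, ∀ v ∈ V, ¬ TwinPair c u v

/-- `ES`: sets containing exactly one of `s`, `s'` for every letter `s`. -/
def ESet (c : S → S) : Set (Set S) := {B | ∀ s, Xor' (s ∈ B) (c s ∈ B)}

/-- `Es`: members of `ES` containing the letter `s`. -/
def ELetter (c : S → S) (s : S) : Set (Set S) := {B | B ∈ ESet c ∧ s ∈ B}

/-- The equicomplementary realization `v̌ ⊆ (ES)^d` of a word `v`. -/
def Realize {d : ℕ} (c : S → S) (v : Fin d → S) : Set (Fin d → Set S) :=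
  {x | ∀ i, x i ∈ ELetter c (v i)}

/-- The union `⋃_{v ∈ V} v̌`. -/
def RealizeSet {d : ℕ} (c : S → S) (V : Set (Fin d → S)) : Set (Fin d → Set S) :=
  ⋃ v ∈ V, Realize c v

/-- Two codes are equivalent if their realizations coincide. -/
def EquivCodes {d : ℕ} (c : S → S) (V W : Set (Fin d → S)) : Prop :=
  RealizeSet c V = RealizeSet c W

/-- A partition code: a polybox code whose realization is the whole box `(ES)^d`. -/
def PartitionCode {d : ℕ} (c : S → S) (U : Set (Fin d → S)) : Prop :=
  PolyboxCode c U ∧ RealizeSet c U = {x | ∀ i, x i ∈ ESet c}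

/-- `V^{i,l}`: the words of `V` with letter `l` at position `i`. -/
def Subcode {d : ℕ} (V : Set (Fin d → S)) (i : Fin d) (l : S) : Set (Fin d → S) :=
  {v | v ∈ V ∧ v i = l}

/-- Concatenation of sets of two-letter words, yielding four-letter words. -/
def Cat (X Y : Set (S × S)) : Set (Fin 4 → S) :=
  {v | ∃ p ∈ X, ∃ q ∈ Y, v = ![p.1, p.2, q.1, q.2]}

/-- `W₁ = C₁C₁ ∪ A₁A₁ᶜ ∪ B₁B₁ᶜ ∪ A₁ᶜB₁ ∪ B₁ᶜA₁` where `A₁ = {ls'}`, `B₁ = {l'l'}`,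
`C₁ = {ls, l'l}`, `A₁ᶜ = {ss, l's', s's}`, `B₁ᶜ = {ll', sl, s'l}`. -/
def Wone (c : S → S) (l s : S) : Set (Fin 4 → S) :=
  Cat {(l, s), (c l, l)} {(l, s), (c l, l)} ∪
    Cat {(l, c s)} {(s, s), (c l, c s), (c s, s)} ∪
    Cat {(c l, c l)} {(l, c l), (s, l), (c s, l)} ∪
    Cat {(s, s), (c l, c s), (c s, s)} {(c l, c l)} ∪
    Cat {(l, c l), (s, l), (c s, l)} {(l, c s)}

/-- `W₂ = C₂C₂ ∪ A₂ᶜA₂ ∪ B₂ᶜB₂ ∪ A₂B₂ᶜ ∪ B₂A₂ᶜ` where `A₂ = {s'l}`, `B₂ = {ss}`,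
`C₂ = {ss', s'l'}`, `A₂ᶜ = {ll', l'l', sl}`, `B₂ᶜ = {ls', l's', s's}`. -/
def Wtwo (c : S → S) (l s : S) : Set (Fin 4 → S) :=
  Cat {(s, c s), (c s, c l)} {(s, c s), (c s, c l)} ∪
    Cat {(l, c l), (c l, c l), (s, l)} {(c s, l)} ∪
    Cat {(l, c s), (c l, c s), (c s, s)} {(s, s)} ∪
    Cat {(c s, l)} {(l, c s), (c l, c s), (c s, s)} ∪
    Cat {(s, s)} {(l, c l), (c l, c l), (s, l)}

/-! ### Valuations -/

section
open scoped Classical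

/-- A function on letters whose sum over every complementary pair is the same. -/
def Val (c : S → S) (f : S → ℚ) : Prop := ∃ k, ∀ s, f s + f (c s) = k

/-- The expectation of the indicator of `s ∈ B` when `B` is uniform among the members of `ES`
containing `T`. -/
noncomputable def ind (c : S → S) (T : Finset S) (s : S) : ℚ :=
  if s ∈ T then 1 else if c s ∈ T then 0 else 1 / 2

/-- The signed indicator of a complementary pair. -/
noncomputable def sgnPair (c : S → S) (q s : S) : ℚ :=
  if s = q then 1 else if s = c q then -1 else 0

section Letters
variable {c : S → S}

lemma val_one : Val c (fun _ => 1) := ⟨2, fun _ => by norm_num⟩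

lemma ind_add (hc : Function.Involutive c) {T : Finset S} (hT : ∀ s ∈ T, c s ∉ T) (s : S) :
    ind c T s + ind c T (c s) = 1 := by
  have := hT s
  have h2 := hT (c s)
  rw [hc s] at h2
  unfold ind
  rw [hc s]
  by_cases h : s ∈ T <;> by_cases h' : c s ∈ T <;> (simp_all; try norm_num)

lemma val_ind (hc : Function.Involutive c) {T : Finset S} (hT : ∀ s ∈ T, c s ∉ T) :
    Val c (ind c T) := ⟨1, ind_add hc hT⟩

lemma val_sgnPair (hc : Function.Involutive c) (hf : ∀ s, c s ≠ s) (q : S) :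
    Val c (sgnPair c q) := by
  refine ⟨0, fun s => ?_⟩
  unfold sgnPair
  by_cases h : s = q
  · subst h; simp [hf]
  · by_cases h' : s = c q
    · subst h'; simp [hc q, hf]
    · have h1 : c s ≠ q := fun e => h' (by rw [← e, hc])
      have h2 : c s ≠ c q := fun e => h (hc.injective e)
      simp [h, h', h1, h2]

lemma ind_nonneg (T : Finset S) (s : S) : 0 ≤ ind c T s := by
  unfold ind; split_ifs <;> norm_num

lemma ind_le_one (T : Finset S) (s : S) : ind c T s ≤ 1 := by
  unfold ind; split_ifs <;> norm_num

lemma ind_of_mem {T : Finset S} {s : S} (h : s ∈ T) : ind c T s = 1 := by simp [ind, h]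

lemma ind_eq_zero {T : Finset S} {s : S} (hT : ∀ s ∈ T, c s ∉ T) (h : c s ∈ T) :
    ind c T s = 0 := by
  have : s ∉ T := fun h' => hT s h' h
  simp [ind, h, this]

lemma ind_pos {T : Finset S} {s : S} (h : c s ∉ T) : 0 < ind c T s := by
  unfold ind; split_ifs <;> norm_num

lemma ind_le_half {T : Finset S} {s : S} (h : s ∉ T) : ind c T s ≤ 1 / 2 := by
  unfold ind; split_ifs <;> norm_num

lemma ind_half {T : Finset S} {s : S} (h : s ∉ T) (h' : c s ∉ T) : ind c T s = 1 / 2 := by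
  simp [ind, h, h']

lemma consistent_singleton (hf : ∀ s, c s ≠ s) (q : S) :
    ∀ s ∈ ({q} : Finset S), c s ∉ ({q} : Finset S) := by
  simp [hf]

lemma consistent_pair (hc : Function.Involutive c) (hf : ∀ s, c s ≠ s) {q s : S} (h : s ≠ c q) :
    ∀ x ∈ ({q, s} : Finset S), c x ∉ ({q, s} : Finset S) := by
  intro x hx
  simp only [Finset.mem_insert, Finset.mem_singleton] at hx ⊢
  rcases hx with rfl | rfl
  · simp [hf, h.symm]
  · rintro (e | e)
    · exact h (by rw [← e, hc])
    · exact hf _ e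

end Letters

/-! ### Words -/

section Words
variable {ι : Type} {c : S → S}

/-- The value of a word, restricted to the coordinates in `K`. -/
def pr (g : ι → S → ℚ) (K : Finset ι) (v : ι → S) : ℚ := ∏ j ∈ K, g j (v j)

/-- The two words overlap in the coordinates of `K`. -/
def Ov (c : S → S) (K : Finset ι) (u r : ι → S) : Prop := ∀ j ∈ K, u j ≠ c (r j)

/-- The two words form a twin pair in the coordinates of `K`. -/
def TwinOn (c : S → S) (K : Finset ι) (u v : ι → S) : Prop :=
  ∃ j ∈ K, v j = c (u j) ∧ ∀ i ∈ K, i ≠ j → v i = u i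

/-- The two families of words have the same multiplicities in the coordinates of `K`. -/
def Null (c : S → S) (A B : Finset (ι → S)) (K : Finset ι) : Prop :=
  ∀ g : ι → S → ℚ, (∀ i, Val c (g i)) → ∑ v ∈ A, pr g K v = ∑ v ∈ B, pr g K v

lemma Null.symm {A B : Finset (ι → S)} {K : Finset ι} (h : Null c A B K) : Null c B A K :=
  fun g hg => (h g hg).symm

lemma Null.card_eq {A B : Finset (ι → S)} {K : Finset ι} (h : Null c A B K) :
    A.card = B.card := by
  have := h (fun _ _ => 1) (fun _ => val_one)
  simpa [pr] using this

lemma pr_ind_nonneg (T : ι → Finset S) (K : Finset ι) (v : ι → S) :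
    0 ≤ pr (fun j => ind c (T j)) K v := Finset.prod_nonneg fun _ _ => ind_nonneg _ _

lemma pr_ind_le (T : ι → Finset S) {K : Finset ι} (v : ι → S) {L : Finset ι} (hL : L ⊆ K) :
    pr (fun j => ind c (T j)) K v ≤ pr (fun j => ind c (T j)) L v := by
  unfold pr
  rw [← Finset.prod_sdiff hL]
  exact mul_le_of_le_one_left (Finset.prod_nonneg fun _ _ => ind_nonneg _ _)
    (Finset.prod_le_one (fun _ _ => ind_nonneg _ _) fun _ _ => ind_le_one _ _)

lemma pr_ind_le_half (T : ι → Finset S) {K : Finset ι} {v : ι → S} {j : ι} (hj : j ∈ K)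
    (h : v j ∉ T j) : pr (fun j => ind c (T j)) K v ≤ 1 / 2 := by
  refine (pr_ind_le T v (Finset.singleton_subset_iff.2 hj)).trans ?_
  simpa [pr] using ind_le_half (c := c) h

lemma pr_ind_le_quarter (T : ι → Finset S) {K : Finset ι} {v : ι → S} {j k : ι} (hj : j ∈ K)
    (hk : k ∈ K) (hjk : j ≠ k) (h : v j ∉ T j) (h' : v k ∉ T k) :
    pr (fun j => ind c (T j)) K v ≤ 1 / 4 := by
  refine (pr_ind_le T v (L := {j, k}) ?_).trans ?_
  · intro x; simp only [Finset.mem_insert, Finset.mem_singleton]; rintro (rfl | rfl) <;> assumption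
  · have h1 := ind_le_half (c := c) h
    have h2 := ind_le_half (c := c) h'
    have h3 := ind_nonneg (c := c) (T j) (v j)
    have h4 := ind_nonneg (c := c) (T k) (v k)
    simp only [pr, Finset.prod_pair hjk]
    nlinarith

lemma pr_ind_pos {T : ι → Finset S} {K : Finset ι} {v : ι → S} (h : ∀ j ∈ K, c (v j) ∉ T j) :
    0 < pr (fun j => ind c (T j)) K v := Finset.prod_pos fun j hj => ind_pos (h j hj)

lemma pr_eq_zero {g : ι → S → ℚ} {K : Finset ι} {v : ι → S} {j : ι} (hj : j ∈ K)
    (h : g j (v j) = 0) : pr g K v = 0 := Finset.prod_eq_zero hj h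

lemma pr_eq_one {g : ι → S → ℚ} {K : Finset ι} {v : ι → S} (h : ∀ j ∈ K, g j (v j) = 1) :
    pr g K v = 1 := Finset.prod_eq_one h

lemma pr_erase {g : ι → S → ℚ} {K : Finset ι} {v : ι → S} {j : ι} (hj : j ∈ K) :
    pr g K v = g j (v j) * pr g (K.erase j) v := (Finset.mul_prod_erase K _ hj).symm

lemma pr_congr {g g' : ι → S → ℚ} {K : Finset ι} {v v' : ι → S}
    (h : ∀ j ∈ K, g j (v j) = g' j (v' j)) : pr g K v = pr g' K v' := Finset.prod_congr rfl h

lemma pr_update {g : ι → S → ℚ} {K : Finset ι} {v : ι → S} {j : ι} (hj : j ∈ K) (f : S → ℚ) :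
    pr (Function.update g j f) K v = f (v j) * pr g (K.erase j) v := by
  rw [pr_erase hj, Function.update_self]
  congr 1
  exact pr_congr fun i hi => by rw [Function.update_of_ne (Finset.ne_of_mem_erase hi)]

lemma val_update {g : ι → S → ℚ} (hg : ∀ i, Val c (g i)) {j : ι} {f : S → ℚ} (hf : Val c f) :
    ∀ i, Val c (Function.update g j f i) := fun i => by
  by_cases e : i = j
  · subst e; simpa using hf
  · simpa [Function.update_of_ne e] using hg i

/-- Restricting an equality of multiplicities to a complementary pair of letters at `j`. -/
lemma Null.slice (hc : Function.Involutive c) (hf : ∀ s, c s ≠ s) {A B : Finset (ι → S)}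
    (hAB : Disjoint A B) {K : Finset ι} (h : Null c A B K) {j : ι} (hj : j ∈ K) (q : S) :
    Null c (A.filter (· j = q) ∪ B.filter (· j = c q)) (B.filter (· j = q) ∪ A.filter (· j = c q))
      (K.erase j) := by
  intro g hg
  have hd : ∀ X Y : Finset (ι → S), Disjoint X Y →
      ∑ v ∈ X.filter (· j = q) ∪ Y.filter (· j = c q), pr g (K.erase j) v =
      ∑ v ∈ X.filter (· j = q), pr g (K.erase j) v +
        ∑ v ∈ Y.filter (· j = c q), pr g (K.erase j) v := fun X Y hXY =>
    Finset.sum_union (Finset.disjoint_filter_filter hXY)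
  have key : ∀ X : Finset (ι → S),
      ∑ v ∈ X, pr (Function.update g j (sgnPair c q)) K v =
      ∑ v ∈ X.filter (· j = q), pr g (K.erase j) v -
        ∑ v ∈ X.filter (· j = c q), pr g (K.erase j) v := by
    intro X
    rw [Finset.sum_filter, Finset.sum_filter, ← Finset.sum_sub_distrib]
    refine Finset.sum_congr rfl fun v _ => ?_
    rw [pr_erase hj, Function.update_self]
    have : pr (Function.update g j (sgnPair c q)) (K.erase j) v = pr g (K.erase j) v :=
      pr_congr fun i hi => by rw [Function.update_of_ne (Finset.ne_of_mem_erase hi)]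
    rw [this]
    unfold sgnPair
    by_cases h1 : v j = q
    · simp [h1, (hf q).symm]
    · by_cases h2 : v j = c q
      · simp [h2, hf]
      · simp [h1, h2]
  have := h (Function.update g j (sgnPair c q)) (fun i => by
    by_cases e : i = j
    · subst e; simpa using val_sgnPair hc hf q
    · simpa [Function.update_of_ne e] using hg i)
  rw [key, key] at this
  rw [hd _ _ hAB, hd _ _ hAB.symm]
  linarith

end Words

end

section
open scoped Classical

/-! ### Covering a word by other words -/

section Cover
variable {ι : Type} {c : S → S}

lemma pr_ind_pow (hc : Function.Involutive c) {K : Finset ι} {v r : ι → S} (h : Ov c K v r) :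
    pr (fun j => ind c {r j}) K v = (1 / 2) ^ (K.filter fun j => v j ≠ r j).card := by
  unfold pr
  rw [← Finset.prod_const, Finset.prod_filter]
  refine Finset.prod_congr rfl fun j hj => ?_
  by_cases e : v j = r j
  · simp [ind, e]
  · have h' : c (v j) ≠ r j := fun h' => h j hj (by rw [← h', hc])
    simp [ind, e, h']

/-- The words of `C` tile the word `r` in the coordinates of `K`, without twin pairs and without
using `r` itself. -/
structure Cover (c : S → S) (K : Finset ι) (r : ι → S) (C : Finset (ι → S)) : Prop where
  ov : ∀ u ∈ C, Ov c K u r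
  dich : ∀ u ∈ C, ∀ v ∈ C, u ≠ v → ∃ j ∈ K, v j = c (u j)
  twin : ∀ u ∈ C, ∀ v ∈ C, ¬ TwinOn c K u v
  ne : ∀ u ∈ C, ∃ j ∈ K, u j ≠ r j
  sum : ∀ g : ι → S → ℚ, (∀ i, Val c (g i)) → (∀ j ∈ K, g j (r j) = 1) →
    (∀ j ∈ K, g j (c (r j)) = 0) → ∑ v ∈ C, pr g K v = 1

variable {K : Finset ι} {r : ι → S} {C : Finset (ι → S)}

/-- The sum over the pieces when weights are indicators. -/
lemma Cover.sum_ind (hc : Function.Involutive c) (h : Cover c K r C) (T : ι → Finset S)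
    (hT : ∀ j, ∀ s ∈ T j, c s ∉ T j) (hr : ∀ j ∈ K, r j ∈ T j) :
    ∑ v ∈ C, pr (fun j => ind c (T j)) K v = 1 :=
  h.sum _ (fun i => val_ind hc (hT i)) (fun j hj => ind_of_mem (hr j hj))
    (fun j hj => ind_eq_zero (hT j) (by rw [hc]; exact hr j hj))

/-- A piece differing from `r` in one coordinate forces the letter of all other pieces there. -/
lemma Cover.forced (h : Cover c K r C) {u : ι → S} (hu : u ∈ C) {j : ι}
    (hur : ∀ i ∈ K, i ≠ j → u i = r i) : ∀ v ∈ C, v ≠ u → v j = c (u j) := by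
  intro v hv hvu
  obtain ⟨i, hi, e⟩ := h.dich u hu v hv hvu.symm
  by_cases hij : i = j
  · rwa [← hij]
  · exact absurd (by rw [e, hur i hi hij]) (h.ov v hv i hi)

lemma Cover.erase (hc : Function.Involutive c) (hf : ∀ s, c s ≠ s) (h : Cover c K r C)
    {u : ι → S} (hu : u ∈ C) {j : ι} (hj : j ∈ K)
    (hur : ∀ i ∈ K, i ≠ j → u i = r i) : Cover c (K.erase j) r (C.erase u) := by
  have hfo := h.forced hu hur
  have hne : u j ≠ r j := by
    obtain ⟨i, hi, e⟩ := h.ne u hu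
    by_cases hij : i = j
    · rwa [← hij]
    · exact absurd (hur i hi hij) e
  refine ⟨fun v hv i hi => h.ov v (Finset.mem_of_mem_erase hv) i (Finset.mem_of_mem_erase hi),
    fun v hv w hw hvw => ?_, fun v hv w hw ht => ?_, fun v hv => ?_, fun g hg h1 h0 => ?_⟩
  · rw [Finset.mem_erase] at hv hw
    obtain ⟨i, hi, e⟩ := h.dich v hv.2 w hw.2 hvw
    refine ⟨i, Finset.mem_erase.2 ⟨?_, hi⟩, e⟩
    rintro rfl
    rw [hfo v hv.2 hv.1, hfo w hw.2 hw.1] at e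
    exact hf _ e.symm
  · rw [Finset.mem_erase] at hv hw
    obtain ⟨i, hi, e, h'⟩ := ht
    refine h.twin v hv.2 w hw.2 ⟨i, Finset.mem_of_mem_erase hi, e, fun k hk hki => ?_⟩
    by_cases hkj : k = j
    · rw [hkj, hfo v hv.2 hv.1, hfo w hw.2 hw.1]
    · exact h' k (Finset.mem_erase.2 ⟨hkj, hk⟩) hki
  · rw [Finset.mem_erase] at hv
    by_contra! hcon
    exact h.twin u hu v hv.2 ⟨j, hj, hfo v hv.2 hv.1, fun i hi hij => by
      rw [hur i hi hij]; exact hcon i (Finset.mem_erase.2 ⟨hij, hi⟩)⟩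
  · have hT : ∀ x ∈ ({r j, c (u j)} : Finset S), c x ∉ ({r j, c (u j)} : Finset S) :=
      consistent_pair hc hf fun e => hne (hc.injective e)
    have := h.sum (Function.update g j (ind c {r j, c (u j)})) (fun i => by
      by_cases e : i = j
      · subst e; simpa using val_ind hc hT
      · simpa [Function.update_of_ne e] using hg i) (fun i hi => by
      by_cases e : i = j
      · subst e; simp [ind]
      · simpa [Function.update_of_ne e] using h1 i (Finset.mem_erase.2 ⟨e, hi⟩)) (fun i hi => by
      by_cases e : i = j
      · subst e; simpa using ind_eq_zero hT (by simp [hc _])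
      · simpa [Function.update_of_ne e] using h0 i (Finset.mem_erase.2 ⟨e, hi⟩))
    rw [← Finset.add_sum_erase _ _ hu, pr_eq_zero hj (by
      simpa using ind_eq_zero hT (by simp)), zero_add] at this
    rw [← this]
    refine Finset.sum_congr rfl fun v hv => ?_
    rw [Finset.mem_erase] at hv
    rw [pr_erase hj, Function.update_self, hfo v hv.2 hv.1, ind_of_mem (by simp), one_mul]
    exact pr_congr fun i hi => by rw [Function.update_of_ne (Finset.ne_of_mem_erase hi)]

/-- If every piece differs from `r` in at least two coordinates and `u` differs exactly in `j` and
`k`, then there are two pieces containing the complement of `u` at `k` but not at `j`. -/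
lemma Cover.two_le (hc : Function.Involutive c) (hf : ∀ s, c s ≠ s) (h : Cover c K r C)
    (hk1 : ∀ u ∈ C, ∀ j ∈ K, ∃ i ∈ K, i ≠ j ∧ u i ≠ r i)
    {u : ι → S} (hu : u ∈ C) {j k : ι} (hj : j ∈ K) (hk : k ∈ K) (hjk : j ≠ k)
    (huk : u k ≠ r k) (hur : ∀ i ∈ K, i ≠ j → i ≠ k → u i = r i) :
    2 ≤ (C.filter fun v => v k = c (u k) ∧ v j ≠ c (u j)).card := by
  set T : ι → Finset S := fun i => if i = j then {r j, u j} else if i = k then {r k, c (u k)}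
    else {r i} with hTd
  have hT : ∀ i, ∀ s ∈ T i, c s ∉ T i := by
    intro i
    simp only [hTd]
    split_ifs
    · exact consistent_pair hc hf (h.ov u hu j hj)
    · exact consistent_pair hc hf fun e => huk (hc.injective e)
    · exact consistent_singleton hf _
  have hTj : T j = {r j, u j} := by simp [hTd]
  have hTk : T k = {r k, c (u k)} := by simp [hTd, hjk.symm]
  have hTi : ∀ i, i ≠ j → i ≠ k → T i = {r i} := fun i h1 h2 => by simp [hTd, h1, h2]
  have hsum := h.sum_ind hc T hT (fun i _ => by simp only [hTd]; split_ifs <;> simp [*])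
  have hval : ∀ v ∈ C, pr (fun i => ind c (T i)) K v ≤
      if v k = c (u k) ∧ v j ≠ c (u j) then 1 / 2 else 0 := by
    intro v hv
    by_cases e1 : v j = c (u j)
    · rw [if_neg (by tauto), pr_eq_zero hj (ind_eq_zero (hT j) (by simp [hTj, e1, hc (u j)]))]
    by_cases e2 : v k = c (u k)
    · rw [if_pos ⟨e2, e1⟩]
      suffices ∃ i ∈ K, v i ∉ T i by
        obtain ⟨i, hi, e⟩ := this
        exact pr_ind_le_half T hi e
      by_contra! hcon
      have hoff : ∀ i ∈ K, i ≠ j → i ≠ k → v i = r i := fun i hi h1 h2 => by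
        simpa [hTi i h1 h2] using hcon i hi
      have := hcon j hj
      simp only [hTj, Finset.mem_insert, Finset.mem_singleton] at this
      rcases this with e | e
      · obtain ⟨i, hi, hik, hir⟩ := hk1 v hv k hk
        by_cases hij : i = j
        · exact hir (by rw [hij, e])
        · exact hir (hoff i hi hij hik)
      · refine h.twin u hu v hv ⟨k, hk, e2, fun i hi hik => ?_⟩
        by_cases hij : i = j
        · rw [hij, e]
        · rw [hoff i hi hij hik, hur i hi hij hik]
    · rw [if_neg (by tauto)]
      have hvu : u = v := by
        by_contra hne
        obtain ⟨i, hi, e⟩ := h.dich u hu v hv hne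
        by_cases hij : i = j
        · exact e1 (hij ▸ e)
        by_cases hik : i = k
        · exact e2 (hik ▸ e)
        exact h.ov v hv i hi (by rw [e, hur i hi hij hik])
      rw [pr_eq_zero hk (ind_eq_zero (hT k) (by simp [hTk, ← hvu]))]
  have h1 := Finset.sum_le_sum hval
  rw [hsum, ← Finset.sum_filter, Finset.sum_const, nsmul_eq_mul] at h1
  have : (2 : ℚ) ≤ ((C.filter fun v => v k = c (u k) ∧ v j ≠ c (u j)).card : ℚ) := by linarith
  exact_mod_cast this

lemma Cover.five_le_of_two_le (hc : Function.Involutive c) (hf : ∀ s, c s ≠ s)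
    (h : Cover c K r C) (hk1 : ∀ u ∈ C, ∀ j ∈ K, ∃ i ∈ K, i ≠ j ∧ u i ≠ r i) : 5 ≤ C.card := by
  have hsum := h.sum_ind hc (fun j => {r j}) (fun j => consistent_singleton hf _) (by simp)
  have hpow : ∀ v ∈ C, pr (fun j => ind c {r j}) K v =
      (1 / 2) ^ (K.filter fun j => v j ≠ r j).card := fun v hv => pr_ind_pow hc (h.ov v hv)
  have htwo : ∀ v ∈ C, 2 ≤ (K.filter fun j => v j ≠ r j).card := by
    intro v hv
    obtain ⟨j, hj, e⟩ := h.ne v hv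
    obtain ⟨i, hi, hij, e'⟩ := hk1 v hv j hj
    rw [← Finset.card_pair hij]
    refine Finset.card_le_card ?_
    intro x
    simp only [Finset.mem_insert, Finset.mem_singleton, Finset.mem_filter]
    rintro (rfl | rfl) <;> exact ⟨‹_›, ‹_›⟩
  by_contra hlt
  have hex : ∃ u ∈ C, (K.filter fun j => u j ≠ r j).card = 2 := by
    by_contra! hcon
    have : ∑ v ∈ C, pr (fun j => ind c {r j}) K v ≤ ∑ v ∈ C, (1 / 8 : ℚ) := by
      refine Finset.sum_le_sum fun v hv => ?_
      rw [hpow v hv]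
      calc (1 / 2 : ℚ) ^ (K.filter fun j => v j ≠ r j).card ≤ (1 / 2 : ℚ) ^ 3 :=
            pow_le_pow_of_le_one (by norm_num) (by norm_num) (by
              have := htwo v hv; have := hcon v hv; omega)
        _ = 1 / 8 := by norm_num
    rw [hsum, Finset.sum_const, nsmul_eq_mul] at this
    have h4 : (C.card : ℚ) ≤ 4 := by exact_mod_cast (by omega : C.card ≤ 4)
    linarith
  obtain ⟨u, hu, hu2⟩ := hex
  obtain ⟨j, k, hjk, hset⟩ := Finset.card_eq_two.1 hu2
  have hmem : ∀ i, (i ∈ K ∧ u i ≠ r i) ↔ (i = j ∨ i = k) := fun i => by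
    have : i ∈ (K.filter fun j => u j ≠ r j) ↔ i ∈ ({j, k} : Finset ι) := by rw [hset]
    simpa using this
  obtain ⟨hj, huj⟩ := (hmem j).2 (Or.inl rfl)
  obtain ⟨hk, huk⟩ := (hmem k).2 (Or.inr rfl)
  have hur : ∀ i ∈ K, i ≠ j → i ≠ k → u i = r i := fun i hi h1 h2 => by
    by_contra e
    exact ((hmem i).1 ⟨hi, e⟩).elim h1 h2
  have n1 := h.two_le hc hf hk1 hu hj hk hjk huk hur
  have n2 := h.two_le hc hf hk1 hu hk hj hjk.symm huj fun i hi h1 h2 => hur i hi h2 h1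
  set N1 := C.filter fun v => v k = c (u k) ∧ v j ≠ c (u j)
  set N2 := C.filter fun v => v j = c (u j) ∧ v k ≠ c (u k)
  have hd : Disjoint N1 N2 := Finset.disjoint_filter.2 fun v _ h1 h2 => h1.2 h2.1
  have hu' : u ∉ N1 ∪ N2 := by
    simp only [N1, N2, Finset.mem_union, Finset.mem_filter]
    rintro (⟨-, e, -⟩ | ⟨-, e, -⟩) <;> exact hf _ e.symm
  have hsub : insert u (N1 ∪ N2) ⊆ C := by
    intro v
    simp only [N1, N2, Finset.mem_insert, Finset.mem_union, Finset.mem_filter]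
    rintro (rfl | ⟨h, -⟩ | ⟨h, -⟩) <;> assumption
  have := Finset.card_le_card hsub
  rw [Finset.card_insert_of_notMem hu', Finset.card_union_of_disjoint hd] at this
  omega

lemma Cover.five_le (hc : Function.Involutive c) (hf : ∀ s, c s ≠ s) (h : Cover c K r C) :
    5 ≤ C.card := by
  induction hn : C.card using Nat.strong_induction_on generalizing C K with
  | _ n ih =>
    by_cases hk1 : ∀ u ∈ C, ∀ j ∈ K, ∃ i ∈ K, i ≠ j ∧ u i ≠ r i
    · exact hn ▸ h.five_le_of_two_le hc hf hk1
    · push Not at hk1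
      obtain ⟨u, hu, j, hj, hur⟩ := hk1
      have h' := h.erase hc hf hu hj hur
      have hcard := Finset.card_erase_lt_of_mem hu
      have := ih _ (hn ▸ hcard) h' rfl
      omega

end Cover
end

section
open scoped Classical

section Cover
variable {ι : Type} {c : S → S} {K : Finset ι} {r : ι → S} {C : Finset (ι → S)}

/-- Valuations supported by the box of `r` in the coordinates of `K`, with total mass one. -/
structure Within (c : S → S) (K : Finset ι) (r : ι → S) (g : ι → S → ℚ) : Prop where
  val : ∀ i, Val c (g i)
  one : ∀ j ∈ K, g j (r j) = 1
  zero : ∀ j ∈ K, g j (c (r j)) = 0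

lemma within_ind (hc : Function.Involutive c) (T : ι → Finset S)
    (hT : ∀ j, ∀ s ∈ T j, c s ∉ T j) (hr : ∀ j ∈ K, r j ∈ T j) :
    Within c K r (fun j => ind c (T j)) :=
  ⟨fun i => val_ind hc (hT i), fun j hj => ind_of_mem (hr j hj),
    fun j hj => ind_eq_zero (hT j) (by rw [hc]; exact hr j hj)⟩

lemma within_ind_self (hc : Function.Involutive c) (hf : ∀ s, c s ≠ s) :
    Within c K r (fun j => ind c {r j}) :=
  within_ind hc _ (fun _ => consistent_singleton hf _) (by simp)

/-- Weights supported by the intersection of the boxes of two overlapping words. -/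
lemma within_ind_pair (hc : Function.Involutive c) (hf : ∀ s, c s ≠ s) {u : ι → S}
    (h : Ov c K u r) :
    Within c K r (fun j => ind c (if j ∈ K then {r j, u j} else {r j})) := by
  refine within_ind hc _ (fun j => ?_) (fun j hj => by simp [hj])
  split_ifs with hj
  · exact consistent_pair hc hf (h j hj)
  · exact consistent_singleton hf _

lemma Within.update (hc : Function.Involutive c) {g : ι → S → ℚ} {i : ι}
    (h : Within c (K.erase i) r g) {T : Finset S}
    (hT : ∀ s ∈ T, c s ∉ T) (hr : r i ∈ T) : Within c K r (Function.update g i (ind c T)) := by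
  refine ⟨val_update h.val (val_ind hc hT), fun j hj => ?_, fun j hj => ?_⟩
  · by_cases e : j = i
    · subst e; simpa using ind_of_mem hr
    · simpa [Function.update_of_ne e] using h.one j (Finset.mem_erase.2 ⟨e, hj⟩)
  · by_cases e : j = i
    · subst e; simpa using ind_eq_zero hT (by rwa [hc])
    · simpa [Function.update_of_ne e] using h.zero j (Finset.mem_erase.2 ⟨e, hj⟩)

lemma Cover.sum' (h : Cover c K r C) {g : ι → S → ℚ} (hg : Within c K r g) :
    ∑ v ∈ C, pr g K v = 1 := h.sum g hg.val hg.one hg.zero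

lemma sum_letters (hf : ∀ s, c s ≠ s) {i : ι} (t : S) (C : Finset (ι → S)) (F : (ι → S) → ℚ) :
    ∑ u ∈ C, F u = ∑ u ∈ C.filter (· i = t), F u + ∑ u ∈ C.filter (· i = c t), F u +
      ∑ u ∈ C.filter (fun u => u i ≠ t ∧ u i ≠ c t), F u := by
  rw [Finset.sum_filter, Finset.sum_filter, Finset.sum_filter, ← Finset.sum_add_distrib,
    ← Finset.sum_add_distrib]
  refine Finset.sum_congr rfl fun u _ => ?_
  by_cases e : u i = t
  · simp [e, (hf t).symm]
  · by_cases e' : u i = c t <;> simp [e, e', hf]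

/-- The words with complementary letters at `i` cover the same part of `r`. -/
lemma Cover.balance (hc : Function.Involutive c) (hf : ∀ s, c s ≠ s) (h : Cover c K r C)
    {i : ι} (hi : i ∈ K) {t : S} (h1 : t ≠ r i) (h2 : t ≠ c (r i)) {g : ι → S → ℚ}
    (hg : Within c (K.erase i) r g) :
    ∑ u ∈ C.filter (· i = t), pr g (K.erase i) u =
      ∑ u ∈ C.filter (· i = c t), pr g (K.erase i) u := by
  have h3 : c t ≠ c (r i) := fun e => h1 (hc.injective e)
  have h4 : c t ≠ r i := fun e => h2 (by rw [← e, hc])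
  have e1 := h.sum' (hg.update hc (consistent_pair hc hf h2) (by simp))
  have e2 := h.sum' (hg.update hc (consistent_pair hc hf h3) (by simp))
  rw [sum_letters hf (i := i) t] at e1 e2
  have key : ∀ x y : S, x ≠ r i → x ≠ c (r i) → (x = t ∨ x = c t) → y = t ∨ y = c t →
      ∑ u ∈ C.filter (· i = x), pr (Function.update g i (ind c {r i, y})) K u =
      (if x = y then 1 else 0) * ∑ u ∈ C.filter (· i = x), pr g (K.erase i) u := by
    intro x y hx hx' hxt hyt
    rw [Finset.mul_sum]
    refine Finset.sum_congr rfl fun u hu => ?_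
    rw [pr_update hi, (Finset.mem_filter.1 hu).2]
    congr 1
    by_cases e : x = y
    · simp [ind, e]
    · have hyc : c x = y := by
        rcases hxt with rfl | rfl <;> rcases hyt with rfl | rfl <;> simp_all
        exact hc _
      simp [ind, hyc, hx, e]
  have e3 : ∑ u ∈ C.filter (fun u => u i ≠ t ∧ u i ≠ c t),
      pr (Function.update g i (ind c {r i, t})) K u =
      ∑ u ∈ C.filter (fun u => u i ≠ t ∧ u i ≠ c t),
      pr (Function.update g i (ind c {r i, c t})) K u := by
    refine Finset.sum_congr rfl fun u hu => ?_
    rw [pr_update hi, pr_update hi]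
    obtain ⟨-, ht, ht'⟩ := Finset.mem_filter.1 hu
    have : c (u i) ≠ t := fun e => ht' (by rw [← e, hc])
    have : c (u i) ≠ c t := fun e => ht (hc.injective e)
    simp [ind, *]
  rw [key t t h1 h2 (by simp) (by simp), key (c t) t h4 h3 (by simp) (by simp)] at e1
  rw [key t (c t) h1 h2 (by simp) (by simp), key (c t) (c t) h4 h3 (by simp) (by simp)] at e2
  simp only [hf, (hf t).symm, if_true, if_false] at e1 e2
  linarith

/-- If words of a cover with the same letter at `i` tile `n` inside `r`, then there is only one of
them, or there are at least five. -/
lemma Cover.tile (hc : Function.Involutive c) (hf : ∀ s, c s ≠ s) (h : Cover c K r C)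
    {i : ι} {t : S} {D : Finset (ι → S)} (hD : D ⊆ C.filter (· i = t)) {n : ι → S}
    (hn : Ov c (K.erase i) n r)
    (hsum : ∀ g, Within c (K.erase i) r g → ∑ u ∈ D, pr g (K.erase i) u = pr g (K.erase i) n) :
    (∃ u ∈ D, D = {u} ∧ ∀ k ∈ K, k ≠ i → u k = n k) ∨ 5 ≤ D.card := by
  have hDC : ∀ u ∈ D, u ∈ C := fun u hu => (Finset.mem_filter.1 (hD hu)).1
  have hDt : ∀ u ∈ D, u i = t := fun u hu => (Finset.mem_filter.1 (hD hu)).2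
  have hov : ∀ u ∈ D, Ov c (K.erase i) u r := fun u hu k hk =>
    h.ov u (hDC u hu) k (Finset.mem_of_mem_erase hk)
  -- every piece is contained in `n`
  have hin : ∀ u ∈ D, ∀ k ∈ K.erase i, n k ≠ r k → u k = n k := by
    intro u hu k hk hnk
    by_contra hne
    have hT : ∀ j, ∀ s ∈ (if j = k then {r k, c (n k)} else if j ∈ K.erase i then {r j, u j}
        else {r j} : Finset S), c s ∉ (if j = k then {r k, c (n k)} else
        if j ∈ K.erase i then {r j, u j} else {r j} : Finset S) := by
      intro j
      split_ifs with h1 h2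
      · exact consistent_pair hc hf fun e => hnk (hc.injective e)
      · exact consistent_pair hc hf (hov u hu j h2)
      · exact consistent_singleton hf _
    have := hsum _ (within_ind hc _ hT (by intro j hj; split_ifs <;> simp [*]))
    rw [pr_eq_zero hk (v := n) (ind_eq_zero (hT k) (by simp))] at this
    have hpos : 0 < ∑ w ∈ D, pr (fun j => ind c (if j = k then {r k, c (n k)} else
        if j ∈ K.erase i then {r j, u j} else {r j})) (K.erase i) w := by
      refine Finset.sum_pos' (fun _ _ => pr_ind_nonneg _ _ _) ⟨u, hu, pr_ind_pos fun j hj => ?_⟩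
      split_ifs with h1
      · subst h1
        simp only [Finset.mem_insert, Finset.mem_singleton, not_or]
        exact ⟨fun e => hov u hu j hk (by rw [← e, hc]), fun e => hne (hc.injective e)⟩
      · simp only [Finset.mem_insert, Finset.mem_singleton, not_or]
        exact ⟨fun e => hov u hu j hj (by rw [← e, hc]), hf _⟩
    exact absurd this hpos.ne'
  by_cases hex : ∃ u ∈ D, ∀ k ∈ K, k ≠ i → u k = n k
  · left
    obtain ⟨u, hu, hun⟩ := hex
    refine ⟨u, hu, Finset.eq_singleton_iff_unique_mem.2 ⟨hu, fun w hw => ?_⟩, hun⟩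
    by_contra hwu
    have := hsum _ (within_ind_pair hc hf (hov w hw))
    rw [← Finset.add_sum_erase _ _ hu, pr_congr (v' := n) (g' := fun j =>
      ind c (if j ∈ K.erase i then {r j, w j} else {r j})) (fun k hk => by
      rw [hun k (Finset.mem_of_mem_erase hk) (Finset.ne_of_mem_erase hk)])] at this
    have hpos : 0 < ∑ u ∈ D.erase u, pr (fun j => ind c (if j ∈ K.erase i then {r j, w j}
        else {r j})) (K.erase i) u := by
      refine Finset.sum_pos' (fun _ _ => pr_ind_nonneg _ _ _)
        ⟨w, Finset.mem_erase.2 ⟨hwu, hw⟩, pr_ind_pos fun j hj => ?_⟩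
      simp only [hj, if_true, Finset.mem_insert, Finset.mem_singleton, not_or]
      exact ⟨fun e => hov w hw j hj (by rw [← e, hc]), hf _⟩
    linarith
  · right
    push Not at hex
    set L := (K.erase i).filter fun k => n k = r k with hL
    have hoff : ∀ u ∈ D, ∀ k ∈ K, k ∉ L → k ≠ i → u k = n k := fun u hu k hk hkL hki =>
      hin u hu k (Finset.mem_erase.2 ⟨hki, hk⟩) fun e =>
        hkL (Finset.mem_filter.2 ⟨Finset.mem_erase.2 ⟨hki, hk⟩, e⟩)
    have hLr : ∀ k ∈ L, n k = r k := fun k hk => (Finset.mem_filter.1 hk).2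
    have hLK : L ⊆ K.erase i := Finset.filter_subset _ _
    have hcov : Cover c L n D := by
      refine ⟨fun u hu k hk => by rw [hLr k hk]; exact hov u hu k (hLK hk),
        fun u hu v hv huv => ?_, fun u hu v hv ht => ?_, fun u hu => ?_, fun g hg h1 h0 => ?_⟩
      · obtain ⟨j, hj, e⟩ := h.dich u (hDC u hu) v (hDC v hv) huv
        refine ⟨j, ?_, e⟩
        by_contra hjL
        by_cases hji : j = i
        · subst hji; rw [hDt u hu, hDt v hv] at e; exact hf _ e.symm
        · rw [hoff u hu j hj hjL hji, hoff v hv j hj hjL hji] at e; exact hf _ e.symm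
      · obtain ⟨j, hj, e, hj'⟩ := ht
        refine h.twin u (hDC u hu) v (hDC v hv) ⟨j, Finset.mem_of_mem_erase (hLK hj), e,
          fun k hk hkj => ?_⟩
        by_cases hki : k = i
        · rw [hki, hDt u hu, hDt v hv]
        by_cases hkL : k ∈ L
        · exact hj' k hkL hkj
        · rw [hoff u hu k hk hkL hki, hoff v hv k hk hkL hki]
      · obtain ⟨k, hk, hki, hkn⟩ := hex u hu
        refine ⟨k, ?_, hkn⟩
        by_contra hkL
        exact hkn (hoff u hu k hk hkL hki)
      · set g' : ι → S → ℚ := fun k => if k ∈ L then g k else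
          ind c (if k ∈ K.erase i then {r k, n k} else {r k})
        have hN := within_ind_pair hc hf hn
        have hg' : Within c (K.erase i) r g' := by
          refine ⟨fun k => ?_, fun k hk => ?_, fun k hk => ?_⟩ <;> by_cases hkL : k ∈ L <;>
            simp only [g', hkL, if_true, if_false]
          · exact hg k
          · exact hN.val k
          · rw [← hLr k hkL, h1 k hkL]
          · exact hN.one k hk
          · rw [← hLr k hkL, h0 k hkL]
          · exact hN.zero k hk
        have hpr : ∀ u, (∀ k ∈ K, k ∉ L → k ≠ i → u k = n k) →
            pr g' (K.erase i) u = pr g L u := by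
          intro u hu
          unfold pr
          rw [← Finset.prod_sdiff hLK, Finset.prod_eq_one, one_mul]
          · exact Finset.prod_congr rfl fun k hk => by simp [g', hk]
          · intro k hk
            rw [Finset.mem_sdiff] at hk
            have hk2 := Finset.mem_erase.1 hk.1
            simp only [g', hk.2, if_false, hk.1, if_true]
            exact ind_of_mem (by simp [hu k hk2.2 hk.2 hk2.1])
        have := hsum g' hg'
        rw [Finset.sum_congr rfl fun u hu => hpr u (hoff u hu), hpr n fun _ _ _ _ => rfl] at this
        rw [this]
        exact pr_eq_one fun k hk => h1 k hk
    exact hcov.five_le hc hf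

end Cover
end

section
open scoped Classical

section Cover
variable {ι : Type} {c : S → S} {K : Finset ι} {r : ι → S} {C : Finset (ι → S)}

/-- No word of `C` differs from `r` only at `i`. -/
def Thick (K : Finset ι) (r : ι → S) (C : Finset (ι → S)) (i : ι) : Prop :=
  ∀ u ∈ C, ∃ k ∈ K, k ≠ i ∧ u k ≠ r k

lemma Ov.erase {u : ι → S} (h : Ov c K u r) (i : ι) : Ov c (K.erase i) u r :=
  fun k hk => h k (Finset.mem_of_mem_erase hk)

lemma Cover.exists_compl (hc : Function.Involutive c) (hf : ∀ s, c s ≠ s) (h : Cover c K r C)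
    {i : ι} (hi : i ∈ K) {u : ι → S} (hu : u ∈ C) (hur : u i ≠ r i) :
    ∃ v ∈ C, v i = c (u i) := by
  have hov := (h.ov u hu).erase i
  have hb := h.balance hc hf hi hur (h.ov u hu i hi) (within_ind_pair hc hf hov)
  by_contra! hcon
  rw [Finset.filter_false_of_mem hcon, Finset.sum_empty] at hb
  have hpos : 0 < ∑ v ∈ C.filter (· i = u i),
      pr (fun j => ind c (if j ∈ K.erase i then {r j, u j} else {r j})) (K.erase i) v := by
    refine Finset.sum_pos' (fun _ _ => pr_ind_nonneg _ _ _)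
      ⟨u, Finset.mem_filter.2 ⟨hu, rfl⟩, pr_ind_pos fun j hj => ?_⟩
    simp only [hj, if_true, Finset.mem_insert, Finset.mem_singleton, not_or]
    exact ⟨fun e => hov j hj (by rw [← e, hc]), hf _⟩
  exact hpos.ne' hb

lemma card_compl_le (hf : ∀ s, c s ≠ s) (i : ι) (t : S) (C : Finset (ι → S)) :
    (C.filter (· i = t)).card + (C.filter (· i = c t)).card +
      (C.filter fun u => u i ≠ t ∧ u i ≠ c t).card = C.card := by
  have := sum_letters (c := c) hf (i := i) t C (fun _ => 1)
  simp only [Finset.sum_const, nsmul_eq_mul, mul_one] at this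
  exact_mod_cast this.symm

lemma Cover.two_le_letter (hc : Function.Involutive c) (hf : ∀ s, c s ≠ s) (h : Cover c K r C)
    (h6 : C.card ≤ 6) {i : ι} (hi : i ∈ K) (hk1 : Thick K r C i) {u : ι → S} (hu : u ∈ C)
    (hur : u i ≠ r i) : 2 ≤ (C.filter (· i = u i)).card := by
  have hmem : u ∈ C.filter (· i = u i) := Finset.mem_filter.2 ⟨hu, rfl⟩
  by_contra hlt
  have hone : C.filter (· i = u i) = {u} := by
    refine Finset.eq_singleton_iff_unique_mem.2 ⟨hmem, fun v hv => ?_⟩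
    exact Finset.card_le_one.1 (by omega) v hv u hmem
  have hbal : ∀ g, Within c (K.erase i) r g →
      ∑ v ∈ C.filter (· i = c (u i)), pr g (K.erase i) v = pr g (K.erase i) u := fun g hg => by
    rw [← h.balance hc hf hi hur (h.ov u hu i hi) hg, hone, Finset.sum_singleton]
  rcases h.tile hc hf (Finset.Subset.refl _) ((h.ov u hu).erase i) hbal with ⟨v, hv, -, hvu⟩ | h5
  · rw [Finset.mem_filter] at hv
    exact h.twin u hu v hv.1 ⟨i, hi, hv.2, hvu⟩
  · have hcard := card_compl_le (c := c) hf i (u i) C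
    have h1 : (C.filter (· i = u i)).card = 1 := by rw [hone]; rfl
    have h0 : (C.filter fun v => v i ≠ u i ∧ v i ≠ c (u i)) = ∅ := Finset.card_eq_zero.1 (by omega)
    have hw := within_ind_self (c := c) (K := K.erase i) (r := r) hc hf
    have hs := h.sum' (hw.update hc (consistent_pair hc hf (h.ov u hu i hi)) (by simp))
    rw [sum_letters hf (i := i) (u i), h0, Finset.sum_empty, hone, Finset.sum_singleton,
      Finset.sum_eq_zero, pr_update hi] at hs
    · obtain ⟨k, hk, hki, hkr⟩ := hk1 u hu
      have := pr_ind_le_half (c := c) (fun j => {r j}) (v := u) (Finset.mem_erase.2 ⟨hki, hk⟩)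
        (by simpa using hkr)
      rw [ind_of_mem (by simp)] at hs
      linarith
    · intro v hv
      rw [pr_update hi, (Finset.mem_filter.1 hv).2,
        ind_eq_zero (consistent_pair hc hf (h.ov u hu i hi)) (by simp [hc _]), zero_mul]

lemma Cover.active_eq (hc : Function.Involutive c) (hf : ∀ s, c s ≠ s) (h : Cover c K r C)
    (h6 : C.card ≤ 6) {i : ι} (hi : i ∈ K) (hk1 : Thick K r C i) {u v : ι → S} (hu : u ∈ C)
    (hur : u i ≠ r i) (hv : v ∈ C) (hvr : v i ≠ r i) : v i = u i ∨ v i = c (u i) := by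
  by_contra! hcon
  obtain ⟨u', hu', eu⟩ := h.exists_compl hc hf hi hu hur
  obtain ⟨v', hv', ev⟩ := h.exists_compl hc hf hi hv hvr
  have hu'r : u' i ≠ r i := fun e => h.ov u hu i hi (by rw [← e, eu, hc])
  have hv'r : v' i ≠ r i := fun e => h.ov v hv i hi (by rw [← e, ev, hc])
  have n1 := h.two_le_letter hc hf h6 hi hk1 hu hur
  have n2 := h.two_le_letter hc hf h6 hi hk1 hu' hu'r
  have n3 := h.two_le_letter hc hf h6 hi hk1 hv hvr
  have n4 := h.two_le_letter hc hf h6 hi hk1 hv' hv'r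
  rw [eu] at n2
  rw [ev] at n4
  have hcard := card_compl_le (c := c) hf i (u i) C
  have hsub : C.filter (· i = v i) ∪ C.filter (· i = c (v i)) ⊆
      C.filter fun w => w i ≠ u i ∧ w i ≠ c (u i) := by
    intro w
    simp only [Finset.mem_union, Finset.mem_filter]
    rintro (⟨hw, e⟩ | ⟨hw, e⟩)
    · rw [e]; exact ⟨hw, hcon⟩
    · rw [e]; exact ⟨hw, fun e => hcon.2 (by rw [← e, hc]), fun e => hcon.1 (hc.injective e)⟩
  have := Finset.card_le_card hsub
  rw [Finset.card_union_of_disjoint (Finset.disjoint_filter.2 fun w _ h1 h2 => hf _ (by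
    rw [← h2, h1]))] at this
  omega

lemma Cover.three_aux (hf : ∀ s, c s ≠ s) (h : Cover c K r C)
    (hne : C.Nonempty) (h2 : ∀ j ∈ K, ∀ u ∈ C, u j ≠ r j → 2 ≤ (C.filter (· j = u j)).card) :
    ∃ T ⊆ K, T.card = 3 ∧ ∀ x ∈ T, ∃ u ∈ C, u x ≠ r x := by
  obtain ⟨w, hw⟩ := hne
  obtain ⟨j, hj, hwj⟩ := h.ne w hw
  obtain ⟨u, hu, v, hv, huv⟩ := Finset.one_lt_card.1 (h2 j hj w hw hwj)
  rw [Finset.mem_filter] at hu hv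
  obtain ⟨k, hk, e⟩ := h.dich u hu.1 v hv.1 huv
  have hkj : k ≠ j := by rintro rfl; rw [hu.2, hv.2] at e; exact hf _ e.symm
  have hl : ∃ l ∈ K, l ≠ k ∧ v l ≠ u l := by
    by_contra! hcon
    exact h.twin u hu.1 v hv.1 ⟨k, hk, e, hcon⟩
  obtain ⟨l, hl, hlk, hluv⟩ := hl
  have hlj : l ≠ j := by rintro rfl; exact hluv (by rw [hu.2, hv.2])
  refine ⟨{j, k, l}, ?_, Finset.card_eq_three.2 ⟨j, k, l, hkj.symm, hlj.symm, hlk.symm, rfl⟩, ?_⟩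
  · intro x; simp only [Finset.mem_insert, Finset.mem_singleton]
    rintro (rfl | rfl | rfl) <;> assumption
  · intro x; simp only [Finset.mem_insert, Finset.mem_singleton]
    rintro (rfl | rfl | rfl)
    · exact ⟨w, hw, hwj⟩
    · exact ⟨u, hu.1, fun e' => h.ov v hv.1 _ hk (by rw [e, e'])⟩
    · by_cases e' : u x = r x
      · exact ⟨v, hv.1, fun e2 => hluv (by rw [e2, e'])⟩
      · exact ⟨u, hu.1, e'⟩

/-- At least three coordinates are active in a small cover. -/
lemma Cover.three (hc : Function.Involutive c) (hf : ∀ s, c s ≠ s) (h : Cover c K r C)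
    (h6 : C.card ≤ 6) :
    ∃ T ⊆ K, T.card = 3 ∧ ∀ x ∈ T, Thick K r C x ∧ ∃ u ∈ C, u x ≠ r x := by
  have h5 := h.five_le hc hf
  by_cases hall : ∀ x ∈ K, Thick K r C x
  · obtain ⟨T, hT, h3, ha⟩ := h.three_aux hf (Finset.card_pos.1 (by omega)) fun j hj u hu hur =>
      h.two_le_letter hc hf h6 hj (hall j hj) hu hur
    exact ⟨T, hT, h3, fun x hx => ⟨hall x (hT hx), ha x hx⟩⟩
  · unfold Thick at hall
    push Not at hall
    obtain ⟨i, hi, u, hu, hur⟩ := hall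
    have hne : u i ≠ r i := by
      obtain ⟨k, hk, e⟩ := h.ne u hu
      by_cases hki : k = i
      · rwa [← hki]
      · exact absurd (hur k hk hki) e
    have hth : ∀ x ∈ K, x ≠ i → Thick K r C x := by
      intro x hx hxi v hv
      by_cases hvu : v = u
      · subst hvu; exact ⟨i, hi, hxi.symm, hne⟩
      · refine ⟨i, hi, hxi.symm, fun e => ?_⟩
        rw [h.forced hu hur v hv hvu] at e
        exact h.ov u hu i hi (by rw [← e, hc])
    have h' := h.erase hc hf hu hi hur
    obtain ⟨T, hT, h3, ha⟩ := h'.three_aux hf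
      (Finset.card_pos.1 (by have := h'.five_le hc hf; omega)) fun j hj v hv hvr => by
        rw [Finset.mem_erase] at hj hv
        have := h.two_le_letter hc hf h6 hj.2 (hth j hj.2 hj.1) hv.2 hvr
        convert this using 2
        ext w
        simp only [Finset.mem_filter, Finset.mem_erase]
        refine ⟨fun hw => ⟨hw.1.2, hw.2⟩, fun hw => ⟨⟨?_, hw.1⟩, hw.2⟩⟩
        rintro rfl
        exact hvr (by rw [← hw.2, hur j hj.2 hj.1])
    refine ⟨T, hT.trans (Finset.erase_subset _ _), h3, fun x hx => ?_⟩
    have hxK := Finset.mem_erase.1 (hT hx)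
    obtain ⟨v, hv, e⟩ := ha x hx
    exact ⟨hth x hxK.2 hxK.1, v, Finset.mem_of_mem_erase hv, e⟩

end Cover
end

section
open scoped Classical

section Slot
variable {ι : Type} {c : S → S} {K : Finset ι} {r : ι → S} {A B : Finset (ι → S)}

/-- The words that miss `r` exactly in the coordinate `i`. -/
noncomputable def nbr (c : S → S) (K : Finset ι) (r : ι → S) (A : Finset (ι → S)) (i : ι) :
    Finset (ι → S) := A.filter fun a => a i = c (r i) ∧ Ov c (K.erase i) a r

lemma mem_nbr {i : ι} {a : ι → S} :
    a ∈ nbr c K r A i ↔ a ∈ A ∧ a i = c (r i) ∧ Ov c (K.erase i) a r := Finset.mem_filter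

lemma Within.eq_zero {g : ι → S → ℚ} (hg : Within c K r g)
    {a : ι → S} (h : ¬ Ov c K a r) : pr g K a = 0 := by
  unfold Ov at h
  push Not at h
  obtain ⟨j, hj, e⟩ := h
  exact pr_eq_zero hj (by rw [e, hg.zero j hj])

lemma Ov.of_erase {i : ι} {a : ι → S} (h : Ov c (K.erase i) a r) (hi : a i ≠ c (r i)) :
    Ov c K a r := fun k hk => by
  by_cases e : k = i
  · rwa [e]
  · exact h k (Finset.mem_erase.2 ⟨e, hk⟩)

/-- `r` belongs to one of two families with equal multiplicities and is tiled by the other. -/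
structure Slot (c : S → S) (K : Finset ι) (r : ι → S) (A B : Finset (ι → S)) : Prop where
  null : Null c A B K
  mem : r ∈ A
  eq : ∀ a ∈ A, Ov c K a r → a = r
  cover : Cover c K r (B.filter (Ov c K · r))

lemma Slot.sum_nbr (h : Slot c K r A B) {i : ι}
    (hi : i ∈ K) {g : ι → S → ℚ}
    (hg : Within c (K.erase i) r g) {f : S → ℚ} (hfv : Val c f) (h0 : f (r i) = 0)
    (h1 : f (c (r i)) = 1) :
    ∑ a ∈ nbr c K r A i, pr g (K.erase i) a = ∑ b ∈ nbr c K r B i, pr g (K.erase i) b +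
      ∑ u ∈ B.filter (Ov c K · r), f (u i) * pr g (K.erase i) u := by
  have hn := h.null (Function.update g i f) (val_update hg.val hfv)
  have hA : ∑ a ∈ A, pr (Function.update g i f) K a =
      ∑ a ∈ nbr c K r A i, pr g (K.erase i) a := by
    unfold nbr
    rw [Finset.sum_filter]
    refine Finset.sum_congr rfl fun a ha => ?_
    rw [pr_update hi]
    split_ifs with hcond
    · rw [hcond.1, h1, one_mul]
    · by_cases ho : Ov c (K.erase i) a r
      · rw [h.eq a ha (ho.of_erase fun e => hcond ⟨e, ho⟩), h0, zero_mul]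
      · rw [hg.eq_zero ho, mul_zero]
  have hB : ∑ a ∈ B, pr (Function.update g i f) K a = ∑ b ∈ nbr c K r B i, pr g (K.erase i) b +
      ∑ u ∈ B.filter (Ov c K · r), f (u i) * pr g (K.erase i) u := by
    unfold nbr
    rw [Finset.sum_filter, Finset.sum_filter, ← Finset.sum_add_distrib]
    refine Finset.sum_congr rfl fun a _ => ?_
    rw [pr_update hi]
    by_cases ho : Ov c (K.erase i) a r
    · by_cases e : a i = c (r i)
      · have : ¬ Ov c K a r := fun h => h i hi e
        simp [e, ho, this, h1]
      · simp [e, ho.of_erase e]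
    · have : ¬ Ov c K a r := fun h => ho (h.erase i)
      simp [ho, this, hg.eq_zero ho]
  rw [hA, hB] at hn
  exact hn

lemma Slot.nbr_nonempty (hc : Function.Involutive c) (hf : ∀ s, c s ≠ s) (h : Slot c K r A B)
    {i : ι} (hi : i ∈ K) {u : ι → S} (hu : u ∈ B.filter (Ov c K · r)) (hur : u i ≠ r i) :
    (nbr c K r A i).Nonempty := by
  have hw := within_ind_self (c := c) (K := K.erase i) (r := r) hc hf
  have hcs := consistent_singleton (c := c) hf (c (r i))
  have := h.sum_nbr hi hw (val_ind hc hcs) (ind_eq_zero hcs (by simp)) (ind_of_mem (by simp))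
  rw [Finset.nonempty_iff_ne_empty]
  intro he
  rw [he, Finset.sum_empty] at this
  have h1 : 0 ≤ ∑ b ∈ nbr c K r B i, pr (fun j => ind c {r j}) (K.erase i) b :=
    Finset.sum_nonneg fun _ _ => pr_ind_nonneg _ _ _
  have hov := h.cover.ov u hu
  have h2 : 0 < ∑ u ∈ B.filter (Ov c K · r),
      ind c {c (r i)} (u i) * pr (fun j => ind c {r j}) (K.erase i) u := by
    refine Finset.sum_pos' (fun _ _ => mul_nonneg (ind_nonneg _ _) (pr_ind_nonneg _ _ _))
      ⟨u, hu, mul_pos (ind_pos ?_) (pr_ind_pos fun j hj => ?_)⟩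
    · rw [Finset.mem_singleton]
      exact fun e => hur (hc.injective e)
    · rw [Finset.mem_singleton]
      exact fun e => hov j (Finset.mem_of_mem_erase hj) (by rw [← e, hc])
  linarith

/-- The identity of `Slot.sum_nbr` when a single pair of letters is active at `i`. -/
lemma Slot.sum_letter (hc : Function.Involutive c) (hf : ∀ s, c s ≠ s) (h : Slot c K r A B)
    {i : ι} (hi : i ∈ K) (h6 : (B.filter (Ov c K · r)).card ≤ 6)
    (hk1 : Thick K r (B.filter (Ov c K · r)) i) {u : ι → S} (hu : u ∈ B.filter (Ov c K · r))
    (hur : u i ≠ r i) {g : ι → S → ℚ} (hg : Within c (K.erase i) r g) :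
    ∑ a ∈ nbr c K r A i, pr g (K.erase i) a = ∑ b ∈ nbr c K r B i, pr g (K.erase i) b +
      ∑ w ∈ (B.filter (Ov c K · r)).filter (· i = u i), pr g (K.erase i) w := by
  have hcs : ∀ x ∈ ({c (r i), u i} : Finset S), c x ∉ ({c (r i), u i} : Finset S) :=
    consistent_pair hc hf (by rwa [hc])
  rw [h.sum_nbr hi hg (val_ind hc hcs) (ind_eq_zero hcs (by simp)) (ind_of_mem (by simp))]
  congr 1
  rw [Finset.sum_filter (fun w : ι → S => w i = u i)]
  refine Finset.sum_congr rfl fun w hw => ?_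
  split_ifs with e
  · rw [e, ind_of_mem (by simp), one_mul]
  · by_cases hwr : w i = r i
    · rw [hwr, ind_eq_zero hcs (by simp), zero_mul]
    · rw [((h.cover.active_eq hc hf h6 hi hk1 hu hur hw hwr).resolve_left e),
        ind_eq_zero hcs (by simp [hc _]), zero_mul]

lemma Slot.two_le_nbr (hc : Function.Involutive c) (hf : ∀ s, c s ≠ s) (h : Slot c K r A B)
    {i : ι} (hi : i ∈ K) (h6 : (B.filter (Ov c K · r)).card ≤ 6)
    (hk1 : Thick K r (B.filter (Ov c K · r)) i) {u : ι → S} (hu : u ∈ B.filter (Ov c K · r))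
    (hur : u i ≠ r i) (hE : nbr c K r B i = ∅) : 2 ≤ (nbr c K r A i).card := by
  by_contra hlt
  have hpos := (h.nbr_nonempty hc hf hi hu hur).card_pos
  obtain ⟨n, hn⟩ := Finset.card_eq_one.1 (by omega : (nbr c K r A i).card = 1)
  have hnm : n ∈ nbr c K r A i := by simp [hn]
  have ht := h.cover.tile hc hf (i := i) (t := u i) (Finset.Subset.refl _)
    (mem_nbr.1 hnm).2.2 fun g hg => by
      have := h.sum_letter hc hf hi h6 hk1 hu hur hg
      rw [hE, Finset.sum_empty, zero_add, hn, Finset.sum_singleton] at this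
      exact this.symm
  have n1 := h.cover.two_le_letter hc hf h6 hi hk1 hu hur
  obtain ⟨u', hu', eu⟩ := h.cover.exists_compl hc hf hi hu hur
  have n2 := h.cover.two_le_letter hc hf h6 hi hk1 hu'
    fun e => h.cover.ov u hu i hi (by rw [← e, eu, hc])
  rw [eu] at n2
  have hcard := card_compl_le (c := c) hf i (u i) (B.filter (Ov c K · r))
  rcases ht with ⟨w, -, hw, -⟩ | ht
  · rw [hw, Finset.card_singleton] at n1; omega
  · omega

lemma eq_of_within (hc : Function.Involutive c) (hf : ∀ s, c s ≠ s) {u v : ι → S}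
    (hu : Ov c K u r) (hv : Ov c K v r) (h : ∀ g, Within c K r g → pr g K u = pr g K v) :
    ∀ k ∈ K, u k = v k := by
  have key : ∀ u v : ι → S, Ov c K u r → (∀ g, Within c K r g → pr g K u = pr g K v) →
      ∀ k ∈ K, v k = r k ∨ v k = u k := by
    intro u v hu h k hk
    by_contra! hcon
    have := h _ (within_ind_pair hc hf hu)
    rw [pr_eq_one fun j hj => ind_of_mem (by simp [hj])] at this
    have h2 := pr_ind_le_half (c := c) (fun j => if j ∈ K then {r j, u j} else {r j}) (v := v) hk
      (by simp [hk, hcon])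
    linarith
  intro k hk
  rcases key u v hu h k hk with e | e
  · rcases key v u hv (fun g hg => (h g hg).symm) k hk with e' | e'
    · rw [e, e']
    · exact e'
  · exact e.symm

lemma Slot.six_le (hc : Function.Involutive c) (hf : ∀ s, c s ≠ s) (h : Slot c K r A B)
    (h6 : A.card ≤ 6) : A.card = 6 ∧ ∃ j ∈ K, (∃ e ∈ B, Ov c K e r ∧ e j ≠ r j) ∧
      (∃ n ∈ A, n j = c (r j) ∧ ∀ k ∈ K, k ≠ j → n k = r k) ∧
      ∃ ρ ∈ B, ρ j = c (r j) ∧ (∀ b ∈ B, b = ρ ∨ Ov c K b r) ∧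
      ∃ f ∈ B, Ov c K f r ∧ f j = r j ∧ ∀ k ∈ K, k ≠ j → ρ k = f k := by
  set C := B.filter (Ov c K · r) with hC
  have hcov : Cover c K r C := h.cover
  have hAB := h.null.card_eq
  have hCB : C ⊆ B := Finset.filter_subset _ _
  have hC5 := hcov.five_le hc hf
  have hCle := Finset.card_le_card hCB
  have hC6 : C.card ≤ 6 := by omega
  obtain ⟨T, hTK, hT3, hT⟩ := hcov.three hc hf hC6
  have hsum : ∑ i ∈ T, (nbr c K r A i).card + 1 ≤ A.card := by
    have hd : ∀ i ∈ T, ∀ j ∈ T, i ≠ j → Disjoint (nbr c K r A i) (nbr c K r A j) := by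
      intro i _ j hj hij
      rw [Finset.disjoint_left]
      intro a ha ha'
      exact (mem_nbr.1 ha).2.2 j (Finset.mem_erase.2 ⟨hij.symm, hTK hj⟩) (mem_nbr.1 ha').2.1
    rw [← Finset.card_biUnion hd, ← Finset.card_erase_add_one h.mem]
    refine Nat.add_le_add_right (Finset.card_le_card fun a ha => ?_) 1
    obtain ⟨i, -, ha⟩ := Finset.mem_biUnion.1 ha
    refine Finset.mem_erase.2 ⟨?_, (mem_nbr.1 ha).1⟩
    rintro rfl
    exact hf _ (mem_nbr.1 ha).2.1.symm
  have hj : ∃ j ∈ T, (nbr c K r A j).card < 2 := by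
    by_contra! hcon
    have := Finset.card_nsmul_le_sum T _ 2 hcon
    rw [hT3, smul_eq_mul] at this
    omega
  obtain ⟨j, hjT, hj1⟩ := hj
  obtain ⟨hth, e, he, hej⟩ := hT j hjT
  have hjK := hTK hjT
  obtain ⟨n, hn⟩ := Finset.card_eq_one.1 (by
    have := (h.nbr_nonempty hc hf hjK he hej).card_pos; omega : (nbr c K r A j).card = 1)
  have hnm := mem_nbr.1 (by simp [hn] : n ∈ nbr c K r A j)
  obtain ⟨ρ, hρ⟩ : (nbr c K r B j).Nonempty := by
    rw [Finset.nonempty_iff_ne_empty]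
    intro hE
    have := h.two_le_nbr hc hf hjK hC6 hth he hej hE
    omega
  have hρm := mem_nbr.1 hρ
  have hρC : ρ ∉ C := fun hmem => hcov.ov ρ hmem j hjK hρm.2.1
  have hBC : B = insert ρ C := by
    symm
    refine Finset.eq_of_subset_of_card_le (Finset.insert_subset hρm.1 hCB) ?_
    rw [Finset.card_insert_of_notMem hρC]
    omega
  have hBcard : B.card = C.card + 1 := by rw [hBC, Finset.card_insert_of_notMem hρC]
  have hE : nbr c K r B j = {ρ} := by
    refine Finset.eq_singleton_iff_unique_mem.2 ⟨hρ, fun b hb => ?_⟩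
    have hbm := mem_nbr.1 hb
    have := hbm.1
    rw [hBC, Finset.mem_insert] at this
    exact this.resolve_right fun hmem => hcov.ov b hmem j hjK hbm.2.1
  have n1 := hcov.two_le_letter hc hf hC6 hjK hth he hej
  obtain ⟨e', he', ee⟩ := hcov.exists_compl hc hf hjK he hej
  have n2 := hcov.two_le_letter hc hf hC6 hjK hth he'
    fun e0 => hcov.ov e he j hjK (by rw [← e0, ee, hc])
  rw [ee] at n2
  have hcard := card_compl_le (c := c) hf j (e j) C
  set D := C.filter fun u => u j ≠ e j ∧ u j ≠ c (e j) with hD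
  have hDr : ∀ u ∈ D, u j = r j := by
    intro u hu
    obtain ⟨hu, h1, h2⟩ := Finset.mem_filter.1 hu
    by_contra hur
    exact (hcov.active_eq hc hf hC6 hjK hth he hej hu hur).elim h1 h2
  have hone : ∀ g, Within c (K.erase j) r g → ∑ w ∈ C.filter (· j = e j), pr g (K.erase j) w +
      ∑ w ∈ D, pr g (K.erase j) w = 1 := by
    intro g hg
    have hcs := consistent_pair hc hf (hcov.ov e he j hjK)
    have := hcov.sum' (hg.update hc hcs (by simp))
    rw [sum_letters hf (i := j) (e j), Finset.sum_eq_zero (s := C.filter (· j = c (e j))),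
      add_zero] at this
    · rw [← this]
      congr 1
      · refine Finset.sum_congr rfl fun w hw => ?_
        rw [pr_update hjK, (Finset.mem_filter.1 hw).2, ind_of_mem (by simp), one_mul]
      · refine Finset.sum_congr rfl fun w hw => ?_
        rw [pr_update hjK, hDr w hw, ind_of_mem (by simp), one_mul]
    · intro w hw
      rw [pr_update hjK, (Finset.mem_filter.1 hw).2, ind_eq_zero hcs (by simp [hc _]), zero_mul]
  have hD1 : D.Nonempty := by
    rw [Finset.nonempty_iff_ne_empty]
    intro hD0
    rcases hcov.tile hc hf (i := j) (t := e j) (n := r) (Finset.Subset.refl _)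
      (fun k _ e0 => hf _ e0.symm) fun g hg => by
        have := hone g hg
        rw [hD0, Finset.sum_empty, add_zero] at this
        rw [this, pr_eq_one hg.one] with ⟨w, -, hw, -⟩ | h5
    · rw [hw, Finset.card_singleton] at n1; omega
    · omega
  obtain ⟨f, hfD⟩ := Finset.card_eq_one.1 (by have := hD1.card_pos; omega : D.card = 1)
  have hfm : f ∈ D := by simp [hfD]
  have hfC : f ∈ C := (Finset.mem_filter.1 hfm).1
  have hrel : ∀ g, Within c (K.erase j) r g →
      pr g (K.erase j) f + pr g (K.erase j) n = 1 + pr g (K.erase j) ρ := by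
    intro g hg
    have h1 := hone g hg
    have h2 := h.sum_letter hc hf hjK hC6 hth he hej hg
    rw [hfD, Finset.sum_singleton] at h1
    rw [hn, hE, Finset.sum_singleton, Finset.sum_singleton] at h2
    linarith
  have hnr : ∀ k ∈ K, k ≠ j → n k = r k := by
    by_contra! hcon
    obtain ⟨k, hk, hkj, hkn⟩ := hcon
    obtain ⟨l, hl, hlj, hlf⟩ := hth f hfC
    have := hrel _ (within_ind_self hc hf)
    have h1 := pr_ind_le_half (c := c) (fun j => {r j}) (v := n) (Finset.mem_erase.2 ⟨hkj, hk⟩)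
      (by simpa using hkn)
    have h2 := pr_ind_le_half (c := c) (fun j => {r j}) (v := f) (Finset.mem_erase.2 ⟨hlj, hl⟩)
      (by simpa using hlf)
    have h3 : 0 < pr (fun j => ind c {r j}) (K.erase j) ρ := pr_ind_pos fun j hj => by
      rw [Finset.mem_singleton]
      exact fun e => hρm.2.2 j hj (by rw [← e, hc])
    linarith
  have hρf := eq_of_within hc hf hρm.2.2 ((hcov.ov f hfC).erase j) fun g hg => by
    have := hrel g hg
    rw [pr_eq_one (v := n) fun k hk => by
      rw [hnr k (Finset.mem_of_mem_erase hk) (Finset.ne_of_mem_erase hk), hg.one k hk]] at this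
    linarith
  refine ⟨by omega, j, hjK, ⟨e, hCB he, hcov.ov e he, hej⟩, ⟨n, hnm.1, hnm.2.1, hnr⟩,
    ρ, hρm.1, hρm.2.1, fun b hb => ?_, f, hCB hfC, hcov.ov f hfC, hDr f hfm,
    fun k hk hkj => hρf k (Finset.mem_erase.2 ⟨hkj, hk⟩)⟩
  rw [hBC, Finset.mem_insert] at hb
  exact hb.imp_right (hcov.ov b)

end Slot
end

section
open scoped Classical

/-! ### Disjoint equivalent codes -/

section Good
variable {ι : Type} [Fintype ι] {c : S → S} {V W : Finset (ι → S)}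

/-- Disjoint codes without twin pairs and with equal realizations. -/
structure Good (c : S → S) (V W : Finset (ι → S)) : Prop where
  dichV : ∀ u ∈ V, ∀ v ∈ V, u ≠ v → ∃ j, v j = c (u j)
  dichW : ∀ u ∈ W, ∀ v ∈ W, u ≠ v → ∃ j, v j = c (u j)
  twinV : ∀ u ∈ V, ∀ v ∈ V, ¬ TwinOn c Finset.univ u v
  twinW : ∀ u ∈ W, ∀ v ∈ W, ¬ TwinOn c Finset.univ u v
  disj : Disjoint V W
  null : Null c V W Finset.univ

lemma Good.symm (h : Good c V W) : Good c W V :=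
  ⟨h.dichW, h.dichV, h.twinW, h.twinV, h.disj.symm, h.null.symm⟩

/-- The words of `V` with letter `q` at `i` and the words of `W` with the complementary letter. -/
noncomputable def side (c : S → S) (V W : Finset (ι → S)) (i : ι) (q : S) : Finset (ι → S) :=
  V.filter (· i = q) ∪ W.filter (· i = c q)

lemma mem_side {i : ι} {q : S} {u : ι → S} :
    u ∈ side c V W i q ↔ (u ∈ V ∧ u i = q) ∨ (u ∈ W ∧ u i = c q) := by
  simp [side]

lemma Good.null_side (hc : Function.Involutive c) (hf : ∀ s, c s ≠ s) (h : Good c V W) (i : ι)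
    (q : S) : Null c (side c V W i q) (side c W V i q) (Finset.univ.erase i) := by
  have := h.null.slice hc hf h.disj (Finset.mem_univ i) q
  unfold side
  convert this

lemma Good.card_side (h : Good c V W) (i : ι) (q : S) :
    (side c V W i q).card = (V.filter (· i = q)).card + (W.filter (· i = c q)).card :=
  Finset.card_union_of_disjoint (Finset.disjoint_filter_filter h.disj)

/-- The part of a word of `V` given by a letter set at `i` is tiled by words of `W`. -/
lemma Good.sum_tile (hc : Function.Involutive c) (hf : ∀ s, c s ≠ s) (h : Good c V W)
    {ρ : ι → S} (hρ : ρ ∈ V) (i : ι) {p : S} (hp : p ≠ c (ρ i)) {g : ι → S → ℚ}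
    (hg : Within c (Finset.univ.erase i) ρ g) :
    ∑ x ∈ W, ind c {ρ i, p} (x i) * pr g (Finset.univ.erase i) x = 1 := by
  have hcs := consistent_pair hc hf hp
  have hn := h.null _ (hg.update hc hcs (by simp)).val
  rw [Finset.sum_congr rfl fun x _ => pr_update (Finset.mem_univ i) _,
    Finset.sum_congr rfl (s₁ := W) fun x _ => pr_update (Finset.mem_univ i) _,
    Finset.sum_eq_single ρ] at hn
  · rw [← hn, ind_of_mem (by simp), one_mul, pr_eq_one hg.one]
  · intro x hx hxρ
    obtain ⟨j, e⟩ := h.dichV ρ hρ x hx hxρ.symm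
    by_cases hji : j = i
    · subst hji
      rw [e, ind_eq_zero hcs (by simp [hc _]), zero_mul]
    · have hj : j ∈ Finset.univ.erase i := Finset.mem_erase.2 ⟨hji, Finset.mem_univ j⟩
      rw [pr_eq_zero hj (by rw [e, hg.zero j hj]), mul_zero]
  · exact fun hne => absurd hρ hne

/-- Words with a common letter at `i` form a cover as soon as they satisfy the sum condition. -/
lemma Good.cover (hf : ∀ s, c s ≠ s) (h : Good c V W) {i : ι} {t : S} {r : ι → S}
    {C : Finset (ι → S)} (hC : ∀ u ∈ C, u ∈ V ∧ u i = t ∧ Ov c (Finset.univ.erase i) u r)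
    (hne : ∀ u ∈ C, ∃ j, j ≠ i ∧ u j ≠ r j)
    (hsum : ∀ g, Within c (Finset.univ.erase i) r g →
      ∑ u ∈ C, pr g (Finset.univ.erase i) u = 1) : Cover c (Finset.univ.erase i) r C := by
  refine ⟨fun u hu => (hC u hu).2.2, fun u hu v hv huv => ?_, fun u hu v hv ht => ?_,
    fun u hu => ?_, fun g hg h1 h0 => hsum g ⟨hg, h1, h0⟩⟩
  · obtain ⟨j, e⟩ := h.dichV u (hC u hu).1 v (hC v hv).1 huv
    refine ⟨j, Finset.mem_erase.2 ⟨?_, Finset.mem_univ j⟩, e⟩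
    rintro rfl
    rw [(hC u hu).2.1, (hC v hv).2.1] at e
    exact hf _ e.symm
  · obtain ⟨j, hj, e, h'⟩ := ht
    refine h.twinV u (hC u hu).1 v (hC v hv).1 ⟨j, Finset.mem_univ j, e, fun k _ hkj => ?_⟩
    by_cases hki : k = i
    · rw [hki, (hC u hu).2.1, (hC v hv).2.1]
    · exact h' k (Finset.mem_erase.2 ⟨hki, Finset.mem_univ k⟩) hkj
  · obtain ⟨j, hj, e⟩ := hne u hu
    exact ⟨j, Finset.mem_erase.2 ⟨hj, Finset.mem_univ j⟩, e⟩

section Near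
variable {v w : ι → S} {i : ι}

lemma Good.near_compl (h : Good c V W) (hw : w ∈ W)
    (hoff : ∀ k, k ≠ i → w k = v k) {x : ι → S} (hx : x ∈ W) (hxw : x ≠ w)
    (hov : Ov c (Finset.univ.erase i) x v) : x i = c (w i) := by
  obtain ⟨j, e⟩ := h.dichW w hw x hx hxw.symm
  by_cases hji : j = i
  · rwa [← hji]
  · exact absurd (by rw [e, hoff j hji]) (hov j (Finset.mem_erase.2 ⟨hji, Finset.mem_univ j⟩))

lemma Good.slot (hc : Function.Involutive c) (hf : ∀ s, c s ≠ s) (h : Good c V W)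
    (hv : v ∈ V) (hw : w ∈ W) (h1 : w i ≠ v i) (h2 : w i ≠ c (v i))
    (hoff : ∀ k, k ≠ i → w k = v k) :
    Slot c (Finset.univ.erase i) v (side c V W i (v i)) (side c W V i (v i)) := by
  have h3 : c (v i) ≠ c (w i) := fun e => h1 (hc.injective e).symm
  have h4 : v i ≠ c (w i) := fun e => h2 (by rw [e, hc])
  have hvv : Ov c (Finset.univ.erase i) w v := fun k hk => by
    rw [hoff k (Finset.ne_of_mem_erase hk)]; exact (hf _).symm
  have hCm : ∀ u ∈ (side c W V i (v i)).filter (Ov c (Finset.univ.erase i) · v),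
      u ∈ V ∧ u i = c (v i) ∧ Ov c (Finset.univ.erase i) u v := by
    intro u hu
    rw [Finset.mem_filter, mem_side] at hu
    obtain ⟨⟨hu, e⟩ | ⟨hu, e⟩, ho⟩ := hu
    · by_cases huw : u = w
      · exact absurd (by rw [← e, huw]) h1
      · exact absurd (by rw [← e, ← h.near_compl hw hoff hu huw ho]) h4
    · exact ⟨hu, e, ho⟩
  refine ⟨h.null_side hc hf i _, mem_side.2 (Or.inl ⟨hv, rfl⟩), fun a ha ho => ?_,
    h.cover hf hCm (fun u hu => ?_) fun g hg => ?_⟩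
  · rcases mem_side.1 ha with ⟨ha, e⟩ | ⟨ha, e⟩
    · by_contra hne
      have := h.symm.near_compl (v := v) hv (fun _ _ => rfl) ha hne ho
      exact hf _ (by rw [← this, e])
    · by_cases haw : a = w
      · exact absurd (by rw [← e, haw]) h2
      · exact absurd (by rw [← e, ← h.near_compl hw hoff ha haw ho]) h3
  · by_contra! hcon
    exact h.twinV v hv u (hCm u hu).1 ⟨i, Finset.mem_univ i, (hCm u hu).2.1,
      fun k _ hk => hcon k hk⟩
  · have hg' : Within c (Finset.univ.erase i) w g := by
      refine ⟨hg.val, fun k hk => ?_, fun k hk => ?_⟩ <;> rw [hoff k (Finset.ne_of_mem_erase hk)]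
      · exact hg.one k hk
      · exact hg.zero k hk
    have hs := h.symm.sum_tile hc hf hw i h3 hg'
    have hcs := consistent_pair hc hf h3
    rw [← hs]
    have hsub : (side c W V i (v i)).filter (Ov c (Finset.univ.erase i) · v) ⊆ V :=
      fun u hu => (hCm u hu).1
    rw [← Finset.sum_subset hsub (f := fun x => ind c {w i, c (v i)} (x i) *
      pr g (Finset.univ.erase i) x)]
    · refine Finset.sum_congr rfl fun u hu => ?_
      rw [(hCm u hu).2.1, ind_of_mem (by simp), one_mul]
    · intro x hx hxC
      by_cases ho : Ov c (Finset.univ.erase i) x v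
      · by_cases hxv : x = v
        · rw [hxv, ind_eq_zero hcs (by simp), zero_mul]
        · have e := h.symm.near_compl (v := v) hv (fun _ _ => rfl) hx hxv ho
          exact absurd (Finset.mem_filter.2 ⟨mem_side.2 (Or.inr ⟨hx, e⟩), ho⟩) hxC
      · rw [hg.eq_zero ho, mul_zero]

lemma Good.slot_mem (hc : Function.Involutive c) (h : Good c V W)
    (hw : w ∈ W) (h1 : w i ≠ v i) (h2 : w i ≠ c (v i))
    (hoff : ∀ k, k ≠ i → w k = v k) {u : ι → S} (hu : u ∈ side c W V i (v i))
    (ho : Ov c (Finset.univ.erase i) u v) : u ∈ V ∧ u i = c (v i) := by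
  rcases mem_side.1 hu with ⟨hu, e⟩ | hu
  · by_cases huw : u = w
    · exact absurd (by rw [← e, huw]) h1
    · have := h.near_compl hw hoff hu huw ho
      exact absurd (by rw [← e, this, hc]) h2
  · exact hu

/-- Small codes contain no two words, one in each, differing in a single coordinate. -/
lemma Good.no_near_of_le_six (hc : Function.Involutive c) (hf : ∀ s, c s ≠ s) (h : Good c V W)
    (h6 : V.card ≤ 6) (hv : v ∈ V) (hw : w ∈ W) (h1 : w i ≠ v i) (h2 : w i ≠ c (v i))
    (hoff : ∀ k, k ≠ i → w k = v k) : False := by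
  have key : ∀ {V W : Finset (ι → S)} {v w : ι → S}, Good c V W → V.card ≤ 6 → v ∈ V → w ∈ W →
      w i ≠ v i → w i ≠ c (v i) → (∀ k, k ≠ i → w k = v k) →
      5 ≤ (side c W V i (v i)).card ∧ ∀ u ∈ V, u = v ∨ u i = c (v i) := by
    intro V W v w h h6 hv hw h1 h2 hoff
    have hs := h.slot hc hf hv hw h1 h2 hoff
    have h5 := hs.cover.five_le hc hf
    refine ⟨h5.trans (Finset.card_le_card (Finset.filter_subset _ _)), ?_⟩
    set C := (side c W V i (v i)).filter (Ov c (Finset.univ.erase i) · v)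
    have hm : ∀ u ∈ C, u ∈ V ∧ u i = c (v i) := fun u hu =>
      h.slot_mem hc hw h1 h2 hoff (Finset.mem_filter.1 hu).1 (Finset.mem_filter.1 hu).2
    have hvC : v ∉ C := fun hm' => hf _ (hm v hm').2.symm
    have hVC : V = insert v C := by
      symm
      refine Finset.eq_of_subset_of_card_le (Finset.insert_subset hv fun u hu => (hm u hu).1) ?_
      rw [Finset.card_insert_of_notMem hvC]; omega
    intro u hu
    rw [hVC, Finset.mem_insert] at hu
    exact hu.imp_right fun hu => (hm u hu).2
  have h3 : v i ≠ c (w i) := fun e => h2 (by rw [e, hc])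
  obtain ⟨n5, hV⟩ := key h h6 hv hw h1 h2 hoff
  obtain ⟨-, hW⟩ := key h.symm (by rw [← h.null.card_eq]; exact h6) hw hv h1.symm h3
    fun k hk => (hoff k hk).symm
  have hA : side c V W i (v i) ⊆ {v} := by
    intro u hu
    rw [Finset.mem_singleton]
    rcases mem_side.1 hu with ⟨hu, e⟩ | ⟨hu, e⟩
    · exact (hV u hu).resolve_right fun e' => hf _ (by rw [← e', e])
    · rcases hW u hu with rfl | e'
      · exact absurd e h2
      · exact absurd (hc.injective (by rw [← e', e])) h1
  have := Finset.card_le_card hA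
  rw [(h.null_side hc hf i _).card_eq, Finset.card_singleton] at this
  omega

lemma card_four (hc : Function.Involutive c) (hf : ∀ s, c s ≠ s) {q s : S} (h1 : s ≠ q)
    (h2 : s ≠ c q) (V : Finset (ι → S)) :
    (V.filter (· i = q)).card + (V.filter (· i = c q)).card + (V.filter (· i = s)).card +
      (V.filter (· i = c s)).card +
      (V.filter fun u => (u i ≠ q ∧ u i ≠ c q) ∧ u i ≠ s ∧ u i ≠ c s).card = V.card := by
  rw [← card_compl_le (c := c) hf i q V,
    ← card_compl_le (c := c) hf i s (V.filter fun u => u i ≠ q ∧ u i ≠ c q)]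
  simp only [Finset.filter_filter]
  have e1 : V.filter (fun u => (u i ≠ q ∧ u i ≠ c q) ∧ u i = s) = V.filter (· i = s) :=
    Finset.filter_congr fun u _ => ⟨fun h => h.2, fun h => ⟨by rw [h]; exact ⟨h1, h2⟩, h⟩⟩
  have e2 : V.filter (fun u => (u i ≠ q ∧ u i ≠ c q) ∧ u i = c s) = V.filter (· i = c s) :=
    Finset.filter_congr fun u _ => ⟨fun h => h.2, fun h => ⟨by
      rw [h]; exact ⟨fun e => h2 (by rw [← e, hc]), fun e => h1 (hc.injective e)⟩, h⟩⟩
  rw [e1, e2]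
  omega

lemma Good.no_near (hc : Function.Involutive c) (hf : ∀ s, c s ≠ s) (h : Good c V W)
    (h12 : V.card = 12) (hv : v ∈ V) (hw : w ∈ W) (h1 : w i ≠ v i) (h2 : w i ≠ c (v i))
    (hoff : ∀ k, k ≠ i → w k = v k) : False := by
  have h3 : v i ≠ c (w i) := fun e => h2 (by rw [e, hc])
  have hoff' : ∀ k, k ≠ i → v k = w k := fun k hk => (hoff k hk).symm
  have hs1 := h.slot hc hf hv hw h1 h2 hoff
  have hs2 := h.symm.slot hc hf hw hv h1.symm h3 hoff'
  have e1 := h.card_side i (v i)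
  have e2 := h.symm.card_side i (v i)
  have e3 := h.symm.card_side i (w i)
  have e4 := h.card_side i (w i)
  have e5 := hs1.null.card_eq
  have e6 := hs2.null.card_eq
  have e7 := card_four (i := i) hc hf h1 h2 V
  have e8 := card_four (i := i) hc hf h1 h2 W
  have e9 := h.null.card_eq
  have hq6 : (side c V W i (v i)).card = 6 := by
    by_contra hne
    have g1 : ¬ (side c V W i (v i)).card ≤ 6 := fun hle => hne (hs1.six_le hc hf hle).1
    have g2 := fun hle => (hs2.six_le hc hf hle).1
    omega
  have hs6 : (side c W V i (w i)).card = 6 := by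
    by_contra hne
    have g2 : ¬ (side c W V i (w i)).card ≤ 6 := fun hle => hne (hs2.six_le hc hf hle).1
    omega
  have hrest : (W.filter fun u => (u i ≠ v i ∧ u i ≠ c (v i)) ∧ u i ≠ w i ∧ u i ≠ c (w i)) = ∅ :=
    Finset.card_eq_zero.1 (by omega)
  obtain ⟨-, j, hj, ⟨e, heB, heo, hej⟩, -, ρ, -, -, hBρ, f, hfB, hfo, -, hρf⟩ :=
    hs1.six_le hc hf hq6.le
  obtain ⟨-, j₂, hj₂, -, ⟨n₂, hn₂, hn₂j, hn₂w⟩, ρ₂, hρ₂, hρ₂j, -, f₂, hf₂B, hf₂o, hf₂j, hρf₂⟩ :=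
    hs2.six_le hc hf hs6.le
  have hj₂i := Finset.ne_of_mem_erase hj₂
  -- `n₂` and `ρ₂` belong to `V`
  have hn₂V : n₂ ∈ V ∧ n₂ i = c (w i) := by
    rcases mem_side.1 hn₂ with ⟨hm, em⟩ | hm
    · refine absurd ⟨j₂, Finset.mem_univ _, hn₂j, fun k _ hk => ?_⟩ (h.twinW w hw n₂ hm)
      by_cases hki : k = i
      · rw [hki, em]
      · exact hn₂w k (Finset.mem_erase.2 ⟨hki, Finset.mem_univ k⟩) hk
    · exact hm
  have hf₂W := h.symm.slot_mem hc hv h1.symm h3 hoff' hf₂B hf₂o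
  have hρ₂V : ρ₂ ∈ V ∧ ρ₂ i = w i := by
    rcases mem_side.1 hρ₂ with hm | ⟨hm, em⟩
    · exact hm
    · refine absurd ⟨j₂, Finset.mem_univ _, by rw [hρ₂j, hf₂j], fun k _ hk => ?_⟩
        (h.twinW f₂ hf₂W.1 ρ₂ hm)
      by_cases hki : k = i
      · rw [hki, em, hf₂W.2]
      · exact hρf₂ k (Finset.mem_erase.2 ⟨hki, Finset.mem_univ k⟩) hk
  -- all words of the slice at `v i` agree with `v` at `j₂`
  have hC : ∀ u ∈ side c W V i (v i), Ov c (Finset.univ.erase i) u v → u j₂ = v j₂ := by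
    intro u hu ho
    obtain ⟨huV, hui⟩ := h.slot_mem hc hw h1 h2 hoff hu ho
    have hun : u ≠ n₂ := by
      rintro rfl
      exact h1 (hc.injective (by rw [← hn₂V.2, hui]))
    obtain ⟨k, ek⟩ := h.dichV n₂ hn₂V.1 u huV hun.symm
    by_cases hki : k = i
    · rw [hki, hui, hn₂V.2, hc] at ek
      exact absurd ek.symm h2
    have hkm : k ∈ Finset.univ.erase i := Finset.mem_erase.2 ⟨hki, Finset.mem_univ k⟩
    by_cases hkj : k = j₂
    · rw [hkj, hn₂j, hc] at ek
      rw [ek, hoff _ hj₂i]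
    · exact absurd (by rw [ek, hn₂w k hkm hkj, hoff k hki]) (ho k hkm)
  have hjj : j₂ ≠ j := by rintro rfl; exact hej (hC e heB heo)
  have hB : ∀ u ∈ side c W V i (v i), u j₂ = v j₂ := by
    intro u hu
    rcases hBρ u hu with rfl | ho
    · rw [hρf j₂ hj₂ hjj]; exact hC f hfB hfo
    · exact hC u hu ho
  have hA : ∀ u ∈ side c V W i (v i), u j₂ = v j₂ := by
    intro u hu
    by_contra hne
    set T : ι → Finset S := fun k => if k = j₂ then {c (v k), u k} else {u k} with hTd
    have hT : ∀ k, ∀ s ∈ T k, c s ∉ T k := by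
      intro k
      simp only [hTd]
      split_ifs with hk
      · exact consistent_pair hc hf (by rw [hk, hc]; exact hne)
      · exact consistent_singleton hf _
    have hn := hs1.null _ fun k => val_ind hc (hT k)
    rw [Finset.sum_eq_zero (s := side c W V i (v i))] at hn
    · have hpos : 0 <
          ∑ x ∈ side c V W i (v i), pr (fun k => ind c (T k)) (Finset.univ.erase i) x := by
        refine Finset.sum_pos' (fun _ _ => pr_ind_nonneg _ _ _) ⟨u, hu, pr_ind_pos fun k _ => ?_⟩
        exact hT k _ (by simp only [hTd]; split_ifs <;> simp)
      exact hpos.ne' hn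
    · intro x hx
      exact pr_eq_zero hj₂ (ind_eq_zero (hT j₂) (by simp [hTd, hB x hx]))
  -- hence `ρ₂` is tiled by words of `W` sharing its letter at `i`
  have hne : v i ≠ c (ρ₂ i) := by rw [hρ₂V.2]; exact h3
  have hc2 : c (v i) ≠ c (ρ₂ i) := fun e => h1 (by rw [← hρ₂V.2]; exact (hc.injective e).symm)
  set C := (W.filter (· i = w i)).filter (Ov c (Finset.univ.erase i) · ρ₂) with hCd
  have hcov : Cover c (Finset.univ.erase i) ρ₂ C := by
    refine h.symm.cover hf (t := w i) (fun u hu => ?_) (fun u hu => ?_) fun g hg => ?_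
    · rw [Finset.mem_filter, Finset.mem_filter] at hu
      exact ⟨hu.1.1, hu.1.2, hu.2⟩
    · rw [Finset.mem_filter, Finset.mem_filter] at hu
      by_contra! hcon
      refine Finset.disjoint_left.1 h.disj hρ₂V.1 ?_
      have : ρ₂ = u := by
        funext k
        by_cases hk : k = i
        · rw [hk, hρ₂V.2, hu.1.2]
        · rw [hcon k hk]
      rw [this]
      exact hu.1.1
    · have hs := h.sum_tile hc hf hρ₂V.1 i hc2 hg
      have hcs := consistent_pair hc hf hc2
      have hsub : C ⊆ W := (Finset.filter_subset _ _).trans (Finset.filter_subset _ _)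
      rw [← hs, ← Finset.sum_subset hsub (f := fun x => ind c {ρ₂ i, c (v i)} (x i) *
        pr g (Finset.univ.erase i) x)]
      · refine Finset.sum_congr rfl fun u hu => ?_
        rw [Finset.mem_filter, Finset.mem_filter] at hu
        rw [hu.1.2, ind_of_mem (by simp [hρ₂V.2]), one_mul]
      · intro x hx hxC
        by_cases ho : Ov c (Finset.univ.erase i) x ρ₂
        · have hx1 : x i ≠ w i := fun e =>
            hxC (Finset.mem_filter.2 ⟨Finset.mem_filter.2 ⟨hx, e⟩, ho⟩)
          by_cases hx2 : x i = c (w i)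
          · rw [hx2, ind_eq_zero hcs (by simp [hc _, hρ₂V.2]), zero_mul]
          by_cases hx3 : x i = v i
          · rw [hx3, ind_eq_zero hcs (by simp), zero_mul]
          by_cases hx4 : x i = c (v i)
          · refine absurd ?_ (ho j₂ hj₂)
            rw [hA x (mem_side.2 (Or.inr ⟨hx, hx4⟩)), hρ₂j, hc, hoff _ hj₂i]
          · have : x ∈ (∅ : Finset (ι → S)) := by
              rw [← hrest]
              exact Finset.mem_filter.2 ⟨hx, ⟨hx3, hx4⟩, hx1, hx2⟩
            simp at this
        · rw [hg.eq_zero ho, mul_zero]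
  have h5 := hcov.five_le hc hf
  have hwC : w ∉ C := fun hm => (Finset.mem_filter.1 hm).2 j₂ hj₂ (by rw [hρ₂j, hc])
  have hle := Finset.card_le_card (Finset.insert_subset
    (Finset.mem_filter.2 ⟨hw, rfl⟩ : w ∈ W.filter (· i = w i))
    (Finset.filter_subset _ _ : C ⊆ W.filter (· i = w i)))
  rw [Finset.card_insert_of_notMem hwC] at hle
  have hpos : 0 < (V.filter (· i = c (w i))).card :=
    Finset.card_pos.2 ⟨n₂, Finset.mem_filter.2 hn₂V⟩
  omega

end Near
end Good
end

section
open scoped Classical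

/-! ### Slices have at least five words -/

section Weight
variable {ι : Type} {c : S → S} {K : Finset ι} {a v : ι → S}

/-- The proportion of the box of `a` covered by the box of `v` in the coordinates of `K`. -/
noncomputable def wt (c : S → S) (K : Finset ι) (a v : ι → S) : ℚ := pr (fun j => ind c {a j}) K v

lemma wt_self : wt c K a a = 1 := pr_eq_one fun _ _ => ind_of_mem (by simp)

lemma wt_nonneg : 0 ≤ wt c K a v := pr_ind_nonneg _ _ _

lemma wt_pos (hc : Function.Involutive c) (h : Ov c K v a) : 0 < wt c K a v :=
  pr_ind_pos fun j hj e => h j hj (by rw [Finset.mem_singleton] at e; rw [← e, hc])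

lemma wt_eq_zero (hc : Function.Involutive c) (hf : ∀ s, c s ≠ s) (h : ¬ Ov c K v a) :
    wt c K a v = 0 := by
  unfold Ov at h
  push Not at h
  obtain ⟨j, hj, e⟩ := h
  exact pr_eq_zero hj (ind_eq_zero (consistent_singleton hf _) (by simp [e, hc _]))

lemma ov_of_wt_pos (hc : Function.Involutive c) (hf : ∀ s, c s ≠ s) (h : 0 < wt c K a v) :
    Ov c K v a := by
  by_contra h'
  exact h.ne' (wt_eq_zero hc hf h')

lemma wt_le_half (h : ∃ j ∈ K, v j ≠ a j) : wt c K a v ≤ 1 / 2 := by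
  obtain ⟨j, hj, e⟩ := h
  exact pr_ind_le_half _ hj (by simpa using e)

lemma wt_le_quarter {j k : ι} (hj : j ∈ K) (hk : k ∈ K) (hjk : j ≠ k) (h1 : v j ≠ a j)
    (h2 : v k ≠ a k) : wt c K a v ≤ 1 / 4 :=
  pr_ind_le_quarter _ hj hk hjk (by simpa using h1) (by simpa using h2)

lemma exists_of_quarter_lt_wt (h : 1 / 4 < wt c K a v) (hne : ∃ j ∈ K, v j ≠ a j) :
    ∃ j ∈ K, v j ≠ a j ∧ ∀ i ∈ K, i ≠ j → v i = a i := by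
  obtain ⟨j, hj, e⟩ := hne
  refine ⟨j, hj, e, fun i hi hij => ?_⟩
  by_contra e'
  exact h.not_ge (wt_le_quarter hi hj hij e' e)

end Weight

section Slice
variable {ι : Type} {c : S → S} {V W : Finset (ι → S)} {i : ι} {q : S}

/-- No word of one code differs from a word of the other code in a single coordinate. -/
def NoNear (V W : Finset (ι → S)) (c : S → S) : Prop :=
  ∀ v ∈ V, ∀ w ∈ W, ∀ i, w i ≠ v i → w i ≠ c (v i) → ¬ ∀ k, k ≠ i → w k = v k

lemma NoNear.symm (hc : Function.Involutive c) (h : NoNear V W c) : NoNear W V c :=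
  fun w hw v hv i h1 h2 h3 => h v hv w hw i h1.symm (fun e => h2 (by rw [e, hc]))
    fun k hk => (h3 k hk).symm

variable [Fintype ι]

lemma mem_or_of_mem_side {u : ι → S} (hu : u ∈ side c V W i q) : u ∈ V ∨ u ∈ W :=
  (mem_side.1 hu).imp And.left And.left

lemma Good.side_letter (h : Good c V W) {u : ι → S} (hu : u ∈ side c V W i q) (huV : u ∈ V) :
    u i = q := by
  rcases mem_side.1 hu with hu | hu
  · exact hu.2
  · exact absurd hu.1 (Finset.disjoint_left.1 h.disj huV)

lemma Good.side_letter' (h : Good c V W) {u : ι → S} (hu : u ∈ side c V W i q) (huW : u ∈ W) :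
    u i = c q := by
  rcases mem_side.1 hu with hu | hu
  · exact absurd huW (Finset.disjoint_left.1 h.disj hu.1)
  · exact hu.2

/-- Distinct words of the same code in the same side are dichotomous off `i`. -/
lemma Good.side_dich (hf : ∀ s, c s ≠ s) (h : Good c V W) {u v : ι → S}
    (hu : u ∈ side c V W i q) (hv : v ∈ side c V W i q) (huv : u ≠ v) (hm : u ∈ V ↔ v ∈ V) :
    ∃ j ∈ Finset.univ.erase i, v j = c (u j) := by
  have key : u i = v i → (∃ j, v j = c (u j)) → ∃ j ∈ Finset.univ.erase i, v j = c (u j) := by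
    rintro e ⟨j, hj⟩
    refine ⟨j, Finset.mem_erase.2 ⟨?_, Finset.mem_univ j⟩, hj⟩
    rintro rfl
    rw [e] at hj
    exact hf _ hj.symm
  by_cases huV : u ∈ V
  · have hvV := hm.1 huV
    exact key (by rw [h.side_letter hu huV, h.side_letter hv hvV]) (h.dichV u huV v hvV huv)
  · have hvV := fun hv => huV (hm.2 hv)
    have huW := (mem_or_of_mem_side hu).resolve_left huV
    have hvW := (mem_or_of_mem_side hv).resolve_left hvV
    exact key (by rw [h.side_letter' hu huW, h.side_letter' hv hvW]) (h.dichW u huW v hvW huv)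

/-- Twins in the same side belong to different codes. -/
lemma Good.side_twin (h : Good c V W) {u v : ι → S}
    (hu : u ∈ side c V W i q) (hv : v ∈ side c V W i q)
    (ht : TwinOn c (Finset.univ.erase i) u v) : ¬ (u ∈ V ↔ v ∈ V) := by
  intro hm
  obtain ⟨j, hj, e, hoff⟩ := ht
  have key : u i = v i → TwinOn c Finset.univ u v := fun e' =>
    ⟨j, Finset.mem_univ j, e, fun k _ hkj => by
      by_cases hki : k = i
      · rw [hki, e']
      · exact hoff k (Finset.mem_erase.2 ⟨hki, Finset.mem_univ k⟩) hkj⟩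
  by_cases huV : u ∈ V
  · have hvV := hm.1 huV
    exact h.twinV u huV v hvV (key (by rw [h.side_letter hu huV, h.side_letter hv hvV]))
  · have hvV := fun hv => huV (hm.2 hv)
    have huW := (mem_or_of_mem_side hu).resolve_left huV
    have hvW := (mem_or_of_mem_side hv).resolve_left hvV
    exact h.twinW u huW v hvW (key (by rw [h.side_letter' hu huW, h.side_letter' hv hvW]))

/-- Words in opposite sides differ off `i`. -/
lemma Good.side_ne (h : Good c V W) {a b : ι → S}
    (ha : a ∈ side c V W i q) (hb : b ∈ side c W V i q) :
    ∃ j ∈ Finset.univ.erase i, b j ≠ a j := by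
  by_contra! hcon
  have hoff : ∀ k, k ≠ i → b k = a k := fun k hk =>
    hcon k (Finset.mem_erase.2 ⟨hk, Finset.mem_univ k⟩)
  have heq : a i = b i → a = b := fun e => funext fun k => by
    by_cases hk : k = i
    · rw [hk, e]
    · rw [hoff k hk]
  have htw : b i = c (a i) → TwinOn c Finset.univ a b := fun e =>
    ⟨i, Finset.mem_univ i, e, fun k _ hk => hoff k hk⟩
  have htw' : a i = c (b i) → TwinOn c Finset.univ b a := fun e =>
    ⟨i, Finset.mem_univ i, e, fun k _ hk => (hoff k hk).symm⟩
  rcases mem_side.1 ha with ⟨ha, ea⟩ | ⟨ha, ea⟩ <;> rcases mem_side.1 hb with ⟨hb, eb⟩ | ⟨hb, eb⟩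
  · have := heq (by rw [ea, eb])
    subst this
    exact Finset.disjoint_left.1 h.disj ha hb
  · exact h.twinV a ha b hb (htw (by rw [ea, eb]))
  · exact h.twinW b hb a ha (htw' (by rw [ea, eb]))
  · have := heq (by rw [ea, eb])
    subst this
    exact Finset.disjoint_left.1 h.disj hb ha

/-- Words in opposite sides which differ, and overlap, in a single coordinate off `i` belong to the
same code. -/
lemma Good.side_near (h : Good c V W) (hn : NoNear V W c) (hc : Function.Involutive c)
    {a b : ι → S}
    (ha : a ∈ side c V W i q) (hb : b ∈ side c W V i q) {j : ι}
    (h1 : b j ≠ a j) (h2 : b j ≠ c (a j)) (hoff : ∀ k ∈ Finset.univ.erase i, k ≠ j → b k = a k) :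
    a ∈ V ↔ b ∈ V := by
  have key : a i = b i → ∀ k, k ≠ j → b k = a k := fun e k hk => by
    by_cases hki : k = i
    · rw [hki, e]
    · exact hoff k (Finset.mem_erase.2 ⟨hki, Finset.mem_univ k⟩) hk
  have nV : ∀ {x : ι → S}, x ∈ W → x ∉ V := fun hx hx' => Finset.disjoint_left.1 h.disj hx' hx
  rcases mem_side.1 ha with ⟨ha, ea⟩ | ⟨ha, ea⟩ <;> rcases mem_side.1 hb with ⟨hb, eb⟩ | ⟨hb, eb⟩
  · exact absurd (key (by rw [ea, eb])) (hn a ha b hb j h1 h2)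
  · simp [ha, hb]
  · simp [nV ha, nV hb]
  · exact absurd (key (by rw [ea, eb])) (hn.symm hc a ha b hb j h1 h2)

section NoTwins

lemma Good.sum_wt (hc : Function.Involutive c) (hf : ∀ s, c s ≠ s) (h : Good c V W) (a : ι → S) :
    ∑ x ∈ side c V W i q, wt c (Finset.univ.erase i) a x =
      ∑ x ∈ side c W V i q, wt c (Finset.univ.erase i) a x :=
  h.null_side hc hf i q _ fun _ => val_ind hc (consistent_singleton hf _)

/-- Without twins in small sides, no word is dichotomous to all other words in its side. -/
lemma Good.exists_ov (hc : Function.Involutive c) (hf : ∀ s, c s ≠ s) (h : Good c V W)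
    (hB : ∀ u ∈ side c W V i q, ∀ v ∈ side c W V i q, ¬ TwinOn c (Finset.univ.erase i) u v)
    (h4 : (side c V W i q).card ≤ 4) {a : ι → S} (ha : a ∈ side c V W i q) :
    ∃ x ∈ side c V W i q, x ≠ a ∧ Ov c (Finset.univ.erase i) x a := by
  by_contra! hcon
  have hsum : ∀ g, Within c (Finset.univ.erase i) a g →
      ∑ x ∈ side c W V i q, pr g (Finset.univ.erase i) x = 1 := by
    intro g hg
    rw [← h.null_side hc hf i q g hg.val, Finset.sum_eq_single a]
    · exact pr_eq_one hg.one
    · exact fun x hx hxa => hg.eq_zero (hcon x hx hxa)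
    · exact fun hne => absurd ha hne
  have hcov : Cover c (Finset.univ.erase i) a
      ((side c W V i q).filter (Ov c (Finset.univ.erase i) · a)) := by
    refine ⟨fun u hu => (Finset.mem_filter.1 hu).2, fun u hu v hv huv => ?_, fun u hu v hv => ?_,
      fun u hu => h.side_ne ha (Finset.mem_filter.1 hu).1, fun g hg h1 h0 => ?_⟩
    · rw [Finset.mem_filter] at hu hv
      have hg := within_ind_pair hc hf hu.2
      have hs := hsum _ hg
      by_contra! hcon
      rw [← Finset.add_sum_erase _ _ hu.1,
        pr_eq_one (fun j hj => by rw [if_pos hj]; exact ind_of_mem (by simp))] at hs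
      have hv' : v ∈ (side c W V i q).erase u := Finset.mem_erase.2 ⟨huv.symm, hv.1⟩
      have hle := Finset.single_le_sum (f := fun x => pr (fun j => ind c
        (if j ∈ Finset.univ.erase i then {a j, u j} else {a j})) (Finset.univ.erase i) x)
        (fun x _ => pr_ind_nonneg _ _ x) hv'
      have hpos : 0 < pr (fun j => ind c
          (if j ∈ Finset.univ.erase i then {a j, u j} else {a j})) (Finset.univ.erase i) v := by
        refine pr_ind_pos fun j hj => ?_
        rw [if_pos hj]
        simp only [Finset.mem_insert, Finset.mem_singleton, not_or]
        exact ⟨fun e => hv.2 j hj (by rw [← e, hc]), fun e => hcon j hj (by rw [← e, hc])⟩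
      linarith
    · exact hB u (Finset.mem_filter.1 hu).1 v (Finset.mem_filter.1 hv).1
    · rw [← hsum g ⟨hg, h1, h0⟩]
      refine Finset.sum_subset (Finset.filter_subset _ _) fun x hx hx' => ?_
      exact Within.eq_zero ⟨hg, h1, h0⟩ fun ho => hx' (Finset.mem_filter.2 ⟨hx, ho⟩)
  have := hcov.five_le hc hf
  have h2 := Finset.card_le_card (Finset.filter_subset (Ov c (Finset.univ.erase i) · a)
    (side c W V i q))
  have := (h.null_side hc hf i q).card_eq
  omega

/-- Without twins in small sides, words in opposite sides overlap, and sides have four words. -/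
lemma Good.side_ov (hc : Function.Involutive c) (hf : ∀ s, c s ≠ s) (h : Good c V W)
    (hn : NoNear V W c)
    (hB : ∀ u ∈ side c W V i q, ∀ v ∈ side c W V i q, ¬ TwinOn c (Finset.univ.erase i) u v)
    (h4 : (side c V W i q).card ≤ 4) {a : ι → S} (ha : a ∈ side c V W i q) :
    (side c V W i q).card = 4 ∧ ∀ b ∈ side c W V i q, Ov c (Finset.univ.erase i) b a := by
  set K := Finset.univ.erase i
  set B := side c W V i q
  obtain ⟨x, hx, hxa, hxo⟩ := h.exists_ov hc hf hB h4 ha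
  have hsum : ∑ x ∈ side c V W i q, wt c K a x = ∑ x ∈ B, wt c K a x := h.sum_wt hc hf a
  have hBc : (side c V W i q).card = B.card := (h.null_side hc hf i q).card_eq
  have hgt : 1 < ∑ x ∈ B, wt c K a x := by
    rw [← hsum, ← Finset.add_sum_erase _ _ ha, wt_self]
    have := Finset.single_le_sum (f := fun x => wt c K a x) (fun x _ => wt_nonneg)
      (Finset.mem_erase.2 ⟨hxa, hx⟩)
    have hp := wt_pos (K := K) hc hxo
    linarith
  have hhalf : ∀ b ∈ B, wt c K a b ≤ 1 / 2 := fun b hb => wt_le_half (h.side_ne ha hb)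
  have hone : ∀ b ∈ B, ∀ b' ∈ B, 1 / 4 < wt c K a b → 1 / 4 < wt c K a b' → b = b' := by
    intro b hb b' hb' w w'
    by_contra hne
    obtain ⟨j, hj, e, hoff⟩ := exists_of_quarter_lt_wt w (h.side_ne ha hb)
    obtain ⟨j', hj', e', hoff'⟩ := exists_of_quarter_lt_wt w' (h.side_ne ha hb')
    have o := ov_of_wt_pos hc hf (lt_trans (by norm_num) w)
    have o' := ov_of_wt_pos hc hf (lt_trans (by norm_num) w')
    have m := h.side_near hn hc ha hb e (o j hj) hoff
    have m' := h.side_near hn hc ha hb' e' (o' j' hj') hoff'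
    have hm : b ∈ V ↔ b' ∈ V := m.symm.trans m'
    have hm' : b ∈ W ↔ b' ∈ W := by
      have d1 : b ∈ V → b ∉ W := fun hx => Finset.disjoint_left.1 h.disj hx
      have d2 : b' ∈ V → b' ∉ W := fun hx => Finset.disjoint_left.1 h.disj hx
      have := mem_or_of_mem_side hb
      have := mem_or_of_mem_side hb'
      tauto
    obtain ⟨k, hk, ek⟩ := h.symm.side_dich hf hb hb' hne hm'
    have hkj : k = j := by
      by_contra hkj
      exact o' k hk (by rw [ek, hoff k hk hkj])
    have hkj' : k = j' := by
      by_contra hkj'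
      exact o k hk (by rw [← hoff' k hk hkj', ek, hc])
    refine hB b hb b' hb' ⟨k, hk, ek, fun m hm hmk => ?_⟩
    rw [hoff m hm (hkj ▸ hmk), hoff' m hm (hkj' ▸ hmk)]
  obtain ⟨b₀, hb₀⟩ : B.Nonempty := by
    rw [← Finset.card_pos, ← hBc]; exact Finset.card_pos.2 ⟨a, ha⟩
  have hsq : ∃ b₁ ∈ B, ∀ b ∈ B, b ≠ b₁ → wt c K a b ≤ 1 / 4 := by
    by_cases hex : ∃ b₁ ∈ B, 1 / 4 < wt c K a b₁
    · obtain ⟨b₁, hb₁, w⟩ := hex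
      exact ⟨b₁, hb₁, fun b hb hne => not_lt.1 fun w' => hne (hone b hb b₁ hb₁ w' w)⟩
    · push Not at hex
      exact ⟨b₀, hb₀, fun b hb _ => hex b hb⟩
  obtain ⟨b₁, hb₁, hq⟩ := hsq
  rw [← Finset.add_sum_erase _ _ hb₁] at hgt
  have hE := Finset.card_erase_of_mem hb₁
  have hEle : ∑ x ∈ B.erase b₁, wt c K a x ≤ (B.erase b₁).card * (1 / 4 : ℚ) := by
    rw [← nsmul_eq_mul, ← Finset.sum_const]
    exact Finset.sum_le_sum fun b hb =>
      hq b (Finset.mem_of_mem_erase hb) (Finset.ne_of_mem_erase hb)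
  have h1 := hhalf b₁ hb₁
  have hEc : 2 < (B.erase b₁).card := by
    have : (2 : ℚ) < (B.erase b₁).card := by linarith
    exact_mod_cast this
  have hBc4 : B.card = 4 := by omega
  refine ⟨by omega, fun b hb => ?_⟩
  by_contra ho
  have hz := wt_eq_zero hc hf ho
  by_cases hbb : b = b₁
  · rw [hE, hBc4] at hEle
    rw [← hbb, hz] at hgt
    rw [← hbb] at hEle
    norm_num at hEle hgt
    linarith
  · have hbm : b ∈ B.erase b₁ := Finset.mem_erase.2 ⟨hbb, hb⟩
    rw [← Finset.add_sum_erase _ _ hbm, hz] at hgt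
    have hle2 : ∑ x ∈ (B.erase b₁).erase b, wt c K a x ≤
        ((B.erase b₁).erase b).card * (1 / 4 : ℚ) := by
      rw [← nsmul_eq_mul, ← Finset.sum_const]
      refine Finset.sum_le_sum fun x hx => ?_
      have hx := Finset.mem_of_mem_erase hx
      exact hq x (Finset.mem_of_mem_erase hx) (Finset.ne_of_mem_erase hx)
    rw [Finset.card_erase_of_mem hbm, hE, hBc4] at hle2
    norm_num at hle2
    linarith

/-- Small sides contain twins. -/
lemma Good.exists_twin (hc : Function.Involutive c) (hf : ∀ s, c s ≠ s) (h : Good c V W)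
    (hn : NoNear V W c) (h4 : (side c V W i q).card ≤ 4) (hne : (side c V W i q).Nonempty) :
    (∃ u ∈ side c V W i q, ∃ v ∈ side c V W i q, TwinOn c (Finset.univ.erase i) u v) ∨
    ∃ u ∈ side c W V i q, ∃ v ∈ side c W V i q, TwinOn c (Finset.univ.erase i) u v := by
  by_contra! hcon
  obtain ⟨hA, hB⟩ := hcon
  set K := Finset.univ.erase i with hK
  obtain ⟨a, ha⟩ := hne
  have hcard := (h.side_ov hc hf hn hB h4 ha).1
  set A := side c V W i q with hAd
  set B := side c W V i q
  obtain ⟨α, hα, β, hβ, hαβ, hm⟩ : ∃ α ∈ A, ∃ β ∈ A, α ≠ β ∧ (α ∈ V ↔ β ∈ V) := by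
    obtain ⟨α, hα, β, hβ, h1, h2⟩ := Finset.exists_ne_map_eq_of_card_lt_of_maps_to
      (s := A) (t := (Finset.univ : Finset Bool)) (f := fun x => decide (x ∈ V))
      (by rw [hcard]; decide) (fun _ _ => Finset.mem_coe.2 (Finset.mem_univ _))
    exact ⟨α, hα, β, hβ, h1, by simpa using h2⟩
  obtain ⟨j, hj, ej⟩ := h.side_dich hf hα hβ hαβ hm
  rw [← hK] at hj
  -- the letters of `α` and `β` at `j` do not occur in the other side
  have hnull : Null c A B K := h.null_side hc hf i q
  have hbal : ∀ g : ι → S → ℚ, (∀ k, Val c (g k)) →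
      ∑ x ∈ A.filter (· j = α j), pr g (K.erase j) x =
        ∑ x ∈ A.filter (· j = c (α j)), pr g (K.erase j) x := by
    intro g hg
    have := hnull _ (val_update hg (j := j) (val_sgnPair hc hf (α j)))
    rw [Finset.sum_congr rfl fun x _ => pr_update hj _,
      Finset.sum_congr rfl (s₁ := B) fun x _ => pr_update hj _,
      Finset.sum_eq_zero (s := B)] at this
    · rw [← sub_eq_zero, ← this, Finset.sum_filter, Finset.sum_filter, ← Finset.sum_sub_distrib]
      refine Finset.sum_congr rfl fun x _ => ?_
      unfold sgnPair
      by_cases e : x j = α j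
      · simp [e, (hf (α j)).symm]
      · by_cases e' : x j = c (α j) <;> simp [e, e', hf]
    · intro b hb
      have h1 := (h.side_ov hc hf hn hB h4 hα).2 b hb j hj
      have h2 := (h.side_ov hc hf hn hB h4 hβ).2 b hb j hj
      rw [ej, hc] at h2
      simp [sgnPair, h1, h2]
  set P := A.filter (· j = α j)
  set Q := A.filter (· j = c (α j))
  have hαP : α ∈ P := Finset.mem_filter.2 ⟨hα, rfl⟩
  have hβQ : β ∈ Q := Finset.mem_filter.2 ⟨hβ, ej⟩
  have hPQ : P.card = Q.card := by
    have := hbal (fun _ _ => 1) fun _ => val_one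
    simpa [pr] using this
  have hQ2 : Q.card ≤ 2 := by
    have hd : Disjoint P Q := Finset.disjoint_filter.2 fun x _ h1 h2 => hf (α j) (by rw [← h2, h1])
    have := Finset.card_le_card (Finset.union_subset (Finset.filter_subset (· j = α j) A)
      (Finset.filter_subset (· j = c (α j)) A))
    rw [Finset.card_union_of_disjoint hd] at this
    omega
  have hdiff : ∀ x ∈ Q, ∃ k ∈ K.erase j, x k ≠ α k := by
    intro x hx
    by_contra! hcon
    rw [Finset.mem_filter] at hx
    exact hA α hα x hx.1 ⟨j, hj, hx.2, fun k hk hkj => hcon k (Finset.mem_erase.2 ⟨hkj, hk⟩)⟩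
  have hrow := hbal (fun k => ind c {α k}) fun _ => val_ind hc (consistent_singleton hf _)
  rw [← Finset.add_sum_erase _ _ hαP, pr_eq_one (fun k _ => ind_of_mem (by simp))] at hrow
  have hnn : 0 ≤ ∑ x ∈ P.erase α, pr (fun k => ind c {α k}) (K.erase j) x :=
    Finset.sum_nonneg fun _ _ => pr_ind_nonneg _ _ _
  have hQle : ∑ x ∈ Q, wt c (K.erase j) α x ≤ Q.card * (1 / 2 : ℚ) := by
    rw [← nsmul_eq_mul, ← Finset.sum_const]
    exact Finset.sum_le_sum fun x hx => wt_le_half (hdiff x hx)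
  have hQ2' : Q.card = 2 := by
    have : (2 : ℚ) ≤ Q.card := by unfold wt at hQle; linarith
    have : 2 ≤ Q.card := by exact_mod_cast this
    omega
  obtain ⟨δ, hδ⟩ : ∃ δ, Q.erase β = {δ} := Finset.card_eq_one.1 (by
    rw [Finset.card_erase_of_mem hβQ, hQ2'])
  have hδm : δ ∈ Q ∧ δ ≠ β := by
    have : δ ∈ Q.erase β := by rw [hδ]; simp
    exact ⟨Finset.mem_of_mem_erase this, Finset.ne_of_mem_erase this⟩
  have hQsum : ∀ F : (ι → S) → ℚ, ∑ x ∈ Q, F x = F β + F δ := fun F => by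
    rw [← Finset.add_sum_erase _ _ hβQ, hδ, Finset.sum_singleton]
  have hβh := wt_le_half (c := c) (hdiff β hβQ)
  have hδh := wt_le_half (c := c) (hdiff δ hδm.1)
  rw [hQsum] at hrow
  change 1 + _ = wt c (K.erase j) α β + wt c (K.erase j) α δ at hrow
  have hP0 : ∑ x ∈ P.erase α, pr (fun k => ind c {α k}) (K.erase j) x = 0 := by linarith
  have hβw : 1 / 4 < wt c (K.erase j) α β := by linarith
  have hδw : 1 / 4 < wt c (K.erase j) α δ := by linarith
  have oβ := ov_of_wt_pos hc hf (lt_trans (by norm_num) hβw)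
  have oδ := ov_of_wt_pos hc hf (lt_trans (by norm_num) hδw)
  obtain ⟨k, hk, ek, hoff⟩ := exists_of_quarter_lt_wt hβw (hdiff β hβQ)
  obtain ⟨m, hm, em, hoff'⟩ := exists_of_quarter_lt_wt hδw (hdiff δ hδm.1)
  -- test the common part of `α` and `β`
  have hg := within_ind_pair hc hf oβ
  have ht := hbal _ hg.val
  rw [← Finset.add_sum_erase _ _ hαP, hQsum, pr_eq_one hg.one,
    pr_eq_one (v := β) (fun k hk => by simp only [if_pos hk]; exact ind_of_mem (by simp)),
    Finset.sum_eq_zero] at ht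
  · have hz : ¬ 0 < pr (fun k => ind c (if k ∈ K.erase j then {α k, β k} else {α k}))
        (K.erase j) δ := by linarith
    obtain ⟨x, hx, ex⟩ : ∃ x ∈ K.erase j, δ x = c (β x) := by
      by_contra! hcon
      refine hz (pr_ind_pos fun k hk => ?_)
      rw [if_pos hk]
      simp only [Finset.mem_insert, Finset.mem_singleton, not_or]
      exact ⟨fun e => oδ k hk (by rw [← e, hc]), fun e => hcon k hk (by rw [← e, hc])⟩
    have hxk : x = k := by
      by_contra hne
      exact oδ x hx (by rw [ex, hoff x hx hne])
    have hxm : x = m := by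
      by_contra hne
      exact oβ x hx (by rw [← hoff' x hx hne, ex, hc])
    refine hA β hβ δ (Finset.mem_filter.1 hδm.1).1 ⟨x, Finset.mem_of_mem_erase hx, ex,
      fun y hy hyx => ?_⟩
    by_cases hyj : y = j
    · rw [hyj, (Finset.mem_filter.1 hδm.1).2, (Finset.mem_filter.1 hβQ).2]
    · have hy' := Finset.mem_erase.2 ⟨hyj, hy⟩
      rw [hoff y hy' (hxk ▸ hyx), hoff' y hy' (hxm ▸ hyx)]
  · intro x hx
    refine hg.eq_zero fun ho => ?_
    have h0 := (Finset.sum_eq_zero_iff_of_nonneg fun _ _ => pr_ind_nonneg _ _ _).1 hP0 x hx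
    exact (wt_pos hc ho).ne' h0

end NoTwins
end Slice
end

section
open scoped Classical

section Twins
variable {ι : Type} {c : S → S} {K : Finset ι} {r : ι → S} {j : ι} {B : Finset (ι → S)}

/-- Words tiling the union of the boxes of a twin pair: each of them differs from the common part
`r` of the twin pair in exactly one coordinate other than the coordinate `j` of the twin pair. -/
structure Fan (c : S → S) (K : Finset ι) (r : ι → S) (j : ι) (B : Finset (ι → S)) : Prop where
  mem : j ∈ K
  one : ∀ b ∈ B, ∃ k ∈ K, k ≠ j ∧ b k ≠ r k ∧ ∀ m ∈ K, m ≠ j → m ≠ k → b m = r m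
  ov : ∀ b ∈ B, ∀ m ∈ K, m ≠ j → b m ≠ c (r m)
  sum : ∀ T : ι → Finset S, (∀ m, ∀ s ∈ T m, c s ∉ T m) → (∀ m ∈ K, m ≠ j → r m ∈ T m) →
    ∑ b ∈ B, pr (fun m => ind c (T m)) K b = 1

lemma Fan.dich (hc : Function.Involutive c) (hf : ∀ s, c s ≠ s) (h : Fan c K r j B) {b b' : ι → S}
    (hb : b ∈ B) (hb' : b' ∈ B) (hbb : b ≠ b') : ∃ m ∈ K, b' m = c (b m) := by
  set T : ι → Finset S := fun m => if m ∈ K ∧ m ≠ j then {r m, b m} else {b m} with hTd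
  have hT : ∀ m, ∀ s ∈ T m, c s ∉ T m := by
    intro m
    simp only [hTd]
    split_ifs with hm
    · exact consistent_pair hc hf (h.ov b hb m hm.1 hm.2)
    · exact consistent_singleton hf _
  have hs := h.sum T hT fun m hm hmj => by simp [hTd, hm, hmj]
  by_contra! hcon
  rw [← Finset.add_sum_erase _ _ hb, pr_eq_one fun m _ => ind_of_mem (by
    simp only [hTd]; split_ifs <;> simp)] at hs
  have hle := Finset.single_le_sum (f := fun x => pr (fun m => ind c (T m)) K x)
    (fun x _ => pr_ind_nonneg _ _ x) (Finset.mem_erase.2 ⟨hbb.symm, hb'⟩)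
  have hpos : 0 < pr (fun m => ind c (T m)) K b' := by
    refine pr_ind_pos fun m hm => ?_
    have h1 : c (b' m) ≠ b m := fun e => hcon m hm (by rw [← e, hc])
    simp only [hTd]
    split_ifs with hmj
    · simp only [Finset.mem_insert, Finset.mem_singleton, not_or]
      exact ⟨fun e => h.ov b' hb' m hm hmj.2 (by rw [← e, hc]), h1⟩
    · simpa using h1
  linarith

lemma Fan.partner (hc : Function.Involutive c) (hf : ∀ s, c s ≠ s) (h : Fan c K r j B) {b : ι → S}
    (hb : b ∈ B) {k : ι} (hk : k ∈ K) (hkj : k ≠ j) (hbk : b k ≠ r k)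
    (hoff : ∀ m ∈ K, m ≠ j → m ≠ k → b m = r m) :
    ∃ b' ∈ B, b' k = c (b k) ∧ b' j ≠ c (b j) := by
  set T : ι → Finset S := fun m => if m = j then {b j} else if m = k then {r k, c (b k)} else {r m}
    with hTd
  have hT : ∀ m, ∀ s ∈ T m, c s ∉ T m := by
    intro m
    simp only [hTd]
    split_ifs
    · exact consistent_singleton hf _
    · exact consistent_pair hc hf fun e => hbk (hc.injective e)
    · exact consistent_singleton hf _
  have hs := h.sum T hT fun m hm hmj => by simp only [hTd, if_neg hmj]; split_ifs <;> simp [*]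
  obtain ⟨b', hb', hne⟩ := Finset.exists_ne_zero_of_sum_ne_zero (by rw [hs]; norm_num)
  have h1 : b' j ≠ c (b j) := fun e => hne (pr_eq_zero h.mem (ind_eq_zero (hT j) (by
    simp [hTd, e, hc _])))
  have h2 : b' k ≠ b k := fun e => hne (pr_eq_zero hk (ind_eq_zero (hT k) (by
    simp [hTd, e, hkj])))
  obtain ⟨m, hm, e⟩ := h.dich hc hf hb hb' (by rintro rfl; exact h2 rfl)
  have hmj : m ≠ j := by rintro rfl; exact h1 e
  have hmk : m = k := by
    by_contra hmk
    exact h.ov b' hb' m hm hmj (by rw [e, hoff m hm hmj hmk])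
  exact ⟨b', hb', hmk ▸ e, h1⟩

/-- Words differing from `r` at different coordinates are complementary at `j`. -/
lemma Fan.compl (hc : Function.Involutive c) (hf : ∀ s, c s ≠ s) (h : Fan c K r j B) {b b' : ι → S}
    (hb : b ∈ B) (hb' : b' ∈ B) {k k' : ι} (hkk : k ≠ k')
    (hbk : b k ≠ r k) (hk : k ∈ K) (hkj : k ≠ j)
    (hoff : ∀ m ∈ K, m ≠ j → m ≠ k → b m = r m)
    (hoff' : ∀ m ∈ K, m ≠ j → m ≠ k' → b' m = r m) : b' j = c (b j) := by
  obtain ⟨m, hm, e⟩ := h.dich hc hf hb hb' (by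
    rintro rfl
    exact hbk (hoff' k hk hkj hkk))
  by_cases hmj : m = j
  · rwa [← hmj]
  by_cases hmk : m = k
  · have := hoff' m hm hmj (hmk ▸ hkk)
    exact absurd (by rw [← this, e, hc]) (h.ov b hb m hm hmj)
  · exact absurd (by rw [e, hoff m hm hmj hmk]) (h.ov b' hb' m hm hmj)

end Twins

section Slice
variable {ι : Type} [Fintype ι] {c : S → S} {V W : Finset (ι → S)} {i : ι} {q : S}

lemma Good.mem_iff (h : Good c V W) {u v : ι → S} (hu : u ∈ side c W V i q)
    (hv : v ∈ side c W V i q) (huv : u ∈ V ↔ v ∈ V) : u ∈ W ↔ v ∈ W := by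
  have key : ∀ {x : ι → S}, x ∈ side c W V i q → (x ∈ W ↔ x ∉ V) := fun hx =>
    ⟨fun h' hV => Finset.disjoint_left.1 h.disj hV h', (mem_or_of_mem_side hx).resolve_right⟩
  rw [key hu, key hv, huv]

/-- Twins in a small side: the words of the opposite side form a fan. -/
lemma Good.fan (hc : Function.Involutive c) (hf : ∀ s, c s ≠ s) (h : Good c V W)
    (hn : NoNear V W c) (h4 : (side c V W i q).card ≤ 4) {a₁ a₂ : ι → S}
    (ha₁ : a₁ ∈ side c V W i q) (ha₂ : a₂ ∈ side c V W i q) {j : ι}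
    (hj : j ∈ Finset.univ.erase i) (e : a₂ j = c (a₁ j))
    (hoff : ∀ k ∈ Finset.univ.erase i, k ≠ j → a₂ k = a₁ k) :
    Fan c (Finset.univ.erase i) a₁ j (side c W V i q) ∧ (side c V W i q).card = 4 := by
  set K := Finset.univ.erase i with hK
  set A := side c V W i q with hA
  set B := side c W V i q with hB
  have hnull : Null c A B K := h.null_side hc hf i q
  have hne : a₁ ≠ a₂ := by rintro rfl; exact hf _ e.symm
  have hBr : ∀ b ∈ B, ∃ k ∈ K.erase j, b k ≠ a₁ k := by
    intro b hb
    by_contra! hcon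
    have hb1 : ∀ k ∈ K, k ≠ j → b k = a₁ k := fun k hk hkj =>
      hcon k (Finset.mem_erase.2 ⟨hkj, hk⟩)
    have hb2 : ∀ k ∈ K, k ≠ j → b k = a₂ k := fun k hk hkj => by rw [hb1 k hk hkj, hoff k hk hkj]
    have n1 : b j ≠ a₁ j := fun e' => by
      obtain ⟨k, hk, ek⟩ := h.side_ne ha₁ hb
      by_cases hkj : k = j
      · exact ek (by rw [hkj, e'])
      · exact ek (hb1 k hk hkj)
    have n2 : b j ≠ a₂ j := fun e' => by
      obtain ⟨k, hk, ek⟩ := h.side_ne ha₂ hb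
      by_cases hkj : k = j
      · exact ek (by rw [hkj, e'])
      · exact ek (hb2 k hk hkj)
    have m1 := h.side_near hn hc ha₁ hb n1 (by rwa [← e]) hb1
    have m2 := h.side_near hn hc ha₂ hb n2 (by rwa [e, hc]) hb2
    exact h.side_twin ha₁ ha₂ ⟨j, hj, e, hoff⟩ (m1.trans m2.symm)
  have hbal : ∑ x ∈ A, wt c (K.erase j) a₁ x = ∑ x ∈ B, wt c (K.erase j) a₁ x := by
    have := hnull _ (val_update (fun _ => val_ind hc (consistent_singleton hf _)) (j := j)
      (g := fun m => ind c {a₁ m}) val_one)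
    rw [Finset.sum_congr rfl fun x _ => pr_update hj _,
      Finset.sum_congr rfl (s₁ := B) fun x _ => pr_update hj _] at this
    simpa only [one_mul, wt] using this
  have ha₂' : a₂ ∈ A.erase a₁ := Finset.mem_erase.2 ⟨hne.symm, ha₂⟩
  have w2 : wt c (K.erase j) a₁ a₂ = 1 := pr_eq_one fun k hk => ind_of_mem (by
    simp [hoff k (Finset.mem_of_mem_erase hk) (Finset.ne_of_mem_erase hk)])
  rw [← Finset.add_sum_erase _ _ ha₁, ← Finset.add_sum_erase _ _ ha₂', wt_self, w2] at hbal
  have hnn : 0 ≤ ∑ x ∈ (A.erase a₁).erase a₂, wt c (K.erase j) a₁ x :=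
    Finset.sum_nonneg fun _ _ => wt_nonneg
  have hle : ∀ b ∈ B, wt c (K.erase j) a₁ b ≤ 1 / 2 := fun b hb => wt_le_half (hBr b hb)
  have hBc : A.card = B.card := hnull.card_eq
  have hsle : ∑ x ∈ B, wt c (K.erase j) a₁ x ≤ B.card * (1 / 2 : ℚ) := by
    rw [← nsmul_eq_mul, ← Finset.sum_const]
    exact Finset.sum_le_sum hle
  have hB4 : (4 : ℚ) ≤ B.card := by linarith
  have hB4' : B.card = 4 := le_antisymm (hBc ▸ h4) (by exact_mod_cast hB4)
  have hhalf : ∀ b ∈ B, wt c (K.erase j) a₁ b = 1 / 2 := by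
    have hs : ∑ x ∈ B, wt c (K.erase j) a₁ x = ∑ x ∈ B, (1 / 2 : ℚ) := by
      refine le_antisymm (Finset.sum_le_sum hle) ?_
      rw [Finset.sum_const, hB4', nsmul_eq_mul]
      norm_num
      linarith
    exact (Finset.sum_eq_sum_iff_of_le hle).1 hs
  have hzero : ∀ a ∈ (A.erase a₁).erase a₂, wt c (K.erase j) a₁ a = 0 := by
    refine (Finset.sum_eq_zero_iff_of_nonneg fun _ _ => wt_nonneg).1 ?_
    have : ∑ x ∈ B, wt c (K.erase j) a₁ x = 2 := by
      rw [Finset.sum_congr rfl hhalf, Finset.sum_const, hB4', nsmul_eq_mul]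
      norm_num
    linarith
  have hov : ∀ b ∈ B, Ov c (K.erase j) b a₁ := fun b hb =>
    ov_of_wt_pos hc hf (by rw [hhalf b hb]; norm_num)
  refine ⟨⟨hj, fun b hb => ?_, fun b hb m hm hmj => hov b hb m (Finset.mem_erase.2 ⟨hmj, hm⟩),
    fun T hT hr => ?_⟩, by rw [hBc, hB4']⟩
  · obtain ⟨k, hk, e', hoff'⟩ := exists_of_quarter_lt_wt (by rw [hhalf b hb]; norm_num) (hBr b hb)
    exact ⟨k, Finset.mem_of_mem_erase hk, Finset.ne_of_mem_erase hk, e', fun m hm hmj hmk =>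
      hoff' m (Finset.mem_erase.2 ⟨hmj, hm⟩) hmk⟩
  · have hg : Within c (K.erase j) a₁ (fun m => ind c (T m)) := within_ind hc T hT fun m hm =>
      hr m (Finset.mem_of_mem_erase hm) (Finset.ne_of_mem_erase hm)
    rw [← hnull _ fun m => val_ind hc (hT m), ← Finset.add_sum_erase _ _ ha₁,
      ← Finset.add_sum_erase _ _ ha₂', Finset.sum_eq_zero, pr_erase hj, pr_erase (v := a₂) hj, e,
      pr_eq_one hg.one, pr_eq_one, mul_one, mul_one, add_zero, ind_add hc (hT j)]
    · intro k hk
      rw [hoff k (Finset.mem_of_mem_erase hk) (Finset.ne_of_mem_erase hk)]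
      exact hg.one k hk
    · intro a ha
      rw [pr_erase hj, hg.eq_zero, mul_zero]
      exact fun ho => (wt_pos hc ho).ne' (hzero a ha)

/-- If a fan contains twins, the remaining words of the other side are close to a fixed word. -/
lemma Good.fan_twin (hc : Function.Involutive c) (hf : ∀ s, c s ≠ s) (h : Good c V W)
    (hn : NoNear V W c) (h4 : (side c V W i q).card ≤ 4) {a₁ a₂ : ι → S}
    (ha₁ : a₁ ∈ side c V W i q) (ha₂ : a₂ ∈ side c V W i q) (hne : a₁ ≠ a₂) {j : ι}
    (hoff : ∀ k ∈ Finset.univ.erase i, k ≠ j → a₂ k = a₁ k)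
    {b₁ b₂ : ι → S} (hb₁ : b₁ ∈ side c W V i q) (hb₂ : b₂ ∈ side c W V i q) {k : ι}
    (hk : k ∈ Finset.univ.erase i) (hkj : k ≠ j) (e₁ : b₁ k ≠ a₁ k) (e₁' : b₁ k ≠ c (a₁ k))
    (hb₁o : ∀ m ∈ Finset.univ.erase i, m ≠ j → m ≠ k → b₁ m = a₁ m)
    (hb₂j : b₂ j = b₁ j) (hb₂k : b₂ k = c (b₁ k))
    (hb₂o : ∀ m ∈ Finset.univ.erase i, m ≠ j → m ≠ k → b₂ m = a₁ m)
    {a : ι → S} (ha : a ∈ side c V W i q) (haa₁ : a ≠ a₁) (haa₂ : a ≠ a₂) :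
    wt c (Finset.univ.erase i) (Function.update (Function.update a₁ j (b₁ j)) k (c (a₁ k))) a =
      1 / 2 := by
  set K := Finset.univ.erase i with hK
  set A := side c V W i q with hA
  set B := side c W V i q with hB
  set ρ := Function.update (Function.update a₁ j (b₁ j)) k (c (a₁ k)) with hρ
  have hρj : ρ j = b₁ j := by simp [hρ, hkj.symm]
  have hρk : ρ k = c (a₁ k) := by simp [hρ]
  have hρo : ∀ m, m ≠ j → m ≠ k → ρ m = a₁ m := fun m h1 h2 => by simp [hρ, h1, h2]
  have hb₁ρ : ∀ m ∈ K, m ≠ k → b₁ m = ρ m := fun m hm hmk => by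
    by_cases hmj : m = j
    · rw [hmj, hρj]
    · rw [hρo m hmj hmk, hb₁o m hm hmj hmk]
  have hb₂ρ : ∀ m ∈ K, m ≠ k → b₂ m = ρ m := fun m hm hmk => by
    by_cases hmj : m = j
    · rw [hmj, hρj, hb₂j]
    · rw [hρo m hmj hmk, hb₂o m hm hmj hmk]
  have e₂ : b₂ k ≠ a₁ k := fun e => e₁' (by rw [← e, hb₂k, hc])
  have e₂' : b₂ k ≠ c (a₁ k) := fun e => e₁ (hc.injective (by rw [← e, hb₂k]))
  have htw : TwinOn c K b₁ b₂ := ⟨k, hk, hb₂k, fun m hm hmk => by rw [hb₁ρ m hm hmk, hb₂ρ m hm hmk]⟩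
  have hwhalf : ∀ b : ι → S, (∀ m ∈ K, m ≠ k → b m = ρ m) → b k ≠ a₁ k → b k ≠ c (a₁ k) →
      wt c K ρ b = 1 / 2 := by
    intro b hb h1 h2
    unfold wt
    rw [pr_erase hk, pr_eq_one fun m hm => ind_of_mem (by
      simp [hb m (Finset.mem_of_mem_erase hm) (Finset.ne_of_mem_erase hm)]), mul_one]
    refine ind_half (by simpa [hρk] using h2) ?_
    simpa [hρk] using fun e => h1 (hc.injective e)
  have hsum : ∑ x ∈ A, wt c K ρ x = ∑ x ∈ B, wt c K ρ x := h.sum_wt hc hf ρ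
  have hbb : b₁ ≠ b₂ := by rintro rfl; exact hf _ hb₂k.symm
  have hBge : 1 ≤ ∑ x ∈ B, wt c K ρ x := by
    rw [← Finset.add_sum_erase _ _ hb₁, ← Finset.add_sum_erase _ _
      (Finset.mem_erase.2 ⟨hbb.symm, hb₂⟩), hwhalf b₁ hb₁ρ e₁ e₁', hwhalf b₂ hb₂ρ e₂ e₂']
    have : 0 ≤ ∑ x ∈ (B.erase b₁).erase b₂, wt c K ρ x := Finset.sum_nonneg fun _ _ => wt_nonneg
    linarith
  have ha₂' : a₂ ∈ A.erase a₁ := Finset.mem_erase.2 ⟨hne.symm, ha₂⟩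
  have hz : ∀ x : ι → S, x k = a₁ k → wt c K ρ x = 0 := fun x hx =>
    wt_eq_zero hc hf fun ho => ho k hk (by rw [hρk, hx, hc])
  rw [← hsum, ← Finset.add_sum_erase _ _ ha₁, ← Finset.add_sum_erase _ _ ha₂', hz a₁ rfl,
    hz a₂ (hoff k hk hkj), zero_add, zero_add] at hBge
  have hle : ∀ x ∈ (A.erase a₁).erase a₂, wt c K ρ x ≤ 1 / 2 := by
    intro x hx
    have hxA : x ∈ A := Finset.mem_of_mem_erase (Finset.mem_of_mem_erase hx)
    refine wt_le_half ?_
    by_contra! hcon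
    have hkx : x k = c (a₁ k) := by rw [hcon k hk, hρk]
    have m1 := h.side_near hn hc hxA hb₁ (by rwa [hkx]) (by rwa [hkx, hc]) fun m hm hmk => by
      rw [hcon m hm, hb₁ρ m hm hmk]
    have m2 := h.side_near hn hc hxA hb₂ (by rwa [hkx]) (by rwa [hkx, hc]) fun m hm hmk => by
      rw [hcon m hm, hb₂ρ m hm hmk]
    have hm : b₁ ∈ V ↔ b₂ ∈ V := m1.symm.trans m2
    exact h.symm.side_twin hb₁ hb₂ htw (h.mem_iff hb₁ hb₂ hm)
  have hcard : ((A.erase a₁).erase a₂).card ≤ 2 := by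
    rw [Finset.card_erase_of_mem ha₂', Finset.card_erase_of_mem ha₁]; omega
  have hs : ∑ x ∈ (A.erase a₁).erase a₂, wt c K ρ x = ∑ x ∈ (A.erase a₁).erase a₂, (1 / 2 : ℚ) := by
    refine le_antisymm (Finset.sum_le_sum hle) ?_
    rw [Finset.sum_const, nsmul_eq_mul]
    have : (((A.erase a₁).erase a₂).card : ℚ) ≤ 2 := by exact_mod_cast hcard
    linarith
  exact (Finset.sum_eq_sum_iff_of_le hle).1 hs a
    (Finset.mem_erase.2 ⟨haa₂, Finset.mem_erase.2 ⟨haa₁, ha⟩⟩)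

end Slice
end

section
open scoped Classical

section Slice
variable {ι : Type} [Fintype ι] {c : S → S} {V W : Finset (ι → S)} {i : ι} {q : S}

/-- All words of a fan differ from its centre in the same coordinate. -/
lemma Good.fan_coord (hc : Function.Involutive c) (hf : ∀ s, c s ≠ s) (h : Good c V W)
    (hn : NoNear V W c) (h4 : (side c V W i q).card = 4) {a₁ a₂ : ι → S}
    (ha₁ : a₁ ∈ side c V W i q) (ha₂ : a₂ ∈ side c V W i q) (hne : a₁ ≠ a₂) {j : ι}
    (hoff : ∀ k ∈ Finset.univ.erase i, k ≠ j → a₂ k = a₁ k)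
    (hF : Fan c (Finset.univ.erase i) a₁ j (side c W V i q)) :
    ∃ k ∈ Finset.univ.erase i, k ≠ j ∧ ∀ b ∈ side c W V i q, b k ≠ a₁ k ∧
      ∀ m ∈ Finset.univ.erase i, m ≠ j → m ≠ k → b m = a₁ m := by
  have hBc := (h.null_side hc hf i q).card_eq
  obtain ⟨b₁, hb₁⟩ : (side c W V i q).Nonempty := by
    rw [← Finset.card_pos, ← hBc, h4]; norm_num
  obtain ⟨k, hk, hkj, e₁, hb₁o⟩ := hF.one b₁ hb₁
  refine ⟨k, hk, hkj, fun b₃ hb₃ => ?_⟩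
  obtain ⟨k', hk', hkj', e₃, hb₃o⟩ := hF.one b₃ hb₃
  by_cases hkk : k = k'
  · subst hkk; exact ⟨e₃, hb₃o⟩
  exfalso
  have hj3 : b₃ j = c (b₁ j) := hF.compl hc hf hb₁ hb₃ hkk e₁ hk hkj hb₁o hb₃o
  obtain ⟨b₂, hb₂, h2k, h2j⟩ := hF.partner hc hf hb₁ hk hkj e₁ hb₁o
  obtain ⟨b₄, hb₄, h4k, h4j⟩ := hF.partner hc hf hb₃ hk' hkj' e₃ hb₃o
  have hb₂' : b₂ j = b₁ j ∧ ∀ m ∈ Finset.univ.erase i, m ≠ j → m ≠ k → b₂ m = a₁ m := by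
    obtain ⟨m, hm, hmj, em, ho⟩ := hF.one b₂ hb₂
    have hmk : m = k := by
      by_contra hmk
      refine hF.ov b₁ hb₁ k hk hkj ?_
      rw [← ho k hk hkj (Ne.symm hmk), h2k, hc]
    subst hmk
    refine ⟨?_, ho⟩
    have := hF.compl hc hf hb₃ hb₂ (Ne.symm hkk) e₃ hk' hkj' hb₃o ho
    rw [this, hj3, hc]
  have hb₄' : b₄ j = b₃ j ∧ ∀ m ∈ Finset.univ.erase i, m ≠ j → m ≠ k' → b₄ m = a₁ m := by
    obtain ⟨m, hm, hmj, em, ho⟩ := hF.one b₄ hb₄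
    have hmk : m = k' := by
      by_contra hmk
      refine hF.ov b₃ hb₃ k' hk' hkj' ?_
      rw [← ho k' hk' hkj' (Ne.symm hmk), h4k, hc]
    subst hmk
    refine ⟨?_, ho⟩
    have := hF.compl hc hf hb₁ hb₄ hkk e₁ hk hkj hb₁o ho
    rw [this, hj3]
  obtain ⟨a, ha⟩ : (((side c V W i q).erase a₁).erase a₂).Nonempty := by
    rw [← Finset.card_pos, Finset.card_erase_of_mem (Finset.mem_erase.2 ⟨hne.symm, ha₂⟩),
      Finset.card_erase_of_mem ha₁, h4]
    norm_num
  obtain ⟨haa₂, haa₁, ha⟩ : a ≠ a₂ ∧ a ≠ a₁ ∧ a ∈ side c V W i q := by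
    simpa only [Finset.mem_erase] using ha
  have w₁ := h.fan_twin hc hf hn h4.le ha₁ ha₂ hne hoff hb₁ hb₂ hk hkj e₁
    (hF.ov b₁ hb₁ k hk hkj) hb₁o hb₂'.1 h2k hb₂'.2 ha haa₁ haa₂
  have w₃ := h.fan_twin hc hf hn h4.le ha₁ ha₂ hne hoff hb₃ hb₄ hk' hkj' e₃
    (hF.ov b₃ hb₃ k' hk' hkj') hb₃o hb₄'.1 h4k hb₄'.2 ha haa₁ haa₂
  have o₃ := ov_of_wt_pos hc hf (by rw [w₃]; norm_num)
  have n1 : a j ≠ b₁ j := by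
    have := o₃ j hF.mem
    simp only [Function.update_of_ne hkj'.symm, Function.update_self, hj3, hc (b₁ j)] at this
    exact this
  have n2 : a k ≠ c (a₁ k) := by
    have := o₃ k hk
    simpa only [Function.update_of_ne hkk, Function.update_of_ne hkj] using this
  have := wt_le_quarter (c := c) (K := Finset.univ.erase i)
    (a := Function.update (Function.update a₁ j (b₁ j)) k (c (a₁ k))) (v := a) hF.mem hk hkj.symm
    (by simpa [hkj.symm] using n1) (by simpa using n2)
  rw [w₁] at this
  norm_num at this

/-- A small side with twins occupies only two coordinates off `i`. -/
lemma Good.fan_side (hc : Function.Involutive c) (hf : ∀ s, c s ≠ s) (h : Good c V W)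
    (h4 : (side c V W i q).card = 4) {a₁ a₂ : ι → S}
    (ha₁ : a₁ ∈ side c V W i q) (ha₂ : a₂ ∈ side c V W i q) (hne : a₁ ≠ a₂) {j : ι}
    (hoff : ∀ k ∈ Finset.univ.erase i, k ≠ j → a₂ k = a₁ k)
    (hF : Fan c (Finset.univ.erase i) a₁ j (side c W V i q)) {k : ι}
    (hk : k ∈ Finset.univ.erase i) (hkj : k ≠ j)
    (hB : ∀ b ∈ side c W V i q, b k ≠ a₁ k ∧
      ∀ m ∈ Finset.univ.erase i, m ≠ j → m ≠ k → b m = a₁ m) :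
    ∀ a ∈ side c V W i q, (∀ m ∈ Finset.univ.erase i, m ≠ j → m ≠ k → a m = a₁ m) ∧
      (a ≠ a₁ → a ≠ a₂ → a k = c (a₁ k)) := by
  set K := Finset.univ.erase i with hK
  set A := side c V W i q with hA
  set B := side c W V i q with hBd
  set ρ := Function.update a₁ k (c (a₁ k)) with hρ
  have hnull : Null c A B K := h.null_side hc hf i q
  have hbal : ∑ x ∈ A, wt c (K.erase j) ρ x = ∑ x ∈ B, wt c (K.erase j) ρ x := by
    have := hnull _ (val_update (fun _ => val_ind hc (consistent_singleton hf _)) (j := j)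
      (g := fun m => ind c {ρ m}) val_one)
    rw [Finset.sum_congr rfl fun x _ => pr_update hF.mem _,
      Finset.sum_congr rfl (s₁ := B) fun x _ => pr_update hF.mem _] at this
    simpa only [one_mul, wt] using this
  have hkm : k ∈ K.erase j := Finset.mem_erase.2 ⟨hkj, hk⟩
  have hBw : ∀ b ∈ B, wt c (K.erase j) ρ b = 1 / 2 := by
    intro b hb
    unfold wt
    rw [pr_erase hkm, pr_eq_one, mul_one]
    · refine ind_half (by simpa [hρ] using hF.ov b hb k hk hkj) ?_
      simpa [hρ] using fun e => (hB b hb).1 (hc.injective e)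
    · intro m hm
      have hmk := Finset.ne_of_mem_erase hm
      have hm' := Finset.mem_of_mem_erase hm
      refine ind_of_mem ?_
      simp [hρ, hmk, (hB b hb).2 m (Finset.mem_of_mem_erase hm') (Finset.ne_of_mem_erase hm') hmk]
  have hBc : A.card = B.card := hnull.card_eq
  have ha₂' : a₂ ∈ A.erase a₁ := Finset.mem_erase.2 ⟨hne.symm, ha₂⟩
  have hz : ∀ x : ι → S, x k = a₁ k → wt c (K.erase j) ρ x = 0 := fun x hx =>
    wt_eq_zero hc hf fun ho => ho k hkm (by simp [hρ, hx, hc _])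
  rw [Finset.sum_congr rfl hBw, Finset.sum_const, ← hBc, h4, nsmul_eq_mul,
    ← Finset.add_sum_erase _ _ ha₁, ← Finset.add_sum_erase _ _ ha₂', hz a₁ rfl,
    hz a₂ (hoff k hk hkj), zero_add, zero_add] at hbal
  have hcard : ((A.erase a₁).erase a₂).card = 2 := by
    rw [Finset.card_erase_of_mem ha₂', Finset.card_erase_of_mem ha₁]; omega
  have hle : ∀ x ∈ (A.erase a₁).erase a₂, wt c (K.erase j) ρ x ≤ 1 := fun x _ =>
    Finset.prod_le_one (fun _ _ => ind_nonneg _ _) fun _ _ => ind_le_one _ _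
  have hone : ∀ x ∈ (A.erase a₁).erase a₂, wt c (K.erase j) ρ x = 1 := by
    refine (Finset.sum_eq_sum_iff_of_le hle).1 ?_
    rw [hbal, Finset.sum_const, hcard, nsmul_eq_mul]
    norm_num
  have heq : ∀ x ∈ (A.erase a₁).erase a₂, ∀ m ∈ K.erase j, x m = ρ m := by
    intro x hx
    by_contra! hcon
    have := wt_le_half (c := c) hcon
    rw [hone x hx] at this
    norm_num at this
  intro a ha
  by_cases h1 : a = a₁
  · subst h1; exact ⟨fun _ _ _ _ => rfl, fun h => absurd rfl h⟩
  by_cases h2 : a = a₂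
  · subst h2; exact ⟨fun m hm hmj _ => hoff m hm hmj, fun _ h => absurd rfl h⟩
  have := heq a (Finset.mem_erase.2 ⟨h2, Finset.mem_erase.2 ⟨h1, ha⟩⟩)
  refine ⟨fun m hm hmj hmk => ?_, fun _ _ => ?_⟩
  · rw [this m (Finset.mem_erase.2 ⟨hmj, hm⟩)]; simp [hρ, hmk]
  · rw [this k hkm]; simp [hρ]

/-- In a fan around one coordinate, every word has a partner from the other code. -/
lemma Good.fan_partner (hc : Function.Involutive c) (hf : ∀ s, c s ≠ s) (h : Good c V W)
    {r : ι → S} {j : ι}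
    (hF : Fan c (Finset.univ.erase i) r j (side c W V i q)) {k : ι}
    (hk : k ∈ Finset.univ.erase i) (hkj : k ≠ j)
    (hB : ∀ b ∈ side c W V i q, b k ≠ r k ∧
      ∀ m ∈ Finset.univ.erase i, m ≠ j → m ≠ k → b m = r m)
    {b : ι → S} (hb : b ∈ side c W V i q) :
    ∃ b' ∈ side c W V i q, ¬ (b' ∈ W ↔ b ∈ W) ∧ b' k = c (b k) := by
  set K := Finset.univ.erase i with hK
  set B := side c W V i q with hBd
  by_contra hcon
  set T : ι → Finset S := fun m => if m = j then {b j} else if m = k then {r k, c (b k)} else {r m}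
    with hTd
  have hT : ∀ m, ∀ s ∈ T m, c s ∉ T m := by
    intro m
    simp only [hTd]
    split_ifs
    · exact consistent_singleton hf _
    · exact consistent_pair hc hf fun e => (hB b hb).1 (hc.injective e)
    · exact consistent_singleton hf _
  have hs := hF.sum T hT fun m hm hmj => by simp only [hTd, if_neg hmj]; split_ifs <;> simp [*]
  have hjk : ∀ x ∈ B, ∀ y ∈ B, x ≠ y → y j = c (x j) ∨ y k = c (x k) := by
    intro x hx y hy hxy
    obtain ⟨m, hm, e⟩ := hF.dich hc hf hx hy hxy
    by_cases hmj : m = j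
    · exact Or.inl (hmj ▸ e)
    by_cases hmk : m = k
    · exact Or.inr (hmk ▸ e)
    · exact absurd (by rw [e, (hB x hx).2 m hm hmj hmk]) (hF.ov y hy m hm hmj)
  have hsupp : ∀ x ∈ B, pr (fun m => ind c (T m)) K x ≠ 0 →
      x j ≠ c (b j) ∧ x k = c (b k) ∧ (x ∈ W ↔ b ∈ W) := by
    intro x hx hne
    have h1 : x j ≠ c (b j) := fun e => hne (pr_eq_zero hF.mem (ind_eq_zero (hT j) (by
      simp [hTd, e, hc _])))
    have h2 : x k ≠ b k := fun e => hne (pr_eq_zero hk (ind_eq_zero (hT k) (by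
      simp [hTd, e, hkj])))
    have h3 := (hjk b hb x hx (by rintro rfl; exact h2 rfl)).resolve_left h1
    exact ⟨h1, h3, by_contra fun hm => hcon ⟨x, hx, hm, h3⟩⟩
  obtain ⟨x, hx, hne⟩ := Finset.exists_ne_zero_of_sum_ne_zero (by rw [hs]; norm_num)
  obtain ⟨x1, x2, x3⟩ := hsupp x hx hne
  have htw : ∀ y ∈ B, ∀ z ∈ B, (y ∈ W ↔ z ∈ W) → ∀ m ∈ K, (m = j ∨ m = k) → z m = c (y m) →
      (∀ m' ∈ K, (m' = j ∨ m' = k) → m' ≠ m → z m' = y m') → False := by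
    intro y hy z hz hm m hmK _ e hoff
    refine h.symm.side_twin hy hz ⟨m, hmK, e, fun m' hm' hne' => ?_⟩ hm
    by_cases h1 : m' = j
    · exact hoff m' hm' (Or.inl h1) hne'
    by_cases h2 : m' = k
    · exact hoff m' hm' (Or.inr h2) hne'
    · rw [(hB y hy).2 m' hm' h1 h2, (hB z hz).2 m' hm' h1 h2]
  rw [Finset.sum_eq_single x] at hs
  · have : x j ∈ T j := by
      by_contra hxj
      have := pr_ind_le_half (c := c) T hF.mem hxj
      rw [hs] at this
      norm_num at this
    have hxj : x j = b j := by simpa [hTd] using this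
    refine htw b hb x hx x3.symm k hk (Or.inr rfl) x2 fun m' _ hm' hne' => ?_
    rw [hm'.resolve_right hne', hxj]
  · intro y hy hyx
    by_contra hne'
    obtain ⟨y1, y2, y3⟩ := hsupp y hy hne'
    have e : y j = c (x j) := (hjk x hx y hy hyx.symm).resolve_right fun e => hf (y k) (by
      rw [y2, ← x2]; rw [← e, y2, ← x2])
    refine htw x hx y hy (x3.trans y3.symm) j hF.mem (Or.inl rfl) e fun m' _ hm' hne' => ?_
    rw [hm'.resolve_left hne', y2, x2]
  · exact fun hn => absurd hx hn

/-- A word without the letters of the slice is dichotomous to the common part of the slice. -/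
lemma Good.fan_other (hc : Function.Involutive c) (hf : ∀ s, c s ≠ s) (h : Good c V W)
    (h4 : (side c V W i q).card = 4) {a₁ a₂ : ι → S}
    (ha₁ : a₁ ∈ side c V W i q) (ha₂ : a₂ ∈ side c V W i q) {j : ι}
    (e : a₂ j = c (a₁ j))
    (hoff : ∀ k ∈ Finset.univ.erase i, k ≠ j → a₂ k = a₁ k)
    (hF : Fan c (Finset.univ.erase i) a₁ j (side c W V i q)) {k : ι}
    (hk : k ∈ Finset.univ.erase i) (hkj : k ≠ j)
    (hB : ∀ b ∈ side c W V i q, b k ≠ a₁ k ∧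
      ∀ m ∈ Finset.univ.erase i, m ≠ j → m ≠ k → b m = a₁ m)
    {X : Finset (ι → S)} (hX : X = V ∨ X = W) {p : ι → S} (hp : p ∈ X) (hpq : p i ≠ q)
    (hpq' : p i ≠ c q) : ∃ m ∈ Finset.univ.erase i, m ≠ j ∧ m ≠ k ∧ p m = c (a₁ m) := by
  set K := Finset.univ.erase i with hK
  set A := side c V W i q with hA
  set B := side c W V i q with hBd
  have hne : a₁ ≠ a₂ := by rintro rfl; exact hf _ e.symm
  have hAs := h.fan_side hc hf h4 ha₁ ha₂ hne hoff hF hk hkj hB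
  have hnull : Null c A B K := h.null_side hc hf i q
  have hB4 : B.card = 4 := by rw [← hnull.card_eq, h4]
  have hjK := hF.mem
  by_contra! hcon
  -- membership in `X`
  have hXA : ∀ u ∈ A, (u ∈ X ↔ u ∈ V) ∨ (u ∈ X ↔ ¬ u ∈ V) := fun u _ => by
    by_cases h1 : u ∈ X <;> by_cases h2 : u ∈ V <;> simp [h1, h2]
  have hmem : ∀ {u}, u ∈ V ∨ u ∈ W → (u ∈ W ↔ ¬ u ∈ V) := fun hu =>
    ⟨fun h' hV => Finset.disjoint_left.1 h.disj hV h', hu.resolve_left⟩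
  have hiffA : ∀ u ∈ A, ∀ v ∈ A, (u ∈ X ↔ v ∈ X) → (u ∈ V ↔ v ∈ V) := by
    intro u hu v hv huv
    have := hmem (mem_or_of_mem_side hu)
    have := hmem (mem_or_of_mem_side hv)
    rcases hX with rfl | rfl
    · exact huv
    · exact not_iff_not.1 (by rw [← hmem (mem_or_of_mem_side hu), ← hmem (mem_or_of_mem_side hv)]
                              exact huv)
  have hiffB : ∀ u ∈ B, ∀ v ∈ B, (u ∈ X ↔ v ∈ X) ↔ (u ∈ W ↔ v ∈ W) := by
    intro u hu v hv
    rcases hX with rfl | rfl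
    · rw [hmem (mem_or_of_mem_side hu).symm, hmem (mem_or_of_mem_side hv).symm, not_iff_not]
    · exact Iff.rfl
  have hletter : ∀ u, u ∈ A ∨ u ∈ B → u i = q ∨ u i = c q := by
    rintro u (hu | hu) <;> rcases mem_side.1 hu with hu | hu <;> simp [hu.2]
  have hdX : ∀ u ∈ X, ∀ v ∈ X, u ≠ v → ∃ m, v m = c (u m) := by
    rcases hX with rfl | rfl
    · exact h.dichV
    · exact h.dichW
  have hABo : ∀ u, u ∈ A ∨ u ∈ B → ∀ m ∈ K, m ≠ j → m ≠ k → u m = a₁ m := by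
    rintro u (hu | hu)
    · exact (hAs u hu).1
    · exact (hB u hu).2
  have hpjk : ∀ u, u ∈ A ∨ u ∈ B → u ∈ X → p j = c (u j) ∨ p k = c (u k) := by
    intro u hu huX
    have hl := hletter u hu
    obtain ⟨m, em⟩ := hdX u huX p hp (by rintro rfl; tauto)
    have hmi : m ≠ i := by
      rintro rfl
      rcases hl with hl | hl <;> rw [hl] at em
      · exact hpq' em
      · exact hpq (by rw [em, hc])
    have hm : m ∈ K := Finset.mem_erase.2 ⟨hmi, Finset.mem_univ m⟩
    by_cases hmj : m = j
    · exact Or.inl (hmj ▸ em)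
    by_cases hmk : m = k
    · exact Or.inr (hmk ▸ em)
    · exact absurd (by rw [em, hABo u hu m hm hmj hmk]) (hcon m hm hmj hmk)
  have htwA : ∀ u ∈ A, ∀ v ∈ A, (u ∈ X ↔ v ∈ X) → ∀ m ∈ K, (m = j ∨ m = k) → v m = c (u m) →
      (∀ m' ∈ K, (m' = j ∨ m' = k) → m' ≠ m → v m' = u m') → False := by
    intro y hy z hz hm m hmK _ e hoff
    refine h.side_twin hy hz ⟨m, hmK, e, fun m' hm' hne' => ?_⟩ (hiffA y hy z hz hm)
    by_cases h1 : m' = j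
    · exact hoff m' hm' (Or.inl h1) hne'
    by_cases h2 : m' = k
    · exact hoff m' hm' (Or.inr h2) hne'
    · rw [hABo y (Or.inl hy) m' hm' h1 h2, hABo z (Or.inl hz) m' hm' h1 h2]
  have htwB : ∀ u ∈ B, ∀ v ∈ B, u ≠ v → (u ∈ X ↔ v ∈ X) → u j ≠ v j ∧ u k ≠ v k := by
    intro y hy z hz hyz hm
    have hm' := (hiffB y hy z hz).1 hm
    obtain ⟨m, hmK, em⟩ := h.symm.side_dich hf hy hz hyz hm'
    have hmjk : m = j ∨ m = k := by
      by_contra! hmn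
      refine hf (a₁ m) ?_
      rw [← hABo y (Or.inr hy) m hmK hmn.1 hmn.2, ← em, hABo z (Or.inr hz) m hmK hmn.1 hmn.2,
        hABo y (Or.inr hy) m hmK hmn.1 hmn.2]
    have key : ¬ ∀ m' ∈ K, (m' = j ∨ m' = k) → m' ≠ m → z m' = y m' := fun hoff =>
      h.symm.side_twin hy hz ⟨m, hmK, em, fun m' hm' hne' => by
        by_cases h1 : m' = j
        · exact hoff m' hm' (Or.inl h1) hne'
        by_cases h2 : m' = k
        · exact hoff m' hm' (Or.inr h2) hne'
        · rw [hABo y (Or.inr hy) m' hm' h1 h2, hABo z (Or.inr hz) m' hm' h1 h2]⟩ hm'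
    rcases hmjk with rfl | rfl
    · refine ⟨fun e' => hf _ (by rw [← em, ← e']), fun e' => key fun m' _ h1 h2 => ?_⟩
      rw [h1.resolve_left h2, e']
    · refine ⟨fun e' => key fun m' _ h1 h2 => ?_, fun e' => hf _ (by rw [← em, ← e'])⟩
      rw [h1.resolve_right h2, e']
  -- two words of the side of `a₁` in `X`
  have pickA : ∀ u ∈ A, ∀ v ∈ A, u ≠ v → u k = v k → u ∈ X ∨ v ∈ X := by
    intro u hu v hv huv ek
    by_contra! hno
    have hm : u ∈ X ↔ v ∈ X := by simp [hno.1, hno.2]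
    obtain ⟨m, hmK, em⟩ := h.side_dich hf hu hv huv (hiffA u hu v hv hm)
    have hmj : m = j := by
      by_contra hmj
      refine hf (u m) ?_
      rw [← em]
      by_cases hmk : m = k
      · rw [hmk, ek]
      · rw [hABo u (Or.inl hu) m hmK hmj hmk, hABo v (Or.inl hv) m hmK hmj hmk]
    subst hmj
    exact htwA u hu v hv hm m hmK (Or.inl rfl) em fun m' _ h1 h2 => by
      rw [h1.resolve_left h2, ek]
  obtain ⟨α, hα, hαX, hαk⟩ : ∃ α ∈ A, α ∈ X ∧ α k = a₁ k := by
    rcases pickA a₁ ha₁ a₂ ha₂ hne (hoff k hk hkj).symm with h' | h'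
    · exact ⟨a₁, ha₁, h', rfl⟩
    · exact ⟨a₂, ha₂, h', hoff k hk hkj⟩
  obtain ⟨α', hα', hαX', hαk'⟩ : ∃ α ∈ A, α ∈ X ∧ α k = c (a₁ k) := by
    have hcard : 1 < ((A.erase a₁).erase a₂).card := by
      rw [Finset.card_erase_of_mem (Finset.mem_erase.2 ⟨hne.symm, ha₂⟩),
        Finset.card_erase_of_mem ha₁, h4]
      norm_num
    obtain ⟨u, hu, v, hv, huv⟩ := Finset.one_lt_card.1 hcard
    simp only [Finset.mem_erase] at hu hv
    have hu' := (hAs u hu.2.2).2 hu.2.1 hu.1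
    have hv' := (hAs v hv.2.2).2 hv.2.1 hv.1
    rcases pickA u hu.2.2 v hv.2.2 huv (by rw [hu', hv']) with h' | h'
    · exact ⟨u, hu.2.2, h', hu'⟩
    · exact ⟨v, hv.2.2, h', hv'⟩
  -- two words of the opposite side in `X`
  obtain ⟨β, hβ, β', hβ', hββ, hβX, hβX'⟩ : ∃ β ∈ B, ∃ β' ∈ B, β ≠ β' ∧ β ∈ X ∧ β' ∈ X := by
    obtain ⟨u, hu, v, hv, huv, hm⟩ := Finset.exists_ne_map_eq_of_card_lt_of_maps_to
      (s := B) (t := (Finset.univ : Finset Bool)) (f := fun x => decide (x ∈ X))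
      (by rw [hB4]; decide) (fun _ _ => Finset.mem_coe.2 (Finset.mem_univ _))
    have hm : u ∈ X ↔ v ∈ X := by simpa using hm
    by_cases huX : u ∈ X
    · exact ⟨u, hu, v, hv, huv, huX, hm.1 huX⟩
    obtain ⟨x, hx, hxu, ex⟩ := h.fan_partner hc hf hF hk hkj hB hu
    obtain ⟨y, hy, hyv, ey⟩ := h.fan_partner hc hf hF hk hkj hB hv
    rw [← hiffB x hx u hu] at hxu
    rw [← hiffB y hy v hv] at hyv
    have hvX : ¬ v ∈ X := fun hv => huX (hm.2 hv)
    refine ⟨x, hx, y, hy, ?_, by_contra fun hx' => hxu (by simp [hx', huX]),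
      by_contra fun hy' => hyv (by simp [hy', hvX])⟩
    rintro rfl
    exact (htwB u hu v hv huv hm).2 (hc.injective (by rw [← ex, ey]))
  have hβj := (htwB β hβ β' hβ' hββ (by simp [hβX, hβX'])).1
  have hBk : ∀ b ∈ B, b ∈ X → (p k = a₁ k ∨ p k = c (a₁ k)) → p j = c (b j) := by
    intro b hb hbX hpk
    refine (hpjk b (Or.inr hb) hbX).resolve_right fun e' => ?_
    rcases hpk with e | e <;> rw [e] at e'
    · exact hF.ov b hb k hk hkj (by rw [e', hc])
    · exact (hB b hb).1 (hc.injective e').symm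
  by_cases hpk : p k = a₁ k ∨ p k = c (a₁ k)
  · exact hβj (hc.injective (by rw [← hBk β hβ hβX hpk, hBk β' hβ' hβX' hpk]))
  · push Not at hpk
    have e1 := (hpjk α (Or.inl hα) hαX).resolve_right (by rw [hαk]; exact hpk.2)
    have e2 := (hpjk α' (Or.inl hα') hαX').resolve_right (by rw [hαk', hc]; exact hpk.1)
    refine htwA α hα α' hα' (by simp [hαX, hαX']) k hk (Or.inr rfl) (by rw [hαk, hαk'])
      fun m' _ h1 h2 => ?_
    rw [h1.resolve_right h2]
    exact hc.injective (by rw [← e1, e2])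

/-- If some letter at `i` lies outside a slice containing small twins, then the slice is itself a
pair of disjoint equivalent codes. -/
lemma Good.not_twin_side (hc : Function.Involutive c) (hf : ∀ s, c s ≠ s) (h : Good c V W)
    (hn : NoNear V W c)
    (hind : ∀ V' W' : Finset (ι → S), Good c V' W' → V'.card = 4 → V'.card < V.card → False)
    {x : ι → S} (hx : x ∈ V ∪ W) (hxq : x i ≠ q) (hxq' : x i ≠ c q)
    (h4 : (side c V W i q).card ≤ 4) {a₁ a₂ : ι → S}
    (ha₁ : a₁ ∈ side c V W i q) (ha₂ : a₂ ∈ side c V W i q) :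
    ¬ TwinOn c (Finset.univ.erase i) a₁ a₂ := by
  rintro ⟨j, hj, e, hoff⟩
  set K := Finset.univ.erase i with hK
  set A := side c V W i q with hA
  set B := side c W V i q with hBd
  have hne : a₁ ≠ a₂ := by rintro rfl; exact hf _ e.symm
  obtain ⟨hF, h4'⟩ := h.fan hc hf hn h4 ha₁ ha₂ hj e hoff
  obtain ⟨k, hk, hkj, hB⟩ := h.fan_coord hc hf hn h4' ha₁ ha₂ hne hoff hF
  have hother := fun X hX p hp => h.fan_other hc hf h4' ha₁ ha₂ e hoff hF hk hkj hB
    (X := X) hX (p := p) hp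
  have hAs := h.fan_side hc hf h4' ha₁ ha₂ hne hoff hF hk hkj hB
  have hABo : ∀ u, u ∈ A ∨ u ∈ B → ∀ m ∈ K, m ≠ j → m ≠ k → u m = a₁ m := by
    rintro u (hu | hu)
    · exact (hAs u hu).1
    · exact (hB u hu).2
  set P := V.filter (fun u => u i = q ∨ u i = c q) with hP
  set Q := W.filter (fun u => u i = q ∨ u i = c q) with hQ
  have hPA : ∀ u ∈ P, u ∈ A ∨ u ∈ B := by
    intro u hu
    obtain ⟨hu, e | e⟩ := Finset.mem_filter.1 hu
    · exact Or.inl (mem_side.2 (Or.inl ⟨hu, e⟩))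
    · exact Or.inr (mem_side.2 (Or.inr ⟨hu, e⟩))
  have hQA : ∀ u ∈ Q, u ∈ A ∨ u ∈ B := by
    intro u hu
    obtain ⟨hu, e | e⟩ := Finset.mem_filter.1 hu
    · exact Or.inr (mem_side.2 (Or.inl ⟨hu, e⟩))
    · exact Or.inl (mem_side.2 (Or.inr ⟨hu, e⟩))
  have hPV : P ⊆ V := Finset.filter_subset _ _
  have hQW : Q ⊆ W := Finset.filter_subset _ _
  have hnull : Null c P Q Finset.univ := by
    intro g hg
    set g' : ι → S → ℚ := fun m => if m = i ∨ m = j ∨ m = k then g m else ind c {a₁ m} with hg'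
    set L := Finset.univ.filter fun m => m ∈ K ∧ m ≠ j ∧ m ≠ k with hL
    have hg'v : ∀ m, Val c (g' m) := fun m => by
      simp only [hg']
      split_ifs
      · exact hg m
      · exact val_ind hc (consistent_singleton hf _)
    have hm : ∀ m, ¬ (m = i ∨ m = j ∨ m = k) ↔ m ∈ L := fun m => by
      simp [hL, hK]
    have hval : ∀ u, u ∈ A ∨ u ∈ B →
        pr g Finset.univ u = (∏ m ∈ L, g m (a₁ m)) * pr g' Finset.univ u := by
      intro u hu
      unfold pr
      rw [← Finset.prod_filter_mul_prod_filter_not Finset.univ (· ∈ L),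
        ← Finset.prod_filter_mul_prod_filter_not Finset.univ (· ∈ L) (fun m => g' m (u m)),
        Finset.prod_eq_one (s := Finset.univ.filter (· ∈ L)) (f := fun m => g' m (u m)), one_mul,
        Finset.filter_mem_eq_inter, Finset.univ_inter]
      · congr 1
        · refine Finset.prod_congr rfl fun m hmL => ?_
          obtain ⟨-, h1, h2, h3⟩ := Finset.mem_filter.1 hmL
          rw [hABo u hu m h1 h2 h3]
        · refine Finset.prod_congr rfl fun m hmL => ?_
          have := by_contra fun h' => (Finset.mem_filter.1 hmL).2 ((hm m).1 h')
          simp only [hg', if_pos this]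
      · intro m hmL
        have hmL := (Finset.mem_filter.1 hmL).2
        obtain ⟨-, h1, h2, h3⟩ := Finset.mem_filter.1 hmL
        simp only [hg', if_neg ((hm m).2 hmL)]
        exact ind_of_mem (by simp [hABo u hu m h1 h2 h3])
    have hz : ∀ X : Finset (ι → S), X = V ∨ X = W → ∑ u ∈ X, pr g' Finset.univ u =
        ∑ u ∈ X.filter (fun u => u i = q ∨ u i = c q), pr g' Finset.univ u := by
      intro X hX
      refine (Finset.sum_subset (Finset.filter_subset _ _) fun u hu hu' => ?_).symm
      have hu' : ¬ (u i = q ∨ u i = c q) := fun h' => hu' (Finset.mem_filter.2 ⟨hu, h'⟩)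
      push Not at hu'
      obtain ⟨m, hmK, hmj, hmk, em⟩ := hother X hX u hu hu'.1 hu'.2
      have hmL : m ∈ L := Finset.mem_filter.2 ⟨Finset.mem_univ m, hmK, hmj, hmk⟩
      refine pr_eq_zero (Finset.mem_univ m) ?_
      simp only [hg', if_neg ((hm m).2 hmL)]
      exact ind_eq_zero (consistent_singleton hf _) (by simp [em, hc _])
    have hn' := h.null g' hg'v
    rw [hz V (Or.inl rfl), hz W (Or.inr rfl)] at hn'
    rw [Finset.sum_congr rfl fun u hu => hval u (hPA u hu),
      Finset.sum_congr rfl (s₁ := Q) fun u hu => hval u (hQA u hu), ← Finset.mul_sum,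
      ← Finset.mul_sum, hn']
  have hgood : Good c P Q := ⟨fun u hu v hv => h.dichV u (hPV hu) v (hPV hv),
    fun u hu v hv => h.dichW u (hQW hu) v (hQW hv), fun u hu v hv => h.twinV u (hPV hu) v (hPV hv),
    fun u hu v hv => h.twinW u (hQW hu) v (hQW hv),
    Finset.disjoint_of_subset_left hPV (Finset.disjoint_of_subset_right hQW h.disj), hnull⟩
  have hPc : P.card = (V.filter (· i = q)).card + (V.filter (· i = c q)).card := by
    rw [← Finset.card_union_of_disjoint (Finset.disjoint_filter.2 fun u _ h1 h2 => hf q (by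
      rw [← h2, h1])), ← Finset.filter_or]
  have hQc : Q.card = (W.filter (· i = q)).card + (W.filter (· i = c q)).card := by
    rw [← Finset.card_union_of_disjoint (Finset.disjoint_filter.2 fun u _ h1 h2 => hf q (by
      rw [← h2, h1])), ← Finset.filter_or]
  have hAc : A.card = (V.filter (· i = q)).card + (W.filter (· i = c q)).card := h.card_side i q
  have hBc : B.card = (W.filter (· i = q)).card + (V.filter (· i = c q)).card :=
    h.symm.card_side i q
  have hAB : A.card = B.card := (h.null_side hc hf i q).card_eq
  have h4' : B.card = 4 := by rw [← hAB]; exact h4'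
  have hPQ := hnull.card_eq
  have hVW := h.null.card_eq
  refine hind P Q hgood (by omega) ?_
  rcases Finset.mem_union.1 hx with hx | hx
  · refine Finset.card_lt_card ⟨hPV, fun hsub => ?_⟩
    exact (Finset.mem_filter.1 (hsub hx)).2.elim hxq hxq'
  · rw [hPQ, hVW]
    refine Finset.card_lt_card ⟨hQW, fun hsub => ?_⟩
    exact (Finset.mem_filter.1 (hsub hx)).2.elim hxq hxq'

/-- Nonempty slices at a coordinate with at least two complementary pairs have five words. -/
lemma Good.five_le_side (hc : Function.Involutive c) (hf : ∀ s, c s ≠ s) (h : Good c V W)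
    (hn : NoNear V W c)
    (hind : ∀ V' W' : Finset (ι → S), Good c V' W' → V'.card = 4 → V'.card < V.card → False)
    {x : ι → S} (hx : x ∈ V ∪ W) (hxq : x i ≠ q) (hxq' : x i ≠ c q)
    (hne : (side c V W i q).Nonempty) : 5 ≤ (side c V W i q).card := by
  by_contra hlt
  have h4 : (side c V W i q).card ≤ 4 := by omega
  rcases h.exists_twin hc hf hn h4 hne with ⟨u, hu, v, hv, ht⟩ | ⟨u, hu, v, hv, ht⟩
  · exact h.not_twin_side hc hf hn hind hx hxq hxq' h4 hu hv ht
  · exact h.symm.not_twin_side hc hf (hn.symm hc) (fun V' W' hg h1 h2 => hind V' W' hg h1 (by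
      rw [h.null.card_eq]; exact h2)) (by rwa [Finset.union_comm]) hxq hxq'
      (by rw [← (h.null_side hc hf i q).card_eq]; exact h4) hu hv ht

end Slice
end

section
open scoped Classical

section Good
variable {ι : Type} [Fintype ι] {c : S → S} {V W : Finset (ι → S)}

/-- A coordinate carrying a single complementary pair splits the two codes. -/
lemma Good.split (hf : ∀ s, c s ≠ s) (hc : Function.Involutive c) (h : Good c V W) {i : ι} {l : S}
    (hl : ∀ x ∈ V ∪ W, x i = l ∨ x i = c l) :
    Good c (V.filter (· i = l)) (W.filter (· i = l)) := by
  refine ⟨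
    fun u hu v hv => h.dichV u (Finset.mem_of_mem_filter u hu) v (Finset.mem_of_mem_filter v hv),
    fun u hu v hv => h.dichW u (Finset.mem_of_mem_filter u hu) v (Finset.mem_of_mem_filter v hv),
    fun u hu v hv => h.twinV u (Finset.mem_of_mem_filter u hu) v (Finset.mem_of_mem_filter v hv),
    fun u hu v hv => h.twinW u (Finset.mem_of_mem_filter u hu) v (Finset.mem_of_mem_filter v hv),
    Finset.disjoint_filter_filter h.disj, fun g hg => ?_⟩
  have hn := h.null _ (val_update hg (j := i) (val_ind hc (consistent_singleton hf l)))
  have key : ∀ X : Finset (ι → S), X ⊆ V ∪ W →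
      ∑ x ∈ X.filter (· i = l), pr g Finset.univ x =
        g i l * ∑ x ∈ X, pr (Function.update g i (ind c {l})) Finset.univ x := by
    intro X hX
    rw [Finset.sum_filter, Finset.mul_sum]
    refine Finset.sum_congr rfl fun x hx => ?_
    rw [pr_update (Finset.mem_univ i)]
    rcases hl x (hX hx) with e | e
    · rw [if_pos e, pr_erase (Finset.mem_univ i), e, ind_of_mem (by simp), one_mul]
    · rw [if_neg (by rw [e]; exact hf l), e,
        ind_eq_zero (consistent_singleton hf l) (by simp [hc _]), zero_mul, mul_zero]
  rw [key V Finset.subset_union_left, key W Finset.subset_union_right, hn]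

lemma Good.sides (hc : Function.Involutive c) (hf : ∀ s, c s ≠ s) (h : Good c V W)
    (hn : NoNear V W c)
    (hind : ∀ V' W' : Finset (ι → S), Good c V' W' → V'.card = 4 → V'.card < V.card → False)
    {i : ι} {x y : ι → S} (hx : x ∈ V ∪ W) (hy : y ∈ V ∪ W) (h1 : y i ≠ x i) (h2 : y i ≠ c (x i)) :
    5 ≤ (side c V W i (x i)).card ∧ 5 ≤ (side c W V i (x i)).card := by
  have he := (h.null_side hc hf i (x i)).card_eq
  have hne : (side c V W i (x i)).Nonempty := by
    rcases Finset.mem_union.1 hx with hx | hx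
    · exact ⟨x, mem_side.2 (Or.inl ⟨hx, rfl⟩)⟩
    · rw [← Finset.card_pos, he, Finset.card_pos]
      exact ⟨x, mem_side.2 (Or.inl ⟨hx, rfl⟩)⟩
  have := h.five_le_side hc hf hn hind hy h1 h2 hne
  omega

lemma Good.card_side_add (hf : ∀ s, c s ≠ s) (h : Good c V W) (i : ι)
    (q : S) : (side c V W i q).card + (side c W V i q).card =
      ((V ∪ W).filter (fun x => x i = q ∨ x i = c q)).card := by
  have e : (V ∪ W).filter (fun x => x i = q ∨ x i = c q) = side c V W i q ∪ side c W V i q := by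
    ext x; simp only [Finset.mem_filter, Finset.mem_union, mem_side]; tauto
  rw [e, Finset.card_union_of_disjoint]
  rw [Finset.disjoint_left]
  intro x h1 h2
  rw [mem_side] at h1 h2
  have hd : x ∈ V → x ∉ W := fun a => Finset.disjoint_left.1 h.disj a
  have hq := hf q
  rcases h1 with h1 | h1 <;> rcases h2 with h2 | h2
  · exact hd h1.1 h2.1
  · exact hq (by rw [← h2.2, h1.2])
  · exact hq (by rw [← h1.2, h2.2])
  · exact hd h2.1 h1.1

omit [Fintype ι] in
lemma disjoint_filter_pairs (hc : Function.Involutive c) (X : Finset (ι → S)) {i : ι} {q r : S}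
    (h1 : r ≠ q) (h2 : r ≠ c q) :
    Disjoint (X.filter (fun z => z i = q ∨ z i = c q))
      (X.filter (fun z => z i = r ∨ z i = c r)) := by
  rw [Finset.disjoint_filter]
  rintro z - (e | e) (e' | e')
  · exact h1 (e'.symm.trans e)
  · exact h2 (by rw [← e, e', hc])
  · exact h2 (e'.symm.trans e)
  · exact h1 (hc.injective (e'.symm.trans e))

/-- Nonempty disjoint equivalent codes without twin pairs have at least seven words. -/
theorem Good.six_lt_card (hc : Function.Involutive c) (hf : ∀ s, c s ≠ s) (h : Good c V W)
    (hne : V.Nonempty) : 6 < V.card := by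
  induction hk : V.card using Nat.strong_induction_on generalizing V W with
  | _ k ih =>
  by_contra hk6
  have hcard := h.null.card_eq
  have hn : NoNear V W c := fun v hv w hw i h1 h2 h3 =>
    h.no_near_of_le_six hc hf (by omega) hv hw h1 h2 h3
  have hlt : ∀ V' W' : Finset (ι → S), Good c V' W' → V'.Nonempty → V'.card < V.card → False := by
    intro V' W' hg hne' hlt
    have := ih V'.card (hk ▸ hlt) hg hne' rfl
    omega
  have hind : ∀ V' W' : Finset (ι → S), Good c V' W' → V'.card = 4 → V'.card < V.card → False :=
    fun V' W' hg h4 => hlt V' W' hg (Finset.card_pos.1 (by omega))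
  have hpair : ∀ i, ∀ x ∈ V ∪ W, ∀ y ∈ V ∪ W, y i = x i ∨ y i = c (x i) := by
    intro i x hx y hy
    by_contra! hxy
    have s1 := h.sides hc hf hn hind hx hy hxy.1 hxy.2
    have s2 := h.sides hc hf hn hind hy hx hxy.1.symm fun e => hxy.2 (by rw [e, hc])
    have e1 := h.card_side_add hf i (x i)
    have e2 := h.card_side_add hf i (y i)
    have hdis := disjoint_filter_pairs hc (V ∪ W) (i := i) hxy.1 hxy.2
    have hle := Finset.card_le_card (Finset.union_subset
      (Finset.filter_subset (fun z : ι → S => z i = x i ∨ z i = c (x i)) (V ∪ W))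
      (Finset.filter_subset (fun z : ι → S => z i = y i ∨ z i = c (y i)) (V ∪ W)))
    rw [Finset.card_union_of_disjoint hdis, Finset.card_union_of_disjoint h.disj] at hle
    omega
  obtain ⟨v, hv⟩ := hne
  obtain ⟨w, hw⟩ := Finset.card_pos.1 (hcard ▸ Finset.card_pos.2 ⟨v, hv⟩)
  have hvw : w ≠ v := fun e => Finset.disjoint_left.1 h.disj hv (e ▸ hw)
  obtain ⟨i, hi⟩ := Function.ne_iff.1 hvw
  have hv' := Finset.mem_union_left W hv
  have hw' := Finset.mem_union_right V hw
  have hg := h.split hf hc (i := i) (l := v i) fun x hx => hpair i v hv' x hx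
  refine hlt _ _ hg ⟨v, by simp [hv]⟩ ?_
  have e := hg.null.card_eq
  rw [e, hcard]
  exact Finset.card_lt_card ⟨Finset.filter_subset _ _, fun hs => hi (Finset.mem_filter.1 (hs hw)).2⟩

/-- Every coordinate of disjoint equivalent twelve-word codes is constant or carries exactly two
complementary pairs, in a balanced way. -/
theorem Good.constant_or_two_pairs (hc : Function.Involutive c) (hf : ∀ s, c s ≠ s)
    (h : Good c V W) (h12 : V.card = 12) (i : ι) :
    (∀ x ∈ V ∪ W, ∀ y ∈ V ∪ W, y i = x i) ∨
    ∃ q r, r ≠ q ∧ r ≠ c q ∧ (∀ x ∈ V ∪ W, x i = q ∨ x i = c q ∨ x i = r ∨ x i = c r) ∧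
      10 ≤ ((V ∪ W).filter (fun x => x i = q ∨ x i = c q)).card ∧
      10 ≤ ((V ∪ W).filter (fun x => x i = r ∨ x i = c r)).card := by
  have hcard := h.null.card_eq
  have hn : NoNear V W c := fun v hv w hw i h1 h2 h3 => h.no_near hc hf h12 hv hw h1 h2 h3
  have hind : ∀ V' W' : Finset (ι → S), Good c V' W' → V'.card = 4 → V'.card < V.card → False := by
    intro V' W' hg h4 _
    have := hg.six_lt_card hc hf (Finset.card_pos.1 (by omega))
    omega
  by_cases hpair : ∀ x ∈ V ∪ W, ∀ y ∈ V ∪ W, y i = x i ∨ y i = c (x i)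
  · left
    by_contra! hcon
    obtain ⟨x, hx, y, hy, hxy⟩ := hcon
    have hy' := (hpair x hx y hy).resolve_left hxy
    have key : ∀ z ∈ V ∪ W, 6 < (V.filter (· i = z i)).card := by
      intro z hz
      have hg := h.split hf hc (i := i) (l := z i) fun u hu => hpair z hz u hu
      refine hg.six_lt_card hc hf ?_
      rcases Finset.mem_union.1 hz with hz | hz
      · exact ⟨z, by simp [hz]⟩
      · rw [← Finset.card_pos, hg.null.card_eq, Finset.card_pos]
        exact ⟨z, by simp [hz]⟩
    have k1 := key x hx
    have k2 := key y hy
    have hdis : Disjoint (V.filter (· i = x i)) (V.filter (· i = y i)) := by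
      rw [Finset.disjoint_filter]
      rintro z - e e'
      exact hxy (e'.symm.trans e)
    have hle := Finset.card_le_card (Finset.union_subset
      (Finset.filter_subset (fun z : ι → S => z i = x i) V)
      (Finset.filter_subset (fun z : ι → S => z i = y i) V))
    rw [Finset.card_union_of_disjoint hdis] at hle
    omega
  · right
    push Not at hpair
    obtain ⟨x, hx, y, hy, h1, h2⟩ := hpair
    have hbig : ∀ u ∈ V ∪ W, ∀ v ∈ V ∪ W, v i ≠ u i → v i ≠ c (u i) →
        10 ≤ ((V ∪ W).filter (fun z => z i = u i ∨ z i = c (u i))).card := by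
      intro u hu v hv h1 h2
      have := h.sides hc hf hn hind hu hv h1 h2
      have := h.card_side_add hf i (u i)
      omega
    have h2' : x i ≠ c (y i) := fun e => h2 (by rw [e, hc])
    have b1 := hbig x hx y hy h1 h2
    have b2 := hbig y hy x hx h1.symm h2'
    refine ⟨x i, y i, h1, h2, fun z hz => ?_, b1, b2⟩
    by_contra! hcon
    obtain ⟨z1, z2, z3, z4⟩ := hcon
    have b3 := hbig z hz x hx z1.symm fun e => z2 (by rw [e, hc])
    have d12 := disjoint_filter_pairs hc (V ∪ W) (i := i) h1 h2
    have d3 : Disjoint ((V ∪ W).filter (fun z => z i = x i ∨ z i = c (x i)) ∪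
        (V ∪ W).filter (fun z => z i = y i ∨ z i = c (y i)))
        ((V ∪ W).filter (fun u => u i = z i ∨ u i = c (z i))) := by
      exact Finset.disjoint_union_left.2
        ⟨disjoint_filter_pairs hc _ z1 z2, disjoint_filter_pairs hc _ z3 z4⟩
    have hle := Finset.card_le_card (Finset.union_subset (Finset.union_subset
      (Finset.filter_subset (fun u : ι → S => u i = x i ∨ u i = c (x i)) (V ∪ W))
      (Finset.filter_subset (fun u : ι → S => u i = y i ∨ u i = c (y i)) (V ∪ W)))
      (Finset.filter_subset (fun u : ι → S => u i = z i ∨ u i = c (z i)) (V ∪ W)))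
    rw [Finset.card_union_of_disjoint d3, Finset.card_union_of_disjoint d12,
      Finset.card_union_of_disjoint h.disj] at hle
    omega

end Good
end

section
open scoped Classical

/-- The coefficient of `y ^ j * z ^ k` in the product of the factors `1 + p * y + q * z`. -/
def coef : List (ℤ × ℤ) → ℕ → ℕ → ℤ
  | [], 0, 0 => 1
  | [], _, _ => 0
  | t :: l, j, k => coef l j k + (match j with | 0 => 0 | j + 1 => t.1 * coef l j k) +
      (match k with | 0 => 0 | k + 1 => t.2 * coef l j k)

lemma coef_perm {l l' : List (ℤ × ℤ)} (h : l.Perm l') : coef l = coef l' := by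
  induction h with
  | nil => rfl
  | cons t _ ih => funext j k; cases j <;> cases k <;> simp [coef, ih]
  | swap s t l =>
    funext j k
    rcases j with - | - | j <;> rcases k with - | - | k <;> simp only [coef] <;> ring
  | trans _ _ h1 h2 => exact h1.trans h2

lemma coef_zero_zero (l : List (ℤ × ℤ)) : coef l 0 0 = 1 := by
  induction l with
  | nil => rfl
  | cons t l ih => simp [coef, ih]

section kernels
variable {ι α : Type} (e₁ e₂ z : ι → α → ℤ)

/-- The kernel attached to three features at each coordinate. -/
def ker (L : List ι) (u v : α) : List (ℤ × ℤ) :=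
  L.map fun i => (e₁ i u * e₁ i v + e₂ i u * e₂ i v, z i u * z i v)

lemma sum_coef_nil (X : Finset α) (w w' : α → ℤ) (j k : ℕ) :
    ∑ u ∈ X, ∑ v ∈ X, w u * w' v * coef (ker e₁ e₂ z [] u v) j k =
      (∑ u ∈ X, w u) * (∑ u ∈ X, w' u) * coef [] j k := by
  simp only [ker, List.map_nil]
  rw [Finset.sum_mul_sum, Finset.sum_mul]
  exact Finset.sum_congr rfl fun u _ => by rw [Finset.sum_mul]

lemma sum_coef_cons (X : Finset α) (w w' : α → ℤ) (i : ι) (L : List ι) (j k : ℕ) :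
    ∑ u ∈ X, ∑ v ∈ X, w u * w' v * coef (ker e₁ e₂ z (i :: L) u v) j k =
      ∑ u ∈ X, ∑ v ∈ X, w u * w' v * coef (ker e₁ e₂ z L u v) j k +
      (match j with
        | 0 => 0
        | j + 1 =>
          ∑ u ∈ X, ∑ v ∈ X, (w u * e₁ i u) * (w' v * e₁ i v) * coef (ker e₁ e₂ z L u v) j k +
          ∑ u ∈ X, ∑ v ∈ X, (w u * e₂ i u) * (w' v * e₂ i v) * coef (ker e₁ e₂ z L u v) j k) +
      (match k with
        | 0 => 0
        | k + 1 =>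
          ∑ u ∈ X, ∑ v ∈ X, (w u * z i u) * (w' v * z i v) * coef (ker e₁ e₂ z L u v) j k) := by
  cases j <;> cases k <;> simp only [add_zero, ← Finset.sum_add_distrib] <;>
    refine Finset.sum_congr rfl fun u _ => Finset.sum_congr rfl fun v _ => ?_ <;>
    simp only [ker, List.map_cons, coef] <;> ring

lemma sum_coef_nonneg (X : Finset α) (L : List ι) (w : α → ℤ) (j k : ℕ) :
    0 ≤ ∑ u ∈ X, ∑ v ∈ X, w u * w v * coef (ker e₁ e₂ z L u v) j k := by
  induction L generalizing w j k with
  | nil =>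
    rw [sum_coef_nil]
    refine mul_nonneg (mul_self_nonneg _) ?_
    cases j <;> cases k <;> simp [coef]
  | cons i L ih =>
    rw [sum_coef_cons]
    have h0 := ih w
    have h1 := ih (fun u => w u * e₁ i u)
    have h2 := ih (fun u => w u * e₂ i u)
    have h3 := ih (fun u => w u * z i u)
    cases j <;> cases k <;> simp only [add_zero] <;> first | exact h0 _ _ | skip
    · exact add_nonneg (h0 _ _) (h3 _ _)
    · exact add_nonneg (h0 _ _) (add_nonneg (h1 _ _) (h2 _ _))
    · exact add_nonneg (add_nonneg (h0 _ _) (add_nonneg (h1 _ _) (h2 _ _))) (h3 _ _)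

end kernels

lemma sum_coef_eq_zero {ι : Type} {c : S → S} (e₁ e₂ z : ι → (ι → S) → ℤ)
    (f₁ f₂ : ι → S → ℚ) (hv₁ : ∀ i, Val c (f₁ i)) (hv₂ : ∀ i, Val c (f₂ i))
    (hf₁ : ∀ i u, (e₁ i u : ℚ) = f₁ i (u i)) (hf₂ : ∀ i u, (e₂ i u : ℚ) = f₂ i (u i))
    (X : Finset (ι → S)) (L : List ι) (hL : L.Nodup) (w w' : (ι → S) → ℤ)
    (h : ∀ g : ι → S → ℚ, (∀ i, Val c (g i)) →
      ∑ u ∈ X, (w u : ℚ) * (L.map fun i => g i (u i)).prod = 0) (j : ℕ) :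
    ∑ u ∈ X, ∑ v ∈ X, w u * w' v * coef (ker e₁ e₂ z L u v) j 0 = 0 := by
  induction L generalizing w w' j with
  | nil =>
    rw [sum_coef_nil]
    have := h (fun _ _ => 1) (fun _ => val_one)
    have h0 : ∑ u ∈ X, w u = 0 := by
      simp only [List.map_nil, List.prod_nil, mul_one] at this
      exact_mod_cast this
    rw [h0]; simp
  | cons i L ih =>
    obtain ⟨hi, hL⟩ := List.nodup_cons.1 hL
    have step : ∀ f : S → ℚ, Val c f → ∀ g : ι → S → ℚ, (∀ i, Val c (g i)) →
        ∑ u ∈ X, ((w u : ℚ) * f (u i)) * (L.map fun i => g i (u i)).prod = 0 := by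
      intro f hf g hg
      rw [← h _ (val_update hg (j := i) hf)]
      refine Finset.sum_congr rfl fun u _ => ?_
      rw [List.map_cons, List.prod_cons, Function.update_self, mul_assoc]
      congr 3
      refine List.map_congr_left fun m hm => ?_
      rw [Function.update_of_ne]
      rintro rfl
      exact hi hm
    rw [sum_coef_cons]
    have h0 := ih hL w w' (fun g hg => by simpa using step _ val_one g hg)
    have h1 := ih hL (fun u => w u * e₁ i u) (fun u => w' u * e₁ i u) (fun g hg => by
      simpa [hf₁] using step _ (hv₁ i) g hg)
    have h2 := ih hL (fun u => w u * e₂ i u) (fun u => w' u * e₂ i u) (fun g hg => by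
      simpa [hf₂] using step _ (hv₂ i) g hg)
    cases j
    · simpa using h0 0
    · simp only [add_zero]
      rw [h0, h1, h2]; simp

end

section
open scoped Classical

/-- A linear combination of the coefficients of a list of factors. -/
def lin (Λ : List ((ℕ × ℕ) × ℤ)) (l : List (ℤ × ℤ)) : ℤ :=
  (Λ.map fun t => t.2 * coef l t.1.1 t.1.2).sum

/-- The list of factors of two words agreeing at `a`, dichotomous at `b` and unrelated at `k`
coordinates. -/
def factors (a b k : ℕ) : List (ℤ × ℤ) :=
  List.replicate a (1, 1) ++ List.replicate b (-1, 1) ++ List.replicate k (0, -1)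

/-- A dual solution showing that the distance distribution of two codes does not exist. -/
def Certificate (n : ℕ) (Λ M : List ((ℕ × ℕ) × ℤ)) (ν μ : ℤ) : Prop :=
  (∀ t ∈ Λ, t.1.2 = 0 ∨ 0 ≤ t.2) ∧ (∀ t ∈ M, 0 ≤ t.2) ∧ 0 ≤ ν ∧
  (∀ a ∈ Finset.range (n + 1), ∀ b ∈ Finset.range (n + 1), a + b ≤ n →
    ((0 < b → ¬ (b = 1 ∧ n - a - b = 0) →
      lin Λ (factors a b (n - a - b)) + lin M (factors a b (n - a - b)) -
        ν * coef (factors a b (n - a - b)) 0 1 + μ ≤ 0) ∧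
    (a ≠ n → ¬ (b = 0 ∧ n - a - b = 1) →
      -lin Λ (factors a b (n - a - b)) + lin M (factors a b (n - a - b)) -
        ν * coef (factors a b (n - a - b)) 0 1 + μ ≤ 0))) ∧
  24 * (lin Λ (factors n 0 0) + lin M (factors n 0 0) - ν * coef (factors n 0 0) 0 1 + μ) <
    576 * μ - 16 * n * ν

instance (n : ℕ) (Λ M : List ((ℕ × ℕ) × ℤ)) (ν μ : ℤ) : Decidable (Certificate n Λ M ν μ) := by
  unfold Certificate; exact instDecidableAnd

lemma perm_factors (l : List (ℤ × ℤ)) (h : ∀ t ∈ l, t = (1, 1) ∨ t = (-1, 1) ∨ t = (0, -1)) :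
    l.Perm (factors (l.count (1, 1)) (l.count (-1, 1)) (l.count (0, -1))) := by
  rw [List.perm_iff_count]
  intro t
  by_cases ht : t ∈ l
  · rcases h t ht with rfl | rfl | rfl <;> simp [factors, List.count_replicate]
  · rw [List.count_eq_zero_of_not_mem ht, eq_comm, List.count_eq_zero]
    intro ht'
    simp only [factors, List.mem_append, List.mem_replicate] at ht'
    rcases ht' with (⟨h1, rfl⟩ | ⟨h1, rfl⟩) | ⟨h1, rfl⟩ <;>
      exact h1 (List.count_eq_zero_of_not_mem ht)

lemma count_toList_map {ι β : Type} [Fintype ι] [BEq β] [LawfulBEq β] (t : ι → β) (x : β) :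
    ((Finset.univ : Finset ι).toList.map t).count x = (Finset.univ.filter (t · = x)).card := by
  change _ = (Multiset.filter (t · = x) Finset.univ.val).card
  rw [← Finset.coe_toList, Multiset.filter_coe, Multiset.coe_card, List.count, List.countP_map,
    List.countP_eq_length_filter]
  congr 2
  funext i
  simp [beq_eq_decide]

section kernels
variable {ι α : Type} (e₁ e₂ z : ι → α → ℤ)

lemma sum_lin_nonneg (X : Finset α) (L : List ι) (w : α → ℤ) (Λ : List ((ℕ × ℕ) × ℤ))
    (h : ∀ t ∈ Λ, (∀ j, ∑ u ∈ X, ∑ v ∈ X, w u * w v * coef (ker e₁ e₂ z L u v) j 0 = 0) ∧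
      t.1.2 = 0 ∨ 0 ≤ t.2) :
    0 ≤ ∑ u ∈ X, ∑ v ∈ X, w u * w v * lin Λ (ker e₁ e₂ z L u v) := by
  induction Λ with
  | nil => simp [lin]
  | cons t Λ ih =>
    have ih := ih fun t ht => h t (List.mem_cons_of_mem _ ht)
    have e : ∑ u ∈ X, ∑ v ∈ X, w u * w v * lin (t :: Λ) (ker e₁ e₂ z L u v) =
        t.2 * (∑ u ∈ X, ∑ v ∈ X, w u * w v * coef (ker e₁ e₂ z L u v) t.1.1 t.1.2) +
        ∑ u ∈ X, ∑ v ∈ X, w u * w v * lin Λ (ker e₁ e₂ z L u v) := by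
      simp only [Finset.mul_sum, ← Finset.sum_add_distrib]
      refine Finset.sum_congr rfl fun u _ => Finset.sum_congr rfl fun v _ => ?_
      simp only [lin, List.map_cons, List.sum_cons]; ring
    rw [e]
    refine add_nonneg ?_ ih
    rcases h t List.mem_cons_self with ⟨h1, h2⟩ | h1
    · rw [h2, h1, mul_zero]
    · exact mul_nonneg h1 (sum_coef_nonneg _ _ _ _ _ _ _ _)

lemma sum_coef_zero_one (X : Finset α) (L : List ι) :
    ∑ u ∈ X, ∑ v ∈ X, coef (ker e₁ e₂ z L u v) 0 1 = (L.map fun i => (∑ u ∈ X, z i u) ^ 2).sum := by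
  induction L with
  | nil => simp [ker, coef]
  | cons i L ih =>
    rw [List.map_cons, List.sum_cons, ← ih, sq, Finset.sum_mul_sum, ← Finset.sum_add_distrib]
    refine Finset.sum_congr rfl fun u _ => ?_
    rw [← Finset.sum_add_distrib]
    refine Finset.sum_congr rfl fun v _ => ?_
    simp [ker, coef, coef_zero_zero]; ring

end kernels

/-- The sign of a letter relative to the pair of `q`. -/
noncomputable def sgnInt (c : S → S) (q s : S) : ℤ := if s = q then 1 else if s = c q then -1 else 0

lemma entry_eq {c : S → S} (hc : Function.Involutive c) (hf : ∀ s, c s ≠ s) {q r x y : S}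
    (h1 : r ≠ q) (h2 : r ≠ c q) (hx : x = q ∨ x = c q ∨ x = r ∨ x = c r)
    (hy : y = q ∨ y = c q ∨ y = r ∨ y = c r) :
    (sgnInt c q x * sgnInt c q y + sgnInt c r x * sgnInt c r y,
      (if x = q ∨ x = c q then (1 : ℤ) else -1) * (if y = q ∨ y = c q then 1 else -1)) =
    if y = x then (1, 1) else if y = c x then (-1, 1) else (0, -1) := by
  have h3 : q ≠ c r := fun e => h2 (by rw [e, hc])
  have h4 : c r ≠ c q := fun e => h1 (hc.injective e)
  have f1 := hf q
  have f2 := hf r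
  unfold sgnInt
  rcases hx with rfl | rfl | rfl | rfl <;> rcases hy with rfl | rfl | rfl | rfl <;>
    simp [hc _, h1, h2, h3, h4, h1.symm, h2.symm, h3.symm, h4.symm, f1, f2, f1.symm, f2.symm]

section Good
variable {ι : Type} [Fintype ι] {c : S → S} {V W : Finset (ι → S)}

/-- Disjoint equivalent twelve-word codes with two balanced pairs at every coordinate do not
exist when the linear program of their distance distribution is infeasible. -/
theorem Good.not_certificate (hc : Function.Involutive c) (hf : ∀ s, c s ≠ s) (h : Good c V W)
    (h12 : V.card = 12) (q r : ι → S) (h1 : ∀ i, r i ≠ q i) (h2 : ∀ i, r i ≠ c (q i))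
    (hl : ∀ i, ∀ x ∈ V ∪ W, x i = q i ∨ x i = c (q i) ∨ x i = r i ∨ x i = c (r i))
    (hq : ∀ i, 10 ≤ ((V ∪ W).filter (fun x => x i = q i ∨ x i = c (q i))).card)
    (hr : ∀ i, 10 ≤ ((V ∪ W).filter (fun x => x i = r i ∨ x i = c (r i))).card)
    {Λ M : List ((ℕ × ℕ) × ℤ)} {ν μ : ℤ} : ¬ Certificate (Fintype.card ι) Λ M ν μ := by
  rintro ⟨hΛ, hM, hν, hpt, hfin⟩
  set n := Fintype.card ι with hn
  set X := V ∪ W with hX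
  have hcard := h.null.card_eq
  have hXc : X.card = 24 := by rw [hX, Finset.card_union_of_disjoint h.disj]; omega
  set e₁ : ι → (ι → S) → ℤ := fun i u => sgnInt c (q i) (u i) with he₁
  set e₂ : ι → (ι → S) → ℤ := fun i u => sgnInt c (r i) (u i) with he₂
  set z : ι → (ι → S) → ℤ := fun i u => if u i = q i ∨ u i = c (q i) then 1 else -1 with hz
  set w : (ι → S) → ℤ := fun u => if u ∈ V then 1 else -1 with hw
  set L := (Finset.univ : Finset ι).toList with hL
  set K := ker e₁ e₂ z L with hK
  have hcast : ∀ p s, (sgnInt c p s : ℚ) = sgnPair c p s := by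
    intro p s; unfold sgnInt sgnPair; split_ifs <;> simp
  have hwW : ∀ u ∈ W, w u = -1 := fun u hu => if_neg fun hu' => Finset.disjoint_left.1 h.disj hu' hu
  have hwV : ∀ u ∈ V, w u = 1 := fun u hu => if_pos hu
  have hzero : ∀ j, ∑ u ∈ X, ∑ v ∈ X, w u * w v * coef (K u v) j 0 = 0 := by
    refine fun j => sum_coef_eq_zero e₁ e₂ z (fun i => sgnPair c (q i)) (fun i => sgnPair c (r i))
      (fun i => val_sgnPair hc hf _) (fun i => val_sgnPair hc hf _) (fun i u => hcast _ _)
      (fun i u => hcast _ _) X L (Finset.nodup_toList _) w w (fun g hg => ?_) j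
    have e : ∀ u : ι → S, (L.map fun i => g i (u i)).prod = pr g Finset.univ u := by
      intro u; rw [hL, Finset.prod_map_toList]; rfl
    simp only [e]
    rw [hX, Finset.sum_union h.disj, Finset.sum_congr rfl fun u hu => by rw [hwV u hu],
      Finset.sum_congr rfl (s₁ := W) fun u hu => by rw [hwW u hu]]
    have := h.null g hg
    simp only [Int.cast_one, one_mul, Int.cast_neg, neg_mul, Finset.sum_neg_distrib]
    linarith
  have hsD := sum_lin_nonneg e₁ e₂ z X L w Λ fun t ht => (hΛ t ht).imp_left fun e => ⟨hzero, e⟩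
  have hsS := sum_lin_nonneg e₁ e₂ z X L (fun _ => 1) M fun t ht => Or.inr (hM t ht)
  have hs1 : ∑ u ∈ X, ∑ v ∈ X, coef (K u v) 0 1 ≤ 16 * n := by
    rw [hK, sum_coef_zero_one]
    have hb : ∀ i, (∑ u ∈ X, z i u) ^ 2 ≤ 16 := by
      intro i
      have e := disjoint_filter_pairs hc X (i := i) (h1 i) (h2 i)
      have hle := Finset.card_le_card (Finset.union_subset
        (Finset.filter_subset (fun u : ι → S => u i = q i ∨ u i = c (q i)) X)
        (Finset.filter_subset (fun u : ι → S => u i = r i ∨ u i = c (r i)) X))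
      rw [Finset.card_union_of_disjoint e] at hle
      have e2 := Finset.card_filter_add_card_filter_not (s := X)
        (fun u : ι → S => u i = q i ∨ u i = c (q i))
      have hsum : ∑ u ∈ X, z i u = (X.filter (fun u => u i = q i ∨ u i = c (q i))).card -
          (X.filter (fun u => ¬ (u i = q i ∨ u i = c (q i)))).card := by
        simp only [hz, Finset.sum_ite, Finset.sum_const]
        simp [sub_eq_add_neg]
      have q1 := hq i
      have q2 := hr i
      rw [hsum]
      have a1 : -4 ≤ ((X.filter (fun u => u i = q i ∨ u i = c (q i))).card : ℤ) -
          (X.filter (fun u => ¬ (u i = q i ∨ u i = c (q i)))).card := by omega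
      have a2 : ((X.filter (fun u => u i = q i ∨ u i = c (q i))).card : ℤ) -
          (X.filter (fun u => ¬ (u i = q i ∨ u i = c (q i)))).card ≤ 4 := by omega
      nlinarith
    have := List.sum_le_card_nsmul (L.map fun i => (∑ u ∈ X, z i u) ^ 2) 16 (by
      simp only [List.mem_map]; rintro _ ⟨i, -, rfl⟩; exact hb i)
    simp only [List.length_map, hL, Finset.length_toList, Finset.card_univ] at this
    simpa [hL, mul_comm] using this
  set E : (ι → S) → (ι → S) → ℤ := fun u v => w u * w v * lin Λ (K u v) + lin M (K u v) -
    ν * coef (K u v) 0 1 + μ with hE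
  have hEsum : 576 * μ - 16 * n * ν ≤ ∑ u ∈ X, ∑ v ∈ X, E u v := by
    simp only [hE, Finset.sum_add_distrib, Finset.sum_sub_distrib, ← Finset.mul_sum,
      Finset.sum_const, hXc]
    simp only [one_mul, mul_one] at hsS
    have := mul_le_mul_of_nonneg_left hs1 hν
    simp only [nsmul_eq_mul]
    push_cast
    linarith
  have hentry : ∀ u ∈ X, ∀ v ∈ X, K u v = L.map fun i =>
      if v i = u i then (1, 1) else if v i = c (u i) then (-1, 1) else (0, -1) := by
    intro u hu v hv
    exact List.map_congr_left fun i _ => entry_eq hc hf (h1 i) (h2 i) (hl i u hu) (hl i v hv)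
  have hdiag : ∀ u ∈ X, K u u = factors n 0 0 := by
    intro u hu
    rw [hentry u hu u hu]
    simp [factors, hL, hn]
  have hoff : ∀ u ∈ X, ∀ v ∈ X, v ≠ u → E u v ≤ 0 := by
    intro u hu v hv huv
    have hk := hentry u hu v hv
    set t : ι → ℤ × ℤ := fun i => if v i = u i then (1, 1) else if v i = c (u i) then (-1, 1)
      else (0, -1) with ht
    have hmem : ∀ x ∈ K u v, x = (1, 1) ∨ x = (-1, 1) ∨ x = (0, -1) := by
      rw [hk]; simp only [List.mem_map, ht]
      rintro x ⟨i, -, rfl⟩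
      split_ifs <;> simp
    have hp := perm_factors _ hmem
    have hlen := hp.length_eq
    have cnt : ∀ x, (K u v).count x = (Finset.univ.filter (t · = x)).card := by
      intro x; rw [hk]; convert count_toList_map t x
    set a := (K u v).count (1, 1)
    set b := (K u v).count (-1, 1)
    set k := (K u v).count (0, -1)
    have ca : a = _ := cnt (1, 1)
    have cb : b = _ := cnt (-1, 1)
    have ck : k = _ := cnt (0, -1)
    have htA : ∀ i, t i = (1, 1) ↔ v i = u i := by
      intro i; simp only [ht]; split_ifs <;> simp [*]
    have htH : ∀ i, t i = (-1, 1) ↔ v i = c (u i) := by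
      intro i; simp only [ht]; split_ifs with g1 g2 <;> simp [*, (hf _).symm]
    have htK : ∀ i, t i = (0, -1) ↔ v i ≠ u i ∧ v i ≠ c (u i) := by
      intro i; simp only [ht]; split_ifs with g1 g2 <;> simp [*]
    have hn' : a + b + k = n := by
      rw [hk] at hlen
      simpa [factors, hL, ← hn, add_assoc] using hlen.symm
    have hkk : k = n - a - b := by omega
    obtain ⟨p1, p2⟩ := hpt a (Finset.mem_range.2 (by omega)) b (Finset.mem_range.2 (by omega))
      (by omega)
    rw [← hkk] at p1 p2
    have hEe : E u v = w u * w v * lin Λ (factors a b k) + lin M (factors a b k) -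
        ν * coef (factors a b k) 0 1 + μ := by
      simp only [hE, lin, coef_perm hp]
    have huniq : ∀ y, (Finset.univ.filter (t · = y)).card = 1 →
        ∃ i, t i = y ∧ ∀ m, t m = y → m = i := by
      intro y hy
      obtain ⟨i, hi⟩ := Finset.card_eq_one.1 hy
      refine ⟨i, ?_, fun m hm => ?_⟩
      · have : i ∈ Finset.univ.filter (t · = y) := by rw [hi]; simp
        simpa using this
      · have : m ∈ Finset.univ.filter (t · = y) := by simpa using hm
        simpa [hi] using this
    have hnone : ∀ y, (Finset.univ.filter (t · = y)).card = 0 → ∀ m, t m ≠ y := by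
      intro y hy m hm
      rw [Finset.card_eq_zero] at hy
      exact Finset.notMem_empty m (hy ▸ Finset.mem_filter.2 ⟨Finset.mem_univ m, hm⟩)
    have same : (∃ i, v i = c (u i)) → ¬ TwinOn c Finset.univ u v → w u * w v = 1 → E u v ≤ 0 := by
      rintro ⟨i, hi⟩ htw hww
      rw [hEe, hww, one_mul]
      refine p1 ?_ ?_
      · rw [cb]
        exact Finset.card_pos.2 ⟨i, Finset.mem_filter.2 ⟨Finset.mem_univ i, (htH i).2 hi⟩⟩
      · rintro ⟨b1, k0⟩
        obtain ⟨j, hj, hju⟩ := huniq (-1, 1) (by rw [← cb, b1])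
        refine htw ⟨j, Finset.mem_univ j, (htH j).1 hj, fun m _ hm => ?_⟩
        by_contra hne
        by_cases hcm : v m = c (u m)
        · exact hm (hju m ((htH m).2 hcm))
        · exact hnone (0, -1) (by rw [← ck, k0]) m ((htK m).2 ⟨hne, hcm⟩)
    have cross : (¬ ∃ i, v i ≠ u i ∧ v i ≠ c (u i) ∧ ∀ k, k ≠ i → v k = u k) → w u * w v = -1 →
        E u v ≤ 0 := by
      rintro hnear hww
      rw [hEe, hww, neg_one_mul]
      refine p2 ?_ ?_
      · intro han
        refine huv (funext fun i => ?_)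
        have : Finset.univ.filter (t · = (1, 1)) = Finset.univ :=
          Finset.eq_univ_of_card _ (by rw [← ca, han])
        have hi := Finset.mem_univ i
        rw [← this] at hi
        exact (htA i).1 (Finset.mem_filter.1 hi).2
      · rintro ⟨b0, k1⟩
        obtain ⟨j, hj, hju⟩ := huniq (0, -1) (by rw [← ck, k1])
        refine hnear ⟨j, ((htK j).1 hj).1, ((htK j).1 hj).2, fun m hm => ?_⟩
        by_contra hne
        by_cases hcm : v m = c (u m)
        · exact hnone (-1, 1) (by rw [← cb, b0]) m ((htH m).2 hcm)
        · exact hm (hju m ((htK m).2 ⟨hne, hcm⟩))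
    have near : ∀ {V W : Finset (ι → S)}, Good c V W → V.card = 12 → u ∈ V → v ∈ W →
        ¬ ∃ i, v i ≠ u i ∧ v i ≠ c (u i) ∧ ∀ k, k ≠ i → v k = u k := by
      rintro V W h h12 hu hv ⟨i, i1, i2, i3⟩
      exact h.no_near hc hf h12 hu hv i1 i2 i3
    rcases Finset.mem_union.1 hu with hu | hu <;> rcases Finset.mem_union.1 hv with hv | hv
    · exact same (h.dichV u hu v hv huv.symm) (h.twinV u hu v hv) (by rw [hwV u hu, hwV v hv]; rfl)
    · exact cross (near h h12 hu hv) (by rw [hwV u hu, hwW v hv]; rfl)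
    · exact cross (near h.symm (hcard ▸ h12) hu hv) (by rw [hwW u hu, hwV v hv]; rfl)
    · exact same (h.dichW u hu v hv huv.symm) (h.twinW u hu v hv) (by rw [hwW u hu, hwW v hv]; rfl)
  have hww : ∀ u, w u * w u = 1 := by
    intro u; simp only [hw]; split_ifs <;> rfl
  have hup : ∑ u ∈ X, ∑ v ∈ X, E u v ≤ ∑ u ∈ X, E u u := by
    refine Finset.sum_le_sum fun u hu => ?_
    rw [← Finset.add_sum_erase X _ hu]
    have := Finset.sum_nonpos fun v hv => hoff u hu v (Finset.mem_of_mem_erase hv)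
      (Finset.ne_of_mem_erase hv)
    linarith
  rw [Finset.sum_congr rfl fun u hu => show E u u = lin Λ (factors n 0 0) + lin M (factors n 0 0) -
      ν * coef (factors n 0 0) 0 1 + μ by
    simp only [hE, hdiag u hu, hww, one_mul], Finset.sum_const, hXc] at hup
  simp only [nsmul_eq_mul] at hup
  push_cast at hup
  linarith

end Good

lemma certificate_five : Certificate 5
    [((0, 0), 35), ((0, 2), 39), ((0, 4), 43), ((1, 0), -11), ((1, 2), 11), ((1, 3), 30),
      ((1, 4), 49), ((3, 0), -184), ((4, 0), -624), ((5, 0), -976)]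
    [((0, 4), 57), ((0, 5), 3), ((1, 3), 8), ((1, 4), 16), ((3, 0), 16)] 103 (-157) := by
  decide +kernel

lemma certificate_six : Certificate 6
    [((0, 0), 43723), ((0, 4), 11019), ((0, 5), 4808), ((1, 0), -15258), ((1, 4), 8430),
      ((1, 5), 19032), ((2, 0), -29456), ((2, 4), 9512), ((3, 0), -20672), ((4, 0), -106848),
      ((5, 0), -250304), ((6, 0), -348928)]
    [((0, 4), 3403), ((0, 6), 9934), ((1, 2), 786)] 42186 (-133935) := by
  decide +kernel

end

section
open scoped Classical

variable {c : S → S} {ι : Type} [Fintype ι] {V W : Finset (ι → S)}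

/-- A pairwise dichotomous set of words with two complementary pairs of letters per position has
at most `2 ^ K.card` elements. -/
lemma card_le_two_pow (hc : Function.Involutive c) (hf : ∀ s, c s ≠ s) (q r : ι → S)
    (hqr : ∀ i, r i ≠ c (q i)) (K : Finset ι) :
    ∀ X : Finset (ι → S),
      (∀ i, ∀ x ∈ X, x i = q i ∨ x i = c (q i) ∨ x i = r i ∨ x i = c (r i)) →
      (∀ u ∈ X, ∀ v ∈ X, u ≠ v → ∃ j ∈ K, v j = c (u j)) → X.card ≤ 2 ^ K.card := by
  induction K using Finset.induction_on with
  | empty =>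
    intro X _ hX
    simp only [Finset.card_empty, pow_zero, Finset.card_le_one]
    intro u hu v hv
    by_contra hne
    obtain ⟨j, hj, _⟩ := hX u hu v hv hne
    simp at hj
  | insert i K hi ih =>
    intro X hl hX
    rw [Finset.card_insert_of_notMem hi, pow_succ,
      ← Finset.card_filter_add_card_filter_not (s := X) (fun x => x i = q i ∨ x i = r i)]
    have key : ∀ Y ⊆ X, (∀ u ∈ Y, ∀ v ∈ Y, v i ≠ c (u i)) → Y.card ≤ 2 ^ K.card := by
      intro Y hY hYi
      refine ih Y (fun j x hx => hl j x (hY hx)) fun u hu v hv hne => ?_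
      obtain ⟨j, hj, e⟩ := hX u (hY hu) v (hY hv) hne
      rcases Finset.mem_insert.1 hj with rfl | hj
      · exact absurd e (hYi u hu v hv)
      · exact ⟨j, hj, e⟩
    have hrq : q i ≠ c (r i) := fun e => hqr i (by rw [e, hc])
    have a := key (X.filter fun x => x i = q i ∨ x i = r i) (Finset.filter_subset _ _) (by
      intro u hu v hv e
      have hu := (Finset.mem_filter.1 hu).2
      have hv := (Finset.mem_filter.1 hv).2
      rcases hu with hu | hu <;> rcases hv with hv | hv <;> rw [hu, hv] at e
      exacts [hf _ e.symm, hqr i e, hrq e, hf _ e.symm])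
    have b := key (X.filter fun x => ¬ (x i = q i ∨ x i = r i)) (Finset.filter_subset _ _) (by
      intro u hu v hv e
      have hu' := hl i u (Finset.mem_filter.1 hu).1
      have hu := (Finset.mem_filter.1 hu).2
      have hv := (Finset.mem_filter.1 hv).2
      push Not at hu hv
      rcases hu' with e' | e' | e' | e'
      · exact hu.1 e'
      · exact hv.1 (by rw [e, e', hc])
      · exact hu.2 e'
      · exact hv.2 (by rw [e, e', hc]))
    omega

/-- Two complementary pairs of letters, numbered so that complementation flips the last bit. -/
def letter (c : S → S) (q r : S) : ℕ → S
  | 0 => q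
  | 1 => c q
  | 2 => r
  | _ => c r

lemma letter_xor_one (hc : Function.Involutive c) (q r : S) {n : ℕ} (hn : n < 4) :
    letter c q r (n ^^^ 1) = c (letter c q r n) := by
  interval_cases n <;> simp [letter, hc _]

lemma letter_inj (hc : Function.Involutive c) (hf : ∀ s, c s ≠ s) {q r : S} (h1 : r ≠ q)
    (h2 : r ≠ c q) {m n : ℕ} (hm : m < 4) (hn : n < 4) (h : letter c q r m = letter c q r n) :
    m = n := by
  have h3 : q ≠ c r := fun e => h2 (by rw [e, hc])
  have h4 := hc.injective.ne h1
  interval_cases m <;> interval_cases n <;>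
    simp [letter, hf, h1, h1.symm, h2, h2.symm, h3, h3.symm, h4, h4.symm, (hf _).symm] at h ⊢

/-- The `i`-th base four digit. -/
def digit (w i : ℕ) : ℕ := (w >>> (2 * i)) &&& 3

lemma digit_lt (w i : ℕ) : digit w i < 4 := Nat.lt_succ_of_le Nat.and_le_right

lemma digit_xor (v w i : ℕ) : digit (v ^^^ w) i = digit v i ^^^ digit w i := by
  simp [digit, Nat.shiftRight_xor_distrib, Nat.and_xor_distrib_right]

lemma digit_and (v w i : ℕ) : digit (v &&& w) i = digit v i &&& digit w i := by
  unfold digit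
  rw [Nat.shiftRight_and_distrib]
  apply Nat.eq_of_testBit_eq
  intro j
  simp only [Nat.testBit_and]
  cases Nat.testBit (v >>> (2 * i)) j <;> cases Nat.testBit (w >>> (2 * i)) j <;> simp

/-- An identification of the positions with `Fin 4` and a choice of two complementary pairs of
letters at each position, containing all letters of the words in `X`. -/
structure Frame (c : S → S) (X : Finset (ι → S)) where
  e : Fin 4 ≃ ι
  q : Fin 4 → S
  r : Fin 4 → S
  ne : ∀ k, r k ≠ q k
  ne_compl : ∀ k, r k ≠ c (q k)
  mem : ∀ x ∈ X, ∀ k, ∃ n < 4, x (e k) = letter c (q k) (r k) n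

/-- The word with the given base four code. -/
def Frame.word {X : Finset (ι → S)} (D : Frame c X) (w : ℕ) (i : ι) : S :=
  letter c (D.q (D.e.symm i)) (D.r (D.e.symm i)) (digit w (D.e.symm i))

lemma Frame.word_apply {X : Finset (ι → S)} (D : Frame c X) (w : ℕ) (k : Fin 4) :
    D.word w (D.e k) = letter c (D.q k) (D.r k) (digit w k) := by simp [Frame.word]

/-- Whether two word codes are equal, or dichotomous and not a twin pair. -/
def sameOk (u v : ℕ) : Bool :=
  let x := u ^^^ v
  let s := digit x 0 + digit x 1 + digit x 2 + digit x 3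
  s == 0 || (s != 1 && (digit x 0 == 1 || digit x 1 == 1 || digit x 2 == 1 || digit x 3 == 1))

/-- Whether two word codes are distinct and do not differ in just one position, by
noncomplementary letters. -/
def crossOk (u v : ℕ) : Bool :=
  let x := u ^^^ v
  let p := fun i => bif digit x i == 0 then 0 else 1
  digit x 0 + digit x 1 + digit x 2 + digit x 3 == 1 || Nat.ble 2 (p 0 + p 1 + p 2 + p 3)

lemma Frame.eq_iff (hc : Function.Involutive c) (hf : ∀ s, c s ≠ s) {X : Finset (ι → S)}
    (D : Frame c X) (u v : ℕ) (k : Fin 4) :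
    D.word v (D.e k) = D.word u (D.e k) ↔ digit (u ^^^ v) k = 0 := by
  rw [D.word_apply, D.word_apply, digit_xor, Nat.xor_eq_zero_iff]
  exact ⟨fun h => (letter_inj hc hf (D.ne k) (D.ne_compl k) (digit_lt _ _) (digit_lt _ _) h).symm,
    fun h => by rw [h]⟩

lemma Frame.compl_iff (hc : Function.Involutive c) (hf : ∀ s, c s ≠ s) {X : Finset (ι → S)}
    (D : Frame c X) (u v : ℕ) (k : Fin 4) :
    D.word v (D.e k) = c (D.word u (D.e k)) ↔ digit (u ^^^ v) k = 1 := by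
  rw [D.word_apply, D.word_apply, digit_xor, ← letter_xor_one hc _ _ (digit_lt _ _)]
  have hx : ∀ a < 4, a ^^^ 1 < 4 := by decide
  have hy : ∀ a < 4, ∀ b < 4, b = a ^^^ 1 ↔ a ^^^ b = 1 := by decide
  rw [← hy _ (digit_lt _ _) _ (digit_lt _ _)]
  exact ⟨letter_inj hc hf (D.ne k) (D.ne_compl k) (digit_lt _ _) (hx _ (digit_lt _ _)),
    fun h => by rw [h]⟩

lemma Frame.sameOk (hc : Function.Involutive c) (hf : ∀ s, c s ≠ s) {X : Finset (ι → S)}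
    (D : Frame c X) {u v : ℕ} (hd : D.word u ≠ D.word v → ∃ j, D.word v j = c (D.word u j))
    (ht : ¬ TwinOn c Finset.univ (D.word u) (D.word v)) : sameOk u v = true := by
  have heq := D.eq_iff hc hf u v
  have hco := D.compl_iff hc hf u v
  by_cases h : D.word u = D.word v
  · have h0 : ∀ k : Fin 4, digit (u ^^^ v) k = 0 := fun k => (heq k).1 (by rw [h])
    have a := h0 0; have b := h0 1; have d := h0 2; have e := h0 3
    simp only [Fin.val_zero, Fin.val_one, Fin.val_two, show ((3 : Fin 4) : ℕ) = 3 from rfl]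
      at a b d e
    simp [_root_.sameOk, a, b, d, e]
  obtain ⟨j, hj⟩ := hd h
  obtain ⟨j, rfl⟩ := D.e.surjective j
  rw [hco] at hj
  have hne : ¬ ∀ k, k ≠ j → digit (u ^^^ v) (k : Fin 4) = 0 := by
    intro h0
    refine ht ⟨D.e j, Finset.mem_univ _, (hco j).2 hj, fun i _ hi => ?_⟩
    obtain ⟨k, rfl⟩ := D.e.surjective i
    exact (heq k).2 (h0 k fun e => hi (by rw [e]))
  simp only [_root_.sameOk, Bool.or_eq_true, Bool.and_eq_true, beq_iff_eq, bne_iff_ne]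
  simp only [Fin.forall_fin_succ] at hne
  fin_cases j <;> simp at hj hne <;> exact Or.inr ⟨fun hs => by omega, by simp [hj]⟩

lemma Frame.crossOk (hc : Function.Involutive c) (hf : ∀ s, c s ≠ s) {X : Finset (ι → S)}
    (D : Frame c X) {u v : ℕ} (hne : D.word v ≠ D.word u)
    (hn : ∀ i, D.word v i ≠ D.word u i → D.word v i ≠ c (D.word u i) →
      (∀ k, k ≠ i → D.word v k = D.word u k) → False) : crossOk u v = true := by
  have heq := D.eq_iff hc hf u v
  have hco := D.compl_iff hc hf u v
  have h0 : ¬ ∀ k : Fin 4, digit (u ^^^ v) k = 0 := fun h => hne (funext fun i => by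
    obtain ⟨k, rfl⟩ := D.e.surjective i
    exact (heq k).2 (h k))
  have h1 : ∀ j : Fin 4, digit (u ^^^ v) j ≠ 0 → digit (u ^^^ v) j ≠ 1 →
      ¬ ∀ k, k ≠ j → digit (u ^^^ v) (k : Fin 4) = 0 := fun j a b h =>
    hn (D.e j) (fun e => a ((heq j).1 e)) (fun e => b ((hco j).1 e)) fun i hi => by
      obtain ⟨k, rfl⟩ := D.e.surjective i
      exact (heq k).2 (h k fun e => hi (by rw [e]))
  simp only [Fin.forall_fin_succ] at h0 h1
  simp at h0 h1
  simp only [_root_.crossOk, Bool.or_eq_true, beq_iff_eq, Nat.ble_eq]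
  generalize digit (u ^^^ v) 0 = a at *
  generalize digit (u ^^^ v) 1 = b at *
  generalize digit (u ^^^ v) 2 = d at *
  generalize digit (u ^^^ v) 3 = e at *
  clear heq hco
  rcases Nat.eq_zero_or_pos a with ha | ha <;> rcases Nat.eq_zero_or_pos b with hb | hb <;>
    rcases Nat.eq_zero_or_pos d with hd | hd <;> rcases Nat.eq_zero_or_pos e with he | he <;>
    simp_all [Nat.pos_iff_ne_zero, cond_eq_ite]

end

/-- Codes whose digits are all `0` or `3`. -/
def masks : List ℕ := [0, 3, 12, 15, 48, 51, 60, 63, 192, 195, 204, 207, 240, 243, 252, 255]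

lemma exists_mask (b : Fin 4 → Bool) :
    ∃ m ∈ masks, ∀ k : Fin 4, digit m k = bif b k then 3 else 0 := by
  revert b; decide +kernel

/-- The words of the other code that may be contained in the box spanned by `v` and `v ^^^ δ`,
given the words `A` of the code of `v` and the words `B` of the other code. -/
def grow (A B : List ℕ) (v δ : ℕ) : List ℕ :=
  (masks.map fun m => v ^^^ (δ &&& m)).filter fun w => B.all (sameOk · w) && A.all (crossOk · w)

/-- A forest of branchings: `node s v δ` branches over the words of one code in the box spanned by
the word `v` of the other one and `v ^^^ δ`, and `ref j g` refers to the `j`-th settled pair of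
sets of words, transformed by `g`. The constructors also carry the next tree in the forest. -/
inductive Forest
  | nil
  | ref (j g : ℕ) (next : Forest)
  | node (s : Bool) (v δ : ℕ) (kids next : Forest)

/-- The permutation of positions encoded in `g`. -/
def pos (g : ℕ) (k : Fin 4) : Fin 4 := Fin.ofNat 4 (digit g (3 * k))

/-- The image of the letter `n` at position `k` under the transformation encoded in `g`. -/
def relabel (g : ℕ) (k : Fin 4) (n : ℕ) : ℕ :=
  digit g (3 * k + (bif Nat.ble 2 n then 2 else 1)) ^^^ (n &&& 1)

/-- Whether `g` transforms all words in `A` into words in `B`. -/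
def embeds (g : ℕ) (A B : List ℕ) : Bool :=
  A.all fun x => B.any fun y =>
    [0, 1, 2, 3].all fun k : Fin 4 => digit y (pos g k) == relabel g k (digit x k)

/-- Whether `g` encodes a transformation. -/
def valid (g : ℕ) : Bool :=
  decide (Function.Injective (pos g)) &&
    [0, 1, 2, 3].all fun k : Fin 4 => relabel g k 2 != relabel g k 0 &&
      relabel g k 2 != relabel g k 1

/-- Checks that adding any of the words in `cs` to `A` (or to `B`, if `s`) leads to contradictions
or settled pairs only. -/
def Forest.check (T : List (List ℕ × List ℕ)) :
    Forest → List ℕ → List ℕ → Bool → List ℕ → Bool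
  | .nil, _, _, _, cs => cs.isEmpty
  | .ref j g next, A, B, s, cs =>
    match cs with
    | [] => true
    | w :: cs =>
      (match T[j]? with
        | none => false
        | some (A₀, B₀) => valid g && embeds g A₀ (bif s then A else w :: A) &&
            embeds g B₀ (bif s then w :: B else B)) && next.check T A B s cs
  | .node s' v δ kids next, A, B, s, cs =>
    match cs with
    | [] => true
    | w :: cs =>
      ([0, 1, 2, 3].all fun k => Nat.ble 2 (digit δ k)) &&
      (let A' := bif s then A else w :: A
       let B' := bif s then w :: B else B
       (bif s' then B'.elem v else A'.elem v) &&
        kids.check T A' B' (!s') (bif s' then grow B' A' v δ else grow A' B' v δ)) &&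
      next.check T A B s cs

lemma eq_or_xor_one_eq {a b n : ℕ} (ha : a < 4) (hb : b < 4) (hn : n < 4) (h : 2 ≤ b) :
    n ^^^ 1 = a ∨ n ^^^ 1 = a ^^^ b ∨ n = a ∨ n = a ^^^ b := by
  interval_cases b <;> interval_cases a <;> interval_cases n <;> simp at *

lemma eq_or_eq_xor_one {a b n : ℕ} (ha : a < 4) (hb : b < 4) (hn : n < 4) (h0 : b ≠ a)
    (h1 : b ≠ a ^^^ 1) : n = a ∨ n = a ^^^ 1 ∨ n = b ∨ n = b ^^^ 1 := by
  interval_cases b <;> interval_cases a <;> interval_cases n <;> simp at *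

section
open scoped Classical

variable {c : S → S} {ι : Type} [Fintype ι] {V W : Finset (ι → S)}

lemma Frame.exists_grow (hc : Function.Involutive c) (hf : ∀ s, c s ≠ s) (h : Good c V W)
    (h12 : V.card = 12) (D : Frame c (V ∪ W)) {A B : List ℕ} (hA : ∀ x ∈ A, D.word x ∈ V)
    (hB : ∀ x ∈ B, D.word x ∈ W) {v δ : ℕ} (hv : v ∈ A) (hδ : ∀ k : Fin 4, 2 ≤ digit δ k) :
    ∃ w ∈ grow A B v δ, D.word w ∈ W := by
  have hlt : ∀ a < 4, ∀ b < 4, a ^^^ b < 4 := by decide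
  have h2 : ∀ a < 4, ∀ b < 4, 2 ≤ b → a ^^^ b ≠ a ^^^ 1 := by decide
  let T : Fin 4 → Finset S := fun k => {letter c (D.q k) (D.r k) (digit v k),
    letter c (D.q k) (D.r k) (digit v k ^^^ digit δ k)}
  have hT : ∀ k, ∀ s ∈ T k, c s ∉ T k := fun k => consistent_pair hc hf (by
    rw [← letter_xor_one hc _ _ (digit_lt _ _)]
    exact fun e => h2 _ (digit_lt v k) _ (digit_lt δ k) (hδ k) (letter_inj hc hf (D.ne k)
      (D.ne_compl k) (hlt _ (digit_lt _ _) _ (digit_lt _ _)) (hlt _ (digit_lt _ _) _ (by decide))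
      e))
  have hn := h.null (fun i => ind c (T (D.e.symm i))) fun i => val_ind hc (hT _)
  have hpos : 0 < ∑ u ∈ V, pr (fun i => ind c (T (D.e.symm i))) Finset.univ u := by
    refine Finset.sum_pos' (fun u _ => Finset.prod_nonneg fun i _ => ind_nonneg _ _)
      ⟨_, hA v hv, Finset.prod_pos fun i _ => ?_⟩
    exact one_pos.trans_eq (ind_of_mem (by simp [T, Frame.word])).symm
  rw [hn] at hpos
  obtain ⟨w, hw, hw0⟩ := Finset.exists_ne_zero_of_sum_ne_zero hpos.ne'
  have hw' := Finset.prod_ne_zero_iff.1 hw0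
  have hmem : ∀ k, w (D.e k) ∈ T k := by
    intro k
    obtain ⟨n, hn4, e⟩ := D.mem w (Finset.mem_union_right _ hw) k
    have hk := hw' (D.e k) (Finset.mem_univ _)
    simp only [Equiv.symm_apply_apply] at hk
    have hcT : c (w (D.e k)) ∉ T k := fun h' => hk (ind_eq_zero (hT k) h')
    rw [e] at hcT ⊢
    rw [← letter_xor_one hc _ _ hn4] at hcT
    simp only [T, Finset.mem_insert, Finset.mem_singleton] at hcT ⊢
    push Not at hcT
    rcases eq_or_xor_one_eq (digit_lt v k) (digit_lt δ k) hn4 (hδ k) with e | e | e | e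
    · exact absurd (congrArg _ e) hcT.1
    · exact absurd (congrArg _ e) hcT.2
    · exact Or.inl (congrArg _ e)
    · exact Or.inr (congrArg _ e)
  obtain ⟨m, hm, hmb⟩ := exists_mask fun k =>
    decide (w (D.e k) ≠ letter c (D.q k) (D.r k) (digit v k))
  have hword : D.word (v ^^^ (δ &&& m)) = w := by
    funext i
    obtain ⟨k, rfl⟩ := D.e.surjective i
    have h3 : ∀ a < 4, a &&& 3 = a := by decide
    rw [D.word_apply, digit_xor, digit_and, hmb]
    by_cases he : w (D.e k) = letter c (D.q k) (D.r k) (digit v k)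
    · simp [he]
    · have := hmem k
      simp only [T, Finset.mem_insert, Finset.mem_singleton, he, false_or] at this
      simp only [he, ne_eq, not_false_eq_true, decide_true, cond_true, h3 _ (digit_lt δ k)]
      exact this.symm
  rw [← hword] at hw
  refine ⟨_, List.mem_filter.2 ⟨List.mem_map.2 ⟨m, hm, rfl⟩, ?_⟩, hw⟩
  rw [Bool.and_eq_true, List.all_eq_true, List.all_eq_true]
  refine ⟨fun u hu => D.sameOk hc hf (h.dichW _ (hB u hu) _ hw) (h.twinW _ (hB u hu) _ hw),
    fun u hu => D.crossOk hc hf ?_ fun i a b d => h.no_near hc hf h12 (hA u hu) hw a b d⟩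
  exact fun e => Finset.disjoint_left.1 h.disj (hA u hu) (e ▸ hw)

/-- The pair `(V, W)` contains the image of the pair `(A, B)` of lists of codes. -/
def Contains (V W : Finset (ι → S)) (c : S → S) (A B : List ℕ) : Prop :=
  ∃ D : Frame c (V ∪ W), (∀ x ∈ A, D.word x ∈ V) ∧ ∀ x ∈ B, D.word x ∈ W

/-- A frame only depends on the union of the two codes. -/
def Frame.swap (D : Frame c (V ∪ W)) : Frame c (W ∪ V) :=
  ⟨D.e, D.q, D.r, D.ne, D.ne_compl, Finset.union_comm V W ▸ D.mem⟩

lemma Contains.of_embeds (hc : Function.Involutive c) (hf : ∀ s, c s ≠ s) {A B A₀ B₀ : List ℕ}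
    (h : Contains V W c A B) {g : ℕ} (hg : valid g = true) (hA : embeds g A₀ A = true)
    (hB : embeds g B₀ B = true) : Contains V W c A₀ B₀ := by
  obtain ⟨D, hDA, hDB⟩ := h
  have hx4 : ∀ a < 4, ∀ b < 2, a ^^^ b < 4 := by decide
  have hlt : ∀ k n, relabel g k n < 4 := fun k n =>
    hx4 _ (digit_lt _ _) _ (Nat.lt_succ_of_le Nat.and_le_right)
  simp only [valid, Bool.and_eq_true, decide_eq_true_eq, List.all_cons, List.all_nil, bne_iff_ne,
    and_true] at hg
  obtain ⟨hinj, hg⟩ := hg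
  have hg : ∀ k : Fin 4, relabel g k 2 ≠ relabel g k 0 ∧ relabel g k 2 ≠ relabel g k 1 := by
    intro k; fin_cases k <;> simp_all
  let L : Fin 4 → ℕ → S := fun k => letter c (D.q (pos g k)) (D.r (pos g k))
  have r1 : ∀ k, relabel g k 1 = relabel g k 0 ^^^ 1 := fun k => by
    simp [relabel, show Nat.ble 2 0 = false from rfl, show Nat.ble 2 1 = false from rfl]
  have r3 : ∀ k, relabel g k 3 = relabel g k 2 ^^^ 1 := fun k => by
    simp [relabel, show Nat.ble 2 2 = true from rfl, show Nat.ble 2 3 = true from rfl]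
  have hL : ∀ k n, n < 4 → letter c (L k (relabel g k 0)) (L k (relabel g k 2)) n =
      L k (relabel g k n) := by
    intro k n hn
    have h0 := letter_xor_one hc (D.q (pos g k)) (D.r (pos g k)) (hlt k 0)
    have h2 := letter_xor_one hc (D.q (pos g k)) (D.r (pos g k)) (hlt k 2)
    interval_cases n
    · rfl
    · rw [r1]; exact h0.symm
    · rfl
    · rw [r3]; exact h2.symm
  have hLne : ∀ k m n, m < 4 → n < 4 → m ≠ n → L k m ≠ L k n := fun k m n hm hn hne e =>
    hne (letter_inj hc hf (D.ne _) (D.ne_compl _) hm hn e)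
  have hsurj : ∀ k, ∀ n < 4, ∃ m < 4, relabel g k m = n := by
    intro k n hn
    rcases eq_or_eq_xor_one (hlt k 0) (hlt k 2) hn (hg k).1 (r1 k ▸ (hg k).2) with e | e | e | e
    exacts [⟨0, by norm_num, e.symm⟩, ⟨1, by norm_num, by rw [e, r1]⟩, ⟨2, by norm_num, e.symm⟩,
      ⟨3, by norm_num, by rw [e, r3]⟩]
  let D' : Frame c (V ∪ W) :=
    { e := (Equiv.ofBijective _ (Finite.injective_iff_bijective.1 hinj)).trans D.e
      q := fun k => L k (relabel g k 0)
      r := fun k => L k (relabel g k 2)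
      ne := fun k => hLne k _ _ (hlt _ _) (hlt _ _) (hg k).1
      ne_compl := fun k => by
        have := hL k 1 (by norm_num)
        simp only [letter] at this
        rw [this]
        exact hLne k _ _ (hlt _ _) (hlt _ _) (hg k).2
      mem := fun x hx k => by
        obtain ⟨n, hn, e⟩ := D.mem x hx (pos g k)
        obtain ⟨m, hm, rfl⟩ := hsurj k n hn
        exact ⟨m, hm, by rw [hL k m hm]; exact e⟩ }
  have hword : ∀ {x y : ℕ}, ([0, 1, 2, 3].all fun k : Fin 4 =>
      digit y (pos g k) == relabel g k (digit x k)) = true → D'.word x = D.word y := by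
    intro x y hxy
    funext i
    obtain ⟨k, rfl⟩ := D'.e.surjective i
    rw [D'.word_apply]
    have : D'.e k = D.e (pos g k) := rfl
    rw [this, D.word_apply]
    refine (hL k _ (digit_lt _ _)).trans (congrArg _ ?_)
    simp only [List.all_cons, List.all_nil, Bool.and_eq_true, beq_iff_eq, and_true] at hxy
    fin_cases k <;> simp_all
  have tr : ∀ {P Q : List ℕ} {X : Finset (ι → S)}, embeds g P Q = true → (∀ x ∈ Q, D.word x ∈ X) →
      ∀ x ∈ P, D'.word x ∈ X := by
    intro P Q X hPQ hQ x hx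
    obtain ⟨y, hy, hxy⟩ := List.any_eq_true.1 (List.all_eq_true.1 hPQ x hx)
    rw [hword hxy]
    exact hQ y hy
  exact ⟨D', tr hA hDA, tr hB hDB⟩

lemma Forest.contains (hc : Function.Involutive c) (hf : ∀ s, c s ≠ s) (h : Good c V W)
    (h12 : V.card = 12) {A₀ B₀ : List ℕ} {T : List (List ℕ × List ℕ)}
    (hT : ∀ x ∈ T, Contains V W c x.1 x.2 → Contains V W c A₀ B₀) (f : Forest) :
    ∀ {A B : List ℕ} {s : Bool} {cs : List ℕ}, f.check T A B s cs = true → ∀ w ∈ cs,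
      Contains V W c (bif s then A else w :: A) (bif s then w :: B else B) →
      Contains V W c A₀ B₀ := by
  have h12' : W.card = 12 := h.null.card_eq ▸ h12
  induction f with
  | nil =>
    intro A B s cs hcs w hw
    simp only [Forest.check, List.isEmpty_iff] at hcs
    simp [hcs] at hw
  | ref j g next ih =>
    intro A B s cs hcs w hw hD
    match cs, hw with
    | w' :: cs, hw =>
      simp only [Forest.check, Bool.and_eq_true] at hcs
      rcases List.mem_cons.1 hw with rfl | hw
      · cases hj : T[j]? with
        | none => simp [hj] at hcs
        | some x =>
          simp only [hj, Bool.and_eq_true] at hcs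
          exact hT x (List.mem_of_getElem? hj)
            (hD.of_embeds hc hf hcs.1.1.1 hcs.1.1.2 hcs.1.2)
      · exact ih hcs.2 w hw hD
  | node s' v δ kids next ihk ihn =>
    intro A B s cs hcs w hw hD
    match cs, hw with
    | w' :: cs, hw =>
      simp only [Forest.check, Bool.and_eq_true] at hcs
      rcases List.mem_cons.1 hw with rfl | hw
      · obtain ⟨⟨hδ, hv, hk⟩, -⟩ := hcs
        generalize (bif s then A else w :: A) = A' at *
        generalize (bif s then w :: B else B) = B' at *
        have hδ : ∀ k : Fin 4, 2 ≤ digit δ k := by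
          simp only [List.all_cons, List.all_nil, Bool.and_eq_true, Nat.ble_eq, and_true] at hδ
          intro k; fin_cases k <;> simp_all
        obtain ⟨D, hA, hB⟩ := hD
        cases s'
        · simp only [cond_false, List.elem_eq_mem, decide_eq_true_eq, Bool.not_false] at hv hk
          obtain ⟨w, hw, hwW⟩ := D.exists_grow hc hf h h12 hA hB hv hδ
          exact ihk hk w hw ⟨D, hA, List.forall_mem_cons.2 ⟨hwW, hB⟩⟩
        · simp only [cond_true, List.elem_eq_mem, decide_eq_true_eq, Bool.not_true] at hv hk
          obtain ⟨w, hw, hwV⟩ := Frame.exists_grow hc hf h.symm h12' D.swap hB hA hv hδ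
          exact ihk hk w hw ⟨D, List.forall_mem_cons.2 ⟨hwV, hA⟩, hB⟩
      · exact ihn hcs.2 w hw hD

/-- Checks a list of pairs `(w :: A, B)` of sets of words with their trees. -/
def checkAll : List (List ℕ × List ℕ) → List (ℕ × List ℕ × List ℕ × Forest) → Bool
  | _, [] => true
  | T, (w, A, B, f) :: l => f.check T A B false [w] && checkAll ((w :: A, B) :: T) l

lemma checkAll_contains (hc : Function.Involutive c) (hf : ∀ s, c s ≠ s) (h : Good c V W)
    (h12 : V.card = 12) {A₀ B₀ : List ℕ} (l : List (ℕ × List ℕ × List ℕ × Forest)) :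
    ∀ {T : List (List ℕ × List ℕ)},
      (∀ x ∈ T, Contains V W c x.1 x.2 → Contains V W c A₀ B₀) → checkAll T l = true →
      ∀ x ∈ l, Contains V W c (x.1 :: x.2.1) x.2.2.1 → Contains V W c A₀ B₀ := by
  induction l with
  | nil => simp
  | cons y l ih =>
    intro T hT hl
    obtain ⟨w, A, B, f⟩ := y
    simp only [checkAll, Bool.and_eq_true] at hl
    have hy := fun hD => f.contains hc hf h h12 hT hl.1 w (by simp) hD
    exact List.forall_mem_cons.2 ⟨hy, ih (List.forall_mem_cons.2 ⟨hy, hT⟩) hl.2⟩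

end

/-- The words of the first code of the canonical pair. -/
def codeOne : List ℕ := [136, 24, 129, 17, 220, 188, 69, 37, 93, 91, 196, 194]

/-- The words of the second code of the canonical pair. -/
def codeTwo : List ℕ :=
  [238, 126, 231, 119, 52, 50, 173, 171, 211, 179, 74, 42]

/-- The search for all pairs of codes in four positions, modulo isomorphism. -/
def searchForest : List (ℕ × List ℕ × List ℕ × Forest) :=
  [(0, [6, 19, 26, 39, 69, 76, 89, 120, 129], [40, 142, 169, 186], .node false 120 190 (.node
      true 244 251 .nil (.node false 120 186 (.node false 39 170 (.node false 120 175 (.node false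
      26 235 (.node true 175 251 (.node false 120 235 (.node false 26 255 (.node true 246 234
      (.node false 76 175 (.ref 0 6518386 .nil) .nil) .nil) .nil) .nil) .nil) .nil) .nil) .nil)
      .nil)) .nil),
    (0, [6, 19, 26, 39, 76, 129, 222], [40, 142, 175, 236], .node true 175 234 (.node true 236
      191 (.ref 0 9059656 .nil) .nil) .nil),
    (0, [6, 19, 74, 99, 135, 146, 148], [168], .node false 0 234 (.node true 194 175 .nil (.node
      true 200 187 .nil (.node true 224 174 .nil (.node true 226 174 .nil (.node true 234 187 .nil
      .nil))))) .nil),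
    (0, [6, 19, 26, 96, 102, 167], [168], .node false 0 187 (.node true 56 175 (.node false 0
      235 (.node false 26 251 (.node true 227 186 (.node true 227 170 (.ref 2 8862092 .nil) .nil)
      .nil) (.node false 26 255 .nil .nil)) .nil) (.node true 59 190 .nil (.node true 176 174 .nil
      (.node true 179 190 (.node false 167 235 (.node true 111 174 .nil .nil) .nil) (.node true
      187 190 (.node false 26 175 (.node true 182 170 .nil .nil) .nil) .nil))))) .nil),
    (0, [6, 19, 74, 99, 154, 167], [168], .node false 19 251 (.node true 208 250 .nil (.node
      true 219 191 (.node true 219 238 .nil .nil) (.node true 216 254 (.node true 216 250 .nil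
      .nil) (.node true 224 186 (.node true 224 174 .nil .nil) (.node true 235 234 .nil .nil)))))
      .nil),
    (0, [6, 19, 74, 135, 146, 148], [168], .node true 168 251 (.ref 2 9316448 .nil) .nil),
    (0, [6, 19, 74, 99, 135, 148], [168], .node true 168 186 (.ref 3 9316448 .nil) .nil),
    (0, [6, 19, 26, 39], [40, 140], .node true 140 187 (.node false 183 191 (.node false 19 175
      (.node true 28 235 .nil (.node false 183 186 (.node false 26 187 (.node true 184 251 (.node
      true 159 238 (.node true 133 238 (.node true 140 235 (.node false 81 239 (.node false 39 254
      (.node false 6 255 (.node false 81 190 (.node true 233 235 (.node false 0 255 (.node false 6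
      235 (.node true 250 175 (.ref 7 3813921 .nil) .nil) .nil) .nil) .nil) .nil) .nil) .nil)
      .nil) .nil) .nil) (.node false 115 250 (.node false 6 239 (.node false 115 174 (.node false
      26 239 (.node false 115 191 (.node false 0 238 (.node true 209 255 (.node true 229 170
      (.node true 140 250 (.node true 246 191 (.node true 65 170 (.ref 7 2475939 .nil) .nil) .nil)
      .nil) .nil) .nil) .nil) .nil) .nil) .nil) .nil) (.node false 67 254 .nil .nil))) .nil)
      (.node true 13 250 .nil .nil)) .nil)) (.node true 59 254 .nil .nil)) .nil) .nil),
    (0, [6, 19, 72, 91, 154], [168], .node true 168 175 (.ref 4 9312432 .nil) .nil),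
    (0, [6, 19, 74, 154, 167], [168], .node true 168 251 (.ref 4 9316448 .nil) .nil),
    (0, [6, 19, 26, 99, 167], [168], .node true 168 250 (.ref 6 9331209 (.node true 168 234
      (.node true 168 254 .nil .nil) .nil)) .nil),
    (0, [6, 19, 74, 99, 154], [168], .node true 168 175 (.ref 6 9316448 (.node true 168 191 .nil
      (.node true 168 255 (.node true 168 239 .nil .nil) .nil))) .nil),
    (0, [6, 24, 33, 74, 149], [170], .node true 170 254 (.ref 5 8534409 .nil) .nil),
    (0, [6, 24, 33, 73, 149], [170], .node true 170 251 (.node true 170 234 .nil (.node true 170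
      234 (.ref 10 8796426 (.node true 170 254 (.node true 170 238 .nil .nil) .nil)) .nil)) .nil),
    (0, [6, 24, 104, 161], [170], .node true 170 239 (.node true 170 191 (.ref 10 9332761 .nil)
      (.ref 4 9058632 .nil)) .nil),
    (0, [6, 24, 33, 74], [170], .node true 170 250 (.node true 170 254 (.ref 9 8534409 .nil)
      (.node true 170 251 (.node true 170 254 .nil .nil) .nil)) .nil),
    (0, [6, 24, 149, 161], [170], .node true 170 239 (.ref 4 9066712 .nil) .nil),
    (0, [6, 19, 26, 167], [168], .node true 168 254 (.node true 168 251 (.ref 13 9331209 .nil)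
      (.ref 6 9331209 (.node true 168 238 (.node true 168 250 (.node true 168 235 (.node false 167
      238 (.node true 133 251 .nil (.node true 137 186 .nil (.node true 101 171 .nil (.node true
      105 186 .nil (.node true 69 251 .nil .nil))))) .nil) .nil) .nil) .nil))) .nil),
    (0, [6, 24, 96, 102], [170], .node true 170 191 (.node true 170 187 (.ref 14 9316680 (.node
      true 170 171 .nil (.node true 170 251 (.node true 170 235 .nil .nil) .nil))) .nil) .nil),
    (0, [6, 24, 106], [168], .node true 168 175 (.ref 4 9064995 .nil) .nil),
    (0, [6, 24, 104], [170], .node true 170 171 (.ref 5 9316448 (.node true 170 239 (.node true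
      170 251 (.node true 170 187 .nil .nil) (.ref 9 9066712 .nil)) (.ref 4 9308321 .nil))) .nil),
    (0, [6, 24, 149], [170], .node true 170 171 (.ref 4 9316448 (.node true 170 187 (.node true
      170 239 (.node true 170 251 (.node true 170 234 (.node true 170 254 (.node false 149 251
      (.node true 158 186 .nil (.node true 173 170 .nil (.node true 93 171 .nil (.node true 109
      175 .nil (.node true 110 175 .nil .nil))))) .nil) .nil) .nil) .nil) .nil) (.node true 170
      251 (.ref 8 9312290 (.ref 7 9312290 (.node true 170 250 (.ref 14 8796426 (.node true 170 254
      (.node true 170 238 .nil .nil) .nil)) .nil))) .nil))) .nil),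
    (0, [6, 24], [42], .node true 42 191 (.node true 42 187 (.node false 33 239 (.node true 13
      250 (.node true 13 170 .nil .nil) (.ref 14 13518938 (.node true 238 254 (.node false 0 174
      (.node true 140 187 (.node false 33 175 (.node true 238 170 (.ref 20 9316680 .nil) .nil)
      .nil) (.node true 142 191 (.node true 238 175 (.node false 177 175 (.ref 20 9324634 .nil)
      .nil) .nil) (.node true 172 254 .nil .nil))) .nil) (.node true 205 250 (.node true 205 254
      (.node true 205 187 (.node true 205 174 (.node true 205 171 (.node false 33 255 (.node false
      0 238 .nil (.node true 222 250 .nil .nil)) .nil) .nil) .nil) .nil) .nil) (.ref 14 13510984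
      .nil))))) (.node true 42 235 (.node true 42 251 .nil .nil) (.node true 42 171 .nil .nil)))
      (.node true 42 171 (.node true 42 235 (.node true 42 255 (.ref 18 9484681 .nil) .nil) .nil)
      (.node true 42 255 (.node true 42 235 (.ref 13 9593817 .nil) .nil) .nil))) .nil),
    (0, [6, 104], [136], .node true 136 175 (.ref 3 9327138 .nil) .nil),
    (0, [26, 98], [160], .node true 160 190 (.ref 4 9331552 .nil) .nil),
    (0, [6, 161], [42], .node true 42 235 (.ref 4 8799202 .nil) .nil),
    (0, [6, 24], [168], .node true 168 175 (.ref 5 9064995 .nil) .nil),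
    (0, [6, 104], [170], .node true 170 171 (.node true 170 186 (.ref 12 9316448 .nil) (.node
      true 170 239 (.ref 10 9050147 (.ref 9 9050379 .nil)) (.node true 170 186 (.ref 11 9308321
      .nil) .nil))) .nil),
    (0, [6, 24], [170], .node true 170 191 (.node true 170 171 (.ref 9 9050147 .nil) (.ref 6
      9316448 (.node true 170 171 (.ref 10 9316680 (.node true 170 187 .nil (.node false 24 170
      (.node true 58 251 (.node true 58 171 .nil .nil) (.node true 50 191 (.node true 50 235 .nil
      .nil) (.node true 184 191 (.node false 33 170 (.node true 43 238 .nil (.node false 135 171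
      (.node false 135 238 .nil .nil) .nil)) .nil) (.node true 176 175 (.node false 6 170 (.node
      true 46 250 .nil (.node true 44 254 .nil .nil)) .nil) (.node true 178 187 .nil .nil)))))
      .nil))) .nil))) .nil),
    (0, [26], [34], .node true 34 254 (.ref 6 9331552 (.ref 5 9994867 (.ref 4 10001608 .nil)))
      .nil),
    (0, [6], [40], .node true 40 175 (.ref 7 9327138 (.ref 4 9316680 (.ref 3 9064995 .nil)))
      .nil),
    (0, [106], [130], .node true 130 250 (.ref 7 10257313 (.ref 5 8784334 (.ref 3 10261408
      .nil))) .nil),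
    (0, [26], [160], .node true 160 190 (.ref 7 10016779 (.ref 4 9994851 (.ref 5 9331552 .nil)))
      .nil),
    (0, [26], [162], .node true 162 190 (.node true 162 175 (.node true 162 238 (.node true 162
      234 (.node true 162 251 (.ref 28 10355274 .nil) .nil) .nil) (.node true 162 171 (.ref 14
      9060963 .nil) (.node true 162 171 (.node true 162 251 (.node true 162 239 (.ref 27 9577035
      .nil) .nil) .nil) .nil))) (.node true 162 238 (.node true 162 171 (.node true 162 175 (.ref
      20 9316617 .nil) .nil) (.node true 162 171 (.node true 162 191 (.node true 162 234 (.node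
      true 162 255 (.node false 104 251 (.node true 99 191 .nil (.node true 91 254 .nil (.node
      true 171 254 .nil (.node true 155 187 .nil (.node true 147 235 .nil .nil))))) (.node true
      162 251 .nil .nil)) (.node true 162 250 .nil .nil)) (.node true 162 175 .nil .nil)) (.node
      true 162 175 (.ref 19 9316617 .nil) .nil)) (.ref 11 8530381 .nil))) (.ref 4 9331552 .nil)))
      .nil),
    (0, [6], [168], .node true 168 175 (.node true 168 187 (.node true 168 235 (.node true 168
      190 (.ref 25 9050352 .nil) .nil) (.node true 168 235 (.node true 168 190 (.node true 168 234
      (.ref 30 9073161 .nil) (.node true 168 186 (.node true 168 238 (.node true 168 250 .nil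
      .nil) .nil) (.ref 22 9050352 .nil))) .nil) (.node true 168 186 (.node true 168 238 (.ref 24
      9316448 .nil) (.node true 168 190 .nil (.ref 16 9316448 .nil))) .nil))) (.ref 5 9064995
      (.ref 5 9327138 .nil))) .nil),
    (0, [], [10], .node true 10 251 (.ref 5 9309345 (.ref 4 9312306 (.ref 5 9047265 (.ref 4
      9050163 (.ref 3 8600737 (.ref 2 8785138 .nil)))))) .nil),
    (0, [], [42], .node true 42 238 (.ref 5 9308490 (.ref 5 9316680 (.ref 4 9740815 (.ref 2
      8527074 (.ref 2 9051360 (.ref 1 9046131 .nil)))))) .nil),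
    (0, [], [], .node false 0 238 (.ref 1 9317472 (.ref 1 9312416 (.ref 1 9308337 (.ref 0
      9317472 (.ref 1 9051360 (.ref 1 9047281 (.ref 0 9124960 (.ref 1 8785122 (.ref 0 8861856
      (.ref 0 8599729 (.node true 238 239 (.ref 4 12993482 (.ref 4 9061325 (.ref 2 9115919 (.ref 4
      13517453 (.ref 2 13572362 (.ref 2 13510925 .nil)))))) .nil))))))))))) .nil)]

lemma checkAll_searchForest : checkAll [(codeOne, codeTwo)] searchForest = true := by
  decide +kernel

section
open scoped Classical

variable {c : S → S} {ι : Type} [Fintype ι] {V W : Finset (ι → S)}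

lemma Good.restrict (hf : ∀ s, c s ≠ s) (h : Good c V W) (J : Finset ι)
    (hJ : ∀ i ∉ J, ∀ x ∈ V ∪ W, ∀ y ∈ V ∪ W, y i = x i) :
    Set.InjOn J.restrict ((V ∪ W : Finset (ι → S)) : Set (ι → S)) ∧
      Good c (V.image J.restrict) (W.image J.restrict) := by
  have hinj : Set.InjOn J.restrict ((V ∪ W : Finset (ι → S)) : Set (ι → S)) := by
    intro x hx y hy e
    funext i
    by_cases hi : i ∈ J
    · exact congrFun e ⟨i, hi⟩
    · exact hJ i hi y hy x hx
  have hV : Set.InjOn J.restrict (V : Set (ι → S)) := hinj.mono (by simp)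
  have hW : Set.InjOn J.restrict (W : Set (ι → S)) := hinj.mono (by simp)
  have dich : ∀ X ⊆ V ∪ W, (∀ u ∈ X, ∀ v ∈ X, u ≠ v → ∃ j, v j = c (u j)) →
      ∀ u ∈ X.image J.restrict, ∀ v ∈ X.image J.restrict, u ≠ v → ∃ j, v j = c (u j) := by
    intro X hX hd u hu v hv huv
    obtain ⟨u, hu', rfl⟩ := Finset.mem_image.1 hu
    obtain ⟨v, hv', rfl⟩ := Finset.mem_image.1 hv
    obtain ⟨j, hj⟩ := hd u hu' v hv' fun e => huv (by rw [e])
    by_cases hjJ : j ∈ J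
    · exact ⟨⟨j, hjJ⟩, hj⟩
    · rw [hJ j hjJ u (hX hu') v (hX hv')] at hj
      exact absurd hj.symm (hf _)
  have twin : ∀ X ⊆ V ∪ W, (∀ u ∈ X, ∀ v ∈ X, ¬ TwinOn c Finset.univ u v) →
      ∀ u ∈ X.image J.restrict, ∀ v ∈ X.image J.restrict, ¬ TwinOn c Finset.univ u v := by
    intro X hX ht u hu v hv
    obtain ⟨u, hu', rfl⟩ := Finset.mem_image.1 hu
    obtain ⟨v, hv', rfl⟩ := Finset.mem_image.1 hv
    rintro ⟨j, -, hj, hne⟩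
    refine ht u hu' v hv' ⟨j, Finset.mem_univ _, hj, fun i _ hi => ?_⟩
    by_cases hiJ : i ∈ J
    · exact hne ⟨i, hiJ⟩ (Finset.mem_univ _) fun e => hi (congrArg Subtype.val e)
    · exact hJ i hiJ u (hX hu') v (hX hv')
  refine ⟨hinj, dich V Finset.subset_union_left h.dichV, dich W Finset.subset_union_right h.dichW,
    twin V Finset.subset_union_left h.twinV, twin W Finset.subset_union_right h.twinW, ?_, ?_⟩
  · rw [Finset.disjoint_left]
    intro x hx hx'
    obtain ⟨v, hv, rfl⟩ := Finset.mem_image.1 hx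
    obtain ⟨w, hw, e⟩ := Finset.mem_image.1 hx'
    have := hinj (Finset.mem_union_right _ hw) (Finset.mem_union_left _ hv) e
    exact Finset.disjoint_left.1 h.disj hv (this ▸ hw)
  · intro g hg
    rw [Finset.sum_image hV, Finset.sum_image hW]
    have hn := h.null (fun i => if hi : i ∈ J then g ⟨i, hi⟩ else fun _ => 1) fun i => by
      split_ifs
      · exact hg _
      · exact val_one
    have e : ∀ v : ι → S, pr (fun i => if hi : i ∈ J then g ⟨i, hi⟩ else fun _ => 1)
        Finset.univ v = pr g Finset.univ (J.restrict v) := by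
      intro v
      unfold pr
      rw [← Finset.prod_subset (Finset.subset_univ J) fun i _ hi => by simp [hi],
        ← Finset.prod_coe_sort J]
      exact Finset.prod_congr rfl fun i _ => by simp
    simpa only [e] using hn

lemma Good.contains (hc : Function.Involutive c) (hf : ∀ s, c s ≠ s) (h : Good c V W)
    (h12 : V.card = 12) (h4 : Fintype.card ι = 4) (q r : ι → S) (h1 : ∀ i, r i ≠ q i)
    (h2 : ∀ i, r i ≠ c (q i))
    (hl : ∀ i, ∀ x ∈ V ∪ W, x i = q i ∨ x i = c (q i) ∨ x i = r i ∨ x i = c (r i)) :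
    Contains V W c codeOne codeTwo := by
  obtain ⟨v, hv⟩ := Finset.card_pos.1 (show 0 < V.card by omega)
  have e := (Fintype.equivFinOfCardEq h4).symm
  have key : ∀ i, ∃ r', r' ≠ v i ∧ r' ≠ c (v i) ∧
      ∀ x ∈ V ∪ W, ∃ n < 4, x i = letter c (v i) r' n := by
    intro i
    have hqr : q i ≠ c (r i) := fun e => h2 i (by rw [e, hc])
    have hcc := hc.injective.ne (h1 i)
    have aux : ∀ r', (∀ x ∈ V ∪ W, x i = v i ∨ x i = c (v i) ∨ x i = r' ∨ x i = c r') →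
        ∀ x ∈ V ∪ W, ∃ n < 4, x i = letter c (v i) r' n := by
      intro r' h x hx
      rcases h x hx with e | e | e | e
      exacts [⟨0, by norm_num, e⟩, ⟨1, by norm_num, e⟩, ⟨2, by norm_num, e⟩, ⟨3, by norm_num, e⟩]
    rcases hl i v (Finset.mem_union_left _ hv) with e | e | e | e
    · refine ⟨r i, e ▸ h1 i, e ▸ h2 i, aux _ fun x hx => ?_⟩
      rw [e]; exact hl i x hx
    · refine ⟨r i, e ▸ h2 i, by rw [e, hc]; exact h1 i, aux _ fun x hx => ?_⟩
      rw [e, hc]; have := hl i x hx; tauto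
    · refine ⟨q i, e ▸ (h1 i).symm, e ▸ hqr, aux _ fun x hx => ?_⟩
      rw [e]; have := hl i x hx; tauto
    · refine ⟨q i, e ▸ hqr, by rw [e, hc]; exact (h1 i).symm, aux _ fun x hx => ?_⟩
      rw [e, hc]; have := hl i x hx; tauto
  choose r' a1 a2 a3 using key
  let D : Frame c (V ∪ W) := ⟨e, fun k => v (e k), fun k => r' (e k), fun k => a1 _, fun k => a2 _,
    fun x hx k => a3 _ x hx⟩
  have h0 : D.word 0 = v := by
    funext i
    obtain ⟨k, rfl⟩ := D.e.surjective i
    rw [D.word_apply]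
    have : ∀ k : Fin 4, digit 0 k = 0 := by intro k; simp [digit]
    rw [this]
    rfl
  refine checkAll_contains hc hf h h12 searchForest (T := [(codeOne, codeTwo)]) (by simp)
    checkAll_searchForest _ (List.getLast_mem (l := searchForest) (by simp [searchForest])) ?_
  refine ⟨D, ?_, ?_⟩
  · rintro x hx
    have hx : x = 0 := by simpa [searchForest] using hx
    rw [hx, h0]; exact hv
  · intro x hx
    simp [searchForest] at hx

/-- The four letter word with code `w` over the complementary pairs of `q k` and `r k`. -/
def spell (c : S → S) (q r : Fin 4 → S) (w : ℕ) (k : Fin 4) : S :=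
  letter c (q k) (r k) (digit w k)

lemma spell_inj (hc : Function.Involutive c) (hf : ∀ s, c s ≠ s) {q r : Fin 4 → S}
    (h1 : ∀ k, r k ≠ q k) (h2 : ∀ k, r k ≠ c (q k)) {u v : ℕ} (h : spell c q r u = spell c q r v)
    (k : Fin 4) : digit u k = digit v k :=
  letter_inj hc hf (h1 k) (h2 k) (digit_lt _ _) (digit_lt _ _) (congrFun h k)

lemma image_eq_of_contains (hc : Function.Involutive c) (hf : ∀ s, c s ≠ s) {X Y : Finset (ι → S)}
    (D : Frame c Y) {A : List ℕ} (hA : ∀ x ∈ A, D.word x ∈ X) (hle : X.card ≤ A.length)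
    (hd : A.Pairwise fun u v => ∃ k : Fin 4, digit u k ≠ digit v k) :
    ∀ x, x ∈ X ↔ ∃ w ∈ A, x = D.word w := by
  have hnd : (A.map D.word).Nodup := List.pairwise_map.2 <| hd.imp fun ⟨k, hk⟩ e => hk <|
    letter_inj hc hf (D.ne k) (D.ne_compl k) (digit_lt _ _) (digit_lt _ _) <| by
      rw [← D.word_apply, ← D.word_apply, e]
  have hsub : (A.map D.word).toFinset ⊆ X := by
    intro x hx
    obtain ⟨w, hw, rfl⟩ := List.mem_map.1 (List.mem_toFinset.1 hx)
    exact hA w hw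
  have := Finset.eq_of_subset_of_card_le hsub (by
    rw [List.toFinset_card_of_nodup hnd, List.length_map]; exact hle)
  intro x
  rw [← this, List.mem_toFinset, List.mem_map]
  simp only [eq_comm]

lemma codeOne_pairwise : codeOne.Pairwise fun u v => ∃ k : Fin 4, digit u k ≠ digit v k := by
  decide +kernel

lemma codeTwo_pairwise : codeTwo.Pairwise fun u v => ∃ k : Fin 4, digit u k ≠ digit v k := by
  decide +kernel

/-- The words of twelve word codes in at most six positions agree except in four positions, where
they are the words of the canonical pair. -/
theorem Good.exists_spell (hc : Function.Involutive c) (hf : ∀ s, c s ≠ s) (h : Good c V W)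
    (h12 : V.card = 12) (h6 : Fintype.card ι ≤ 6) :
    ∃ (e : Fin 4 → ι) (q r : Fin 4 → S), Function.Injective e ∧ (∀ k, r k ≠ q k) ∧
      (∀ k, r k ≠ c (q k)) ∧
      (∀ i, (∀ k, i ≠ e k) → ∀ x ∈ V ∪ W, ∀ y ∈ V ∪ W, y i = x i) ∧
      (∀ x, (∃ v ∈ V, v ∘ e = x) ↔ ∃ w ∈ codeOne, x = spell c q r w) ∧
      ∀ x, (∃ v ∈ W, v ∘ e = x) ↔ ∃ w ∈ codeTwo, x = spell c q r w := by
  let J : Finset ι := Finset.univ.filter fun i => ¬ ∀ x ∈ V ∪ W, ∀ y ∈ V ∪ W, y i = x i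
  have hJ : ∀ i ∉ J, ∀ x ∈ V ∪ W, ∀ y ∈ V ∪ W, y i = x i := by
    intro i hi
    by_contra hn
    exact hi (Finset.mem_filter.2 ⟨Finset.mem_univ _, hn⟩)
  obtain ⟨hinj, hg⟩ := h.restrict hf J hJ
  have hVi : Set.InjOn J.restrict (V : Set (ι → S)) := hinj.mono (by simp)
  have hWi : Set.InjOn J.restrict (W : Set (ι → S)) := hinj.mono (by simp)
  have hV : (V.image J.restrict).card = 12 := by rw [Finset.card_image_of_injOn hVi, h12]
  have hW : (W.image J.restrict).card = 12 := hg.null.card_eq ▸ hV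
  have key : ∀ i : J, ∃ q r, r ≠ q ∧ r ≠ c q ∧
      (∀ x ∈ V.image J.restrict ∪ W.image J.restrict, x i = q ∨ x i = c q ∨ x i = r ∨ x i = c r) ∧
      10 ≤ ((V.image J.restrict ∪ W.image J.restrict).filter
        (fun x => x i = q ∨ x i = c q)).card ∧
      10 ≤ ((V.image J.restrict ∪ W.image J.restrict).filter
        (fun x => x i = r ∨ x i = c r)).card := by
    intro i
    refine (hg.constant_or_two_pairs hc hf hV i).resolve_left fun hcon =>
      (Finset.mem_filter.1 i.2).2 fun x hx y hy => ?_
    have himg : ∀ x ∈ V ∪ W, J.restrict x ∈ V.image J.restrict ∪ W.image J.restrict := by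
      intro x hx
      rw [← Finset.image_union]
      exact Finset.mem_image_of_mem _ hx
    exact hcon _ (himg x hx) _ (himg y hy)
  choose q r h1 h2 hl hq hr using key
  have hcard : Fintype.card J = J.card := Fintype.card_coe J
  have hJ6 : J.card ≤ 6 := J.card_le_univ.trans h6
  have hJ5 : Fintype.card J ≠ 5 := fun e =>
    hg.not_certificate hc hf hV q r h1 h2 hl hq hr (e ▸ certificate_five)
  have hJ66 : Fintype.card J ≠ 6 := fun e =>
    hg.not_certificate hc hf hV q r h1 h2 hl hq hr (e ▸ certificate_six)
  have hJ3 : 4 ≤ Fintype.card J := by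
    by_contra hlt
    have := card_le_two_pow hc hf q r h2 Finset.univ _
      (fun i x hx => hl i x (Finset.mem_union_left _ hx)) fun u hu v hv huv => by
        simpa using hg.dichV u hu v hv huv
    rw [hV, Finset.card_univ] at this
    have := this.trans (Nat.pow_le_pow_right (n := 2) (by norm_num)
      (show Fintype.card J ≤ 3 by omega))
    omega
  obtain ⟨D, hA, hB⟩ := hg.contains hc hf hV (by omega) q r h1 h2 hl
  have hA := image_eq_of_contains hc hf D hA (by rw [hV]; rfl) codeOne_pairwise
  have hB := image_eq_of_contains hc hf D hB (by rw [hW]; rfl) codeTwo_pairwise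
  have hsp : ∀ (X : Finset (ι → S)) (l : List ℕ),
      (∀ x, x ∈ X.image J.restrict ↔ ∃ w ∈ l, x = D.word w) →
      ∀ x, (∃ v ∈ X, (v ∘ fun k => (D.e k : ι)) = x) ↔ ∃ w ∈ l, x = spell c D.q D.r w := by
    intro X l hX x
    constructor
    · rintro ⟨v, hv, rfl⟩
      obtain ⟨w, hw, e⟩ := (hX _).1 (Finset.mem_image_of_mem _ hv)
      exact ⟨w, hw, funext fun k => (congrFun e (D.e k)).trans (D.word_apply w k)⟩
    · rintro ⟨w, hw, rfl⟩
      obtain ⟨v, hv, e⟩ := Finset.mem_image.1 ((hX _).2 ⟨w, hw, rfl⟩)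
      exact ⟨v, hv, funext fun k => (congrFun e (D.e k)).trans (D.word_apply w k)⟩
  refine ⟨fun k => (D.e k : ι), D.q, D.r, Subtype.val_injective.comp D.e.injective, D.ne,
    D.ne_compl, fun i hi => hJ i fun hiJ => ?_, hsp V _ hA, hsp W _ hB⟩
  exact hi (D.e.symm ⟨i, hiJ⟩) (by simp)

end

section
open scoped Classical

variable {c : S → S} {d : ℕ} {V W : Set (Fin d → S)}

lemma mem_ESet {B : Set S} : B ∈ ESet c ↔ ∀ s, c s ∈ B ↔ s ∉ B := by
  refine forall_congr' fun s => ?_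
  change Xor _ _ ↔ _
  rw [xor_iff_not_iff]
  tauto

lemma ESet.compl_mem {B : Set S} (hB : B ∈ ESet c) : Bᶜ ∈ ESet c :=
  mem_ESet.2 fun s => not_congr (mem_ESet.1 hB s)

lemma exists_mem_ELetter [Fintype S] (hc : Function.Involutive c) (hf : ∀ s, c s ≠ s) (l : S) :
    ∃ B, B ∈ ELetter c l := by
  let e := Fintype.equivFin S
  have hB : {s | e s < e (c s)} ∈ ESet c := mem_ESet.2 fun s => by
    have : e s ≠ e (c s) := fun h => hf s (e.injective h).symm
    simp only [Set.mem_ofPred_eq, hc s, not_lt]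
    exact ⟨le_of_lt, fun h => lt_of_le_of_ne h this.symm⟩
  by_cases hl : l ∈ {s | e s < e (c s)}
  · exact ⟨_, hB, hl⟩
  · exact ⟨_, ESet.compl_mem hB, hl⟩

/-- Valuations are spanned by the indicators of the members of `ES`. -/
lemma Val.mem_of_forall_indicator_mem [Fintype S] (hc : Function.Involutive c)
    (hf : ∀ s, c s ≠ s) {N : Submodule ℚ (S → ℚ)}
    (hN : ∀ B ∈ ESet c, B.indicator 1 ∈ N) {f : S → ℚ} (h : Val c f) : f ∈ N := by
  obtain ⟨k, hk⟩ := h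
  have one : ∀ l : S, (1 : S → ℚ) ∈ N := fun l => by
    obtain ⟨B, hB, -⟩ := exists_mem_ELetter hc hf l
    rw [← Set.indicator_self_add_compl B 1]
    exact N.add_mem (hN B hB) (hN _ (ESet.compl_mem hB))
  have pair : ∀ l : S, Pi.single l (1 : ℚ) - Pi.single (c l) 1 ∈ N := fun l => by
    obtain ⟨B, hB, hl⟩ := exists_mem_ELetter hc hf l
    have hcl : c l ∉ B := fun h => (mem_ESet.1 hB l).1 h hl
    have hB' : {s | if s = l ∨ s = c l then s = c l else s ∈ B} ∈ ESet c := mem_ESet.2 fun s => by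
      have h1 : c s = l ↔ s = c l := hc.eq_iff
      have h2 : c s = c l ↔ s = l := hc.injective.eq_iff
      have h3 := mem_ESet.1 hB s
      have h4 := hf l
      simp only [Set.mem_ofPred_eq, h1, h2]
      by_cases a : s = l
      · subst a; simp [h4.symm]
      · by_cases b : s = c l
        · subst b; simp [h4]
        · simp only [a, b, h3, or_self, if_false]
    convert N.sub_mem (hN B hB) (hN _ hB') using 1
    funext s
    simp only [Pi.sub_apply, Pi.single_apply, Set.indicator_apply, Set.mem_ofPred_eq]
    by_cases a : s = l
    · subst a; simp [hl, (hf s).symm]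
    · by_cases b : s = c l
      · subst b; simp [hcl, hf l]
      · simp [a, b]
  rcases isEmpty_or_nonempty S with _ | ⟨⟨l⟩⟩
  · rw [Subsingleton.elim f 0]
    exact N.zero_mem
  have e : f = (k / 2) • 1 +
      (1 / 2 : ℚ) • ∑ l, f l • (Pi.single l (1 : ℚ) - Pi.single (c l) 1) := by
    funext s
    have h1 : ∀ l, s = c l ↔ c s = l := fun l => ⟨fun h => by rw [h, hc], fun h => by rw [← h, hc]⟩
    simp only [Pi.add_apply, Pi.smul_apply, Pi.one_apply, Finset.sum_apply, Pi.sub_apply,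
      Pi.single_apply, smul_eq_mul, mul_sub, Finset.sum_sub_distrib, mul_ite, mul_one, mul_zero,
      h1, Finset.sum_ite_eq, Finset.mem_univ, if_true]
    linarith [hk s]
  rw [e]
  exact N.add_mem (N.smul_mem _ (one l))
    (N.smul_mem _ (N.sum_mem fun l _ => N.smul_mem _ (pair l)))

/-- A member of the box realizes at most one of the words of a code. -/
lemma PolyboxCode.sum_pr_indicator (hV : PolyboxCode c V)
    {X : Finset (Fin d → S)} (hX : ∀ v, v ∈ X ↔ v ∈ V) {x : Fin d → Set S}
    (hx : ∀ i, x i ∈ ESet c) :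
    ∑ v ∈ X, pr (fun i => (x i).indicator 1) Finset.univ v =
      if x ∈ RealizeSet c V then (1 : ℚ) else 0 := by
  have key : ∀ v, pr (fun i => (x i).indicator (1 : S → ℚ)) Finset.univ v =
      if x ∈ Realize c v then 1 else 0 := fun v => by
    simp only [pr, Set.indicator_apply, Pi.one_apply, Finset.prod_ite_zero, Realize, ELetter,
      Set.mem_ofPred_eq, hx, true_and, Finset.mem_univ, forall_const, Finset.prod_const_one]
  simp only [key]
  split_ifs with h
  · obtain ⟨v, hv, hxv⟩ : ∃ v ∈ V, x ∈ Realize c v := by simpa [RealizeSet] using h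
    rw [Finset.sum_eq_single v, if_pos hxv]
    · intro w hw hwv
      refine if_neg fun hxw => ?_
      obtain ⟨j, hj⟩ := hV v hv w ((hX w).1 hw) hwv.symm
      have := (hxw j).2
      rw [hj, mem_ESet.1 (hx j)] at this
      exact this (hxv j).2
    · exact fun h => absurd ((hX v).2 hv) h
  · refine Finset.sum_eq_zero fun v hv => if_neg fun hxv => h ?_
    simp only [RealizeSet, Set.mem_iUnion]
    exact ⟨v, (hX v).1 hv, hxv⟩

/-- Equivalent codes have the same total valuation. -/
lemma EquivCodes.null [Fintype S] (hc : Function.Involutive c) (hf : ∀ s, c s ≠ s)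
    (hV : PolyboxCode c V) (hW : PolyboxCode c W) (h : EquivCodes c V W)
    {X Y : Finset (Fin d → S)} (hX : ∀ v, v ∈ X ↔ v ∈ V) (hY : ∀ v, v ∈ Y ↔ v ∈ W) :
    Null c X Y Finset.univ := by
  suffices H : ∀ (K : Finset (Fin d)) (g : Fin d → S → ℚ), (∀ i ∈ K, Val c (g i)) →
      (∀ i ∉ K, ∃ B ∈ ESet c, g i = B.indicator 1) →
      ∑ v ∈ X, pr g Finset.univ v = ∑ v ∈ Y, pr g Finset.univ v from
    fun g hg => H Finset.univ g (fun i _ => hg i) (by simp)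
  intro K
  induction K using Finset.induction with
  | empty =>
    intro g _ hg
    choose B hB e using fun i => hg i (Finset.notMem_empty i)
    obtain rfl : g = fun i => (B i).indicator 1 := funext e
    rw [hV.sum_pr_indicator hX hB, hW.sum_pr_indicator hY hB, h]
  | insert j K hj ih =>
    intro g hg hg'
    have split : ∀ f v, pr (Function.update g j f) Finset.univ v =
        f (v j) * pr g (Finset.univ.erase j) v := fun f v => by
      convert pr_update (Finset.mem_univ j) f
    let N : Submodule ℚ (S → ℚ) :=
      { carrier := {f | ∑ v ∈ X, pr (Function.update g j f) Finset.univ v =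
          ∑ v ∈ Y, pr (Function.update g j f) Finset.univ v}
        add_mem' := fun {a b} ha hb => by
          simp only [Set.mem_ofPred_eq, split, Pi.add_apply, add_mul, Finset.sum_add_distrib]
            at ha hb ⊢
          rw [ha, hb]
        zero_mem' := by simp [split]
        smul_mem' := fun t a ha => by
          simp only [Set.mem_ofPred_eq, split, Pi.smul_apply, smul_eq_mul, mul_assoc,
            ← Finset.mul_sum] at ha ⊢
          rw [ha] }
    have := (hg j (Finset.mem_insert_self j K)).mem_of_forall_indicator_mem hc hf (N := N)
      fun B hB => ih _ (fun i hi => by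
          rw [Function.update_of_ne (ne_of_mem_of_not_mem hi hj)]
          exact hg i (Finset.mem_insert_of_mem hi)) fun i hi => by
        by_cases e : i = j
        · subst e; exact ⟨B, hB, Function.update_self ..⟩
        · rw [Function.update_of_ne e]
          exact hg' i (by simp [e, hi])
    simpa [N] using this

end

section

/-- The words of `W₁`. -/
def wordsOne : List ℕ :=
  [136, 24, 129, 17, 172, 220, 188, 69, 37, 53, 90, 93, 91, 196, 194, 195]

/-- The words of `W₂`. -/
def wordsTwo : List ℕ :=
  [238, 126, 231, 119, 52, 53, 50, 172, 173, 171, 195, 211, 179, 74, 90, 42]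

variable {c : S → S}

lemma spell_const (l s : S) (w : ℕ) :
    spell c (fun _ => l) (fun _ => s) w = ![letter c l s (digit w 0), letter c l s (digit w 1),
      letter c l s (digit w 2), letter c l s (digit w 3)] := by
  funext k
  fin_cases k <;> rfl

lemma mem_Wone {l s : S} {x : Fin 4 → S} :
    x ∈ Wone c l s ↔ ∃ w ∈ wordsOne, x = spell c (fun _ => l) (fun _ => s) w := by
  simp [Wone, Cat, wordsOne, spell_const, digit, letter, or_assoc]

lemma mem_Wtwo {l s : S} {x : Fin 4 → S} :
    x ∈ Wtwo c l s ↔ ∃ w ∈ wordsTwo, x = spell c (fun _ => l) (fun _ => s) w := by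
  simp [Wtwo, Cat, wordsTwo, spell_const, digit, letter, or_assoc]

lemma mem_diff_iff_spell (hc : Function.Involutive c) (hf : ∀ s, c s ≠ s) {l s : S} (h1 : s ≠ l)
    (h2 : s ≠ c l) {A B : Set (Fin 4 → S)} {P Q R : List ℕ}
    (hA : ∀ x, x ∈ A ↔ ∃ w ∈ P, x = spell c (fun _ => l) (fun _ => s) w)
    (hB : ∀ x, x ∈ B ↔ ∃ w ∈ Q, x = spell c (fun _ => l) (fun _ => s) w)
    (hPR : ∀ w ∈ P, w ∈ Q ∨ w ∈ R) (hRP : ∀ w ∈ R, w ∈ P)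
    (hRQ : ∀ w ∈ R, ∀ u ∈ Q, ¬ ∀ k : Fin 4, digit w k = digit u k) (x : Fin 4 → S) :
    x ∈ A \ B ↔ ∃ w ∈ R, x = spell c (fun _ => l) (fun _ => s) w := by
  rw [Set.mem_sdiff, hA, hB]
  constructor
  · rintro ⟨⟨w, hw, rfl⟩, hx⟩
    exact ⟨w, (hPR w hw).resolve_left fun h => hx ⟨w, h, rfl⟩, rfl⟩
  · rintro ⟨w, hw, rfl⟩
    refine ⟨⟨w, hRP w hw, rfl⟩, ?_⟩
    rintro ⟨u, hu, h⟩
    exact hRQ w hw u hu (spell_inj hc hf (fun _ => h1) (fun _ => h2) h)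

lemma mem_Wone_diff (hc : Function.Involutive c) (hf : ∀ s, c s ≠ s) {l s : S} (h1 : s ≠ l)
    (h2 : s ≠ c l) (x : Fin 4 → S) : x ∈ Wone c l s \ (Wone c l s ∩ Wtwo c l s) ↔
      ∃ w ∈ codeOne, x = spell c (fun _ => l) (fun _ => s) w := by
  rw [Set.sdiff_self_inter]
  exact mem_diff_iff_spell hc hf h1 h2 (fun _ => mem_Wone) (fun _ => mem_Wtwo) (by decide)
    (by decide) (by decide +kernel) x

lemma mem_Wtwo_diff (hc : Function.Involutive c) (hf : ∀ s, c s ≠ s) {l s : S} (h1 : s ≠ l)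
    (h2 : s ≠ c l) (x : Fin 4 → S) : x ∈ Wtwo c l s \ (Wone c l s ∩ Wtwo c l s) ↔
      ∃ w ∈ codeTwo, x = spell c (fun _ => l) (fun _ => s) w := by
  rw [Set.inter_comm, Set.sdiff_self_inter]
  exact mem_diff_iff_spell hc hf h1 h2 (fun _ => mem_Wtwo) (fun _ => mem_Wone) (by decide)
    (by decide) (by decide +kernel) x

open scoped Classical in
/-- Any letter can be moved to any other by a bijection that respects complementation and fixes
all letters outside the two complementary pairs. -/
lemma exists_equiv_apply_eq (hc : Function.Involutive c) (hf : ∀ s, c s ≠ s) (a b : S) :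
    ∃ h : S ≃ S, (∀ x, h (c x) = c (h x)) ∧ h a = b ∧
      ∀ x, x ≠ a → x ≠ c a → x ≠ b → x ≠ c b → h x = x := by
  have hinv : Function.Involutive fun x =>
      if x = a then b else if x = c a then c b else if x = b then a else if x = c b then c a
      else x := fun x => by
    have := hf a
    have := hf b
    have := hc a
    have := hc b
    grind
  refine ⟨hinv.toPerm _, fun x => ?_, by simp, fun x h1 h2 h3 h4 => by simp [h1, h2, h3, h4]⟩
  have := hf a
  have := hf b
  have := hc a
  have := hc b
  have := hc x
  simp only [Function.Involutive.coe_toPerm]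
  grind

lemma exists_equiv_apply_eq₂ (hc : Function.Involutive c) (hf : ∀ s, c s ≠ s) {q r l s : S}
    (h1 : r ≠ q) (h2 : r ≠ c q) (h3 : s ≠ l) (h4 : s ≠ c l) :
    ∃ h : S ≃ S, (∀ x, h (c x) = c (h x)) ∧ h q = l ∧ h r = s := by
  obtain ⟨f, hfc, hfq, -⟩ := exists_equiv_apply_eq hc hf q l
  obtain ⟨g, hgc, hgr, hg⟩ := exists_equiv_apply_eq hc hf (f r) s
  have hne : f r ≠ l := fun e => h1 (f.injective (e.trans hfq.symm))
  have hne' : f r ≠ c l := fun e => h2 (f.injective (by rw [e, hfc, hfq]))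
  refine ⟨f.trans g, fun x => by simp [hfc, hgc], ?_, by simpa using hgr⟩
  rw [Equiv.trans_apply, hfq]
  exact hg l hne.symm (fun e => hne' (by rw [e, hc])) h3.symm fun e => h4 (by rw [e, hc])

lemma apply_letter {h : S → S} (hh : ∀ x, h (c x) = c (h x)) (q r : S) (n : ℕ) :
    h (letter c q r n) = letter c (h q) (h r) n := by
  unfold letter
  split <;> simp [hh]

end

theorem structure_of_twelve_word_codes {d : ℕ} [Fintype S] (c : S → S)
    (hinv : Function.Involutive c) (hfix : ∀ s, c s ≠ s)
    (hd : d = 4 ∨ d = 5 ∨ d = 6)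
    (V W : Set (Fin d → S))
    (hV : PolyboxCode c V) (hW : PolyboxCode c W)
    (hdisj : Disjoint V W) (heq : EquivCodes c V W)
    (hVt : NoTwinPair c V) (hWt : NoTwinPair c W)
    (hVcard : V.ncard = 12) (hWcard : W.ncard = 12)
    (hext : ∃ U : Set (Fin d → S), PartitionCode c U ∧ V ⊆ U) :
    ∃ (σ : Equiv.Perm (Fin d)) (h : Fin d → S ≃ S),
      (∀ i x, h i (c x) = c (h i x)) ∧
      ∃ l s : S, s ≠ l ∧ s ≠ c l ∧
      ∃ e : Fin 4 → Fin d, StrictMono e ∧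
      ∃ p : Fin d → S,
        (∀ v ∈ (fun v : Fin d → S => fun i => h i (v (σ i))) '' (V ∪ W),
          ∀ j, (∀ k, j ≠ e k) → v j = p j) ∧
        (fun v : Fin d → S => fun k : Fin 4 => v (e k)) ''
            ((fun v : Fin d → S => fun i => h i (v (σ i))) '' V) =
          Wone c l s \ (Wone c l s ∩ Wtwo c l s) ∧
        (fun v : Fin d → S => fun k : Fin 4 => v (e k)) ''
            ((fun v : Fin d → S => fun i => h i (v (σ i))) '' W) =
          Wtwo c l s \ (Wone c l s ∩ Wtwo c l s) := by
  classical
  have hV' : ∀ v, v ∈ (Set.toFinite V).toFinset ↔ v ∈ V := fun v => Set.Finite.mem_toFinset _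
  have hW' : ∀ v, v ∈ (Set.toFinite W).toFinset ↔ v ∈ W := fun v => Set.Finite.mem_toFinset _
  have hX : (Set.toFinite V).toFinset.card = 12 := by
    rw [← Set.ncard_eq_toFinset_card V]; exact hVcard
  generalize (Set.toFinite V).toFinset = X at hV' hX
  generalize (Set.toFinite W).toFinset = Y at hW'
  have good : Good c X Y :=
    { dichV := fun u hu v hv => hV u ((hV' u).1 hu) v ((hV' v).1 hv)
      dichW := fun u hu v hv => hW u ((hW' u).1 hu) v ((hW' v).1 hv)
      twinV := fun u hu v hv ⟨j, _, hj, h⟩ => hVt u ((hV' u).1 hu) v ((hV' v).1 hv)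
        ⟨j, hj, fun i => h i (Finset.mem_univ i)⟩
      twinW := fun u hu v hv ⟨j, _, hj, h⟩ => hWt u ((hW' u).1 hu) v ((hW' v).1 hv)
        ⟨j, hj, fun i => h i (Finset.mem_univ i)⟩
      disj := Finset.disjoint_left.2 fun v hv hw =>
        Set.disjoint_left.1 hdisj ((hV' v).1 hv) ((hW' v).1 hw)
      null := heq.null hinv hfix hV hW hV' hW' }
  obtain ⟨e, q, r, he, hq, hr, hout, hone, htwo⟩ :=
    good.exists_spell hinv hfix hX (by rw [Fintype.card_fin]; omega)
  have h4 : 4 ≤ d := by omega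
  have hmono : StrictMono (Fin.castLE h4) := Fin.strictMono_castLE h4
  let τ := (Equiv.ofInjective _ hmono.injective).symm.trans (Equiv.ofInjective e he)
  have hτ : ∀ k, τ.extendSubtype (Fin.castLE h4 k) = e k := fun k => by
    rw [Equiv.extendSubtype_apply_of_mem τ _ ⟨k, rfl⟩]
    simp only [τ, Equiv.trans_apply]
    rw [Equiv.ofInjective_symm_apply]
    rfl
  choose H Hc Hq Hr using fun k =>
    exists_equiv_apply_eq₂ hinv hfix (hq k) (hr k) (hq 0) (hr 0)
  let h : Fin d → S ≃ S := fun i => if hi : (i : ℕ) < 4 then H ⟨i, hi⟩ else Equiv.refl S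
  have hh : ∀ k, h (Fin.castLE h4 k) = H k := fun k => by simp [h]
  obtain ⟨v₀, hv₀⟩ : X.Nonempty := Finset.card_pos.1 (by omega)
  have himage : ∀ (A : Set (Fin d → S)) (Z : Finset (Fin d → S)) (R : List ℕ)
      (B : Set (Fin 4 → S)), (∀ v, v ∈ Z ↔ v ∈ A) →
      (∀ x, (∃ v ∈ Z, v ∘ e = x) ↔ ∃ w ∈ R, x = spell c q r w) →
      (∀ x, x ∈ B ↔ ∃ w ∈ R, x = spell c (fun _ => q 0) (fun _ => r 0) w) →
      (fun v : Fin d → S => fun k : Fin 4 => v (Fin.castLE h4 k)) ''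
        ((fun v : Fin d → S => fun i => h i (v (τ.extendSubtype i))) '' A) = B := by
    intro A Z R B hA hZ hB
    have hs : ∀ w, (fun k => H k (spell c q r w k)) = spell c (fun _ => q 0) (fun _ => r 0) w :=
      fun w => funext fun k => by simp only [spell, apply_letter (Hc k), Hq, Hr]
    ext x
    rw [hB, Set.image_image]
    simp only [hh, hτ]
    constructor
    · rintro ⟨v, hv, rfl⟩
      obtain ⟨w, hw, hvw⟩ := (hZ _).1 ⟨v, (hA v).2 hv, rfl⟩
      refine ⟨w, hw, ?_⟩
      rw [← hs, ← hvw]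
      rfl
    · rintro ⟨w, hw, rfl⟩
      obtain ⟨v, hv, hvw⟩ := (hZ _).2 ⟨w, hw, rfl⟩
      refine ⟨v, (hA v).1 hv, ?_⟩
      rw [← hs, ← hvw]
      rfl
  refine ⟨τ.extendSubtype, h, fun i x => ?_, q 0, r 0, hq 0, hr 0, Fin.castLE h4, hmono,
    fun i => h i (v₀ (τ.extendSubtype i)), ?_,
    himage V X codeOne _ hV' hone (mem_Wone_diff hinv hfix (hq 0) (hr 0)),
    himage W Y codeTwo _ hW' htwo (mem_Wtwo_diff hinv hfix (hq 0) (hr 0))⟩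
  · by_cases hi : (i : ℕ) < 4 <;> simp [h, hi, Hc]
  · rintro _ ⟨v, hv, rfl⟩ j hj
    refine congrArg (h j) (hout _ (fun k hk => hj k ?_) v₀ (Finset.mem_union_left _ hv₀) v ?_)
    · exact τ.extendSubtype.injective (hk.trans (hτ k).symm)
    · rwa [Finset.mem_union, hV', hW']
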